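/- For every integer n ≥ 3, n/φ(n) < e^γ · log(log(n)) + 2.50637/log(log(n)). -/

import Mathlib

section

open Complex Filter Topology Metric

lemma exists_entire_factor_pow {g : ℂ → ℂ} (hg : Differentiable ℂ g) (b : ℂ)
    (hb : analyticOrderAt g b ≠ ⊤) :
    ∃ h : ℂ → ℂ, Differentiable ℂ h ∧ (∀ v, g v = (v - b) ^ (analyticOrderNatAt g b) * h v) ∧
      h b ≠ 0 := by
  obtain ⟨h₀, hh₀, hb₀, he⟩ := ((hg.analyticAt b).analyticOrderAt_eq_natCast
    (n := analyticOrderNatAt g b)).1 (Nat.cast_analyticOrderNatAt hb).symm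
  set n := analyticOrderNatAt g b
  classical
  let h : ℂ → ℂ := fun v => if v = b then h₀ b else g v / (v - b) ^ n
  have hval : ∀ v, g v = (v - b) ^ n * h v := by
    intro v
    by_cases hv : v = b
    · subst hv
      have := he.self_of_nhds
      simpa [h] using this
    · have : (v - b) ^ n ≠ 0 := pow_ne_zero _ (sub_ne_zero.2 hv)
      simp only [h, hv, if_false]
      field_simp
  refine ⟨h, ?_, hval, by simpa [h] using hb₀⟩
  intro v
  by_cases hv : v = b
  · subst hv
    refine hh₀.differentiableAt.congr_of_eventuallyEq ?_
    filter_upwards [he] with w hw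
    by_cases hwv : w = v
    · simp [h, hwv]
    · have : (w - v) ^ n ≠ 0 := pow_ne_zero _ (sub_ne_zero.2 hwv)
      simp only [h, hwv, if_false, hw, smul_eq_mul]
      field_simp
  · have hne : (v - b) ^ n ≠ 0 := pow_ne_zero _ (sub_ne_zero.2 hv)
    have : DifferentiableAt ℂ (fun w => g w / (w - b) ^ n) v :=
      (hg v).div (by fun_prop) hne
    refine this.congr_of_eventuallyEq ?_
    filter_upwards [isOpen_ne.mem_nhds hv] with w hw
    simp only [h]; rw [if_neg hw]

lemma exists_entire_factor_finset {f : ℂ → ℂ} (hf : Differentiable ℂ f)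
    (hft : ∀ a, analyticOrderAt f a ≠ ⊤) (T : Finset ℂ) :
    ∃ g : ℂ → ℂ, Differentiable ℂ g ∧
      (∀ v, f v = (∏ a ∈ T, (v - a) ^ (analyticOrderNatAt f a)) * g v) ∧ ∀ a ∈ T, g a ≠ 0 := by
  classical
  induction T using Finset.induction_on with
  | empty => exact ⟨f, hf, by simp, by simp⟩
  | insert b T hb ih =>
    obtain ⟨g, hg, hfg, hgT⟩ := ih
    set P : ℂ → ℂ := fun v => ∏ a ∈ T, (v - a) ^ (analyticOrderNatAt f a)
    have hP : Differentiable ℂ P := by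
      intro v
      exact DifferentiableAt.fun_finsetProd fun i _ => by fun_prop
    have hPb : P b ≠ 0 := by
      refine Finset.prod_ne_zero_iff.2 fun a ha => pow_ne_zero _ (sub_ne_zero.2 ?_)
      rintro rfl; exact hb ha
    have hord : analyticOrderAt f b = analyticOrderAt g b := by
      have : f = P * g := funext hfg
      rw [this, analyticOrderAt_mul (hP.analyticAt b) (hg.analyticAt b),
        analyticOrderAt_eq_zero.2 (Or.inr hPb), zero_add]
    have hordN : analyticOrderNatAt g b = analyticOrderNatAt f b := by
      simp [analyticOrderNatAt, hord]
    obtain ⟨h, hh, hgh, hhb⟩ := exists_entire_factor_pow hg b (hord ▸ hft b)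
    refine ⟨h, hh, fun v => ?_, fun a ha => ?_⟩
    · rw [Finset.prod_insert hb, hfg v, hgh v, hordN]; ring
    · rcases Finset.mem_insert.1 ha with rfl | ha
      · exact hhb
      · have := hgT a ha
        rw [hgh a] at this
        exact right_ne_zero_of_mul this

lemma analyticOrderAt_ne_top_of_entire {f : ℂ → ℂ} (hf : Differentiable ℂ f) {c : ℂ}
    (hc : f c ≠ 0) (a : ℂ) : analyticOrderAt f a ≠ ⊤ := by
  refine AnalyticOnNhd.analyticOrderAt_ne_top_of_isPreconnected (U := Set.univ) (x := c)
    (fun z _ => hf.analyticAt z) isPreconnected_univ trivial trivial ?_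
  rw [analyticOrderAt_eq_zero.2 (Or.inr hc)]; simp

lemma finite_zeros_closedBall {f : ℂ → ℂ} (hf : Differentiable ℂ f) {c : ℂ}
    (hc : f c ≠ 0) (R : ℝ) : ({a : ℂ | f a = 0 ∧ ‖a‖ ≤ R}).Finite := by
  by_contra hinf
  obtain ⟨a, -, ha⟩ := Set.Infinite.exists_accPt_of_subset_isCompact hinf
    (isCompact_closedBall (0:ℂ) R) (fun x hx => by simpa using hx.2)
  have h2 : f =ᶠ[𝓝 a] 0 := by
    rcases (hf.analyticAt a).eventually_eq_zero_or_eventually_ne_zero with h | h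
    · exact h
    · exfalso
      rw [accPt_iff_frequently_nhdsNE] at ha
      exact ha (by filter_upwards [h] with z hz hz2; exact hz hz2.1)
  exact analyticOrderAt_ne_top_of_entire hf hc a (analyticOrderAt_eq_top.2 h2)

/-- A zero-free entire function bounded on a disc has small logarithmic derivative. -/
lemma norm_logDeriv_le_of_ne_zero {G : ℂ → ℂ} (hG : Differentiable ℂ G) {R M : ℝ} (hR : 0 < R)
    (hM : 0 < M) (h0 : G 0 = 1) (hne : ∀ v ∈ ball (0:ℂ) R, G v ≠ 0)
    (hb : ∀ v ∈ ball (0:ℂ) R, ‖G v‖ ≤ Real.exp M) {v : ℂ} (hv : ‖v‖ ≤ R / 4) :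
    ‖logDeriv G v‖ ≤ 8 * M / R := by
  have hd : DifferentiableOn ℂ (logDeriv G) (ball 0 R) := by
    have : DifferentiableOn ℂ (deriv G) (ball 0 R) := hG.differentiableOn.deriv isOpen_ball
    exact this.div hG.differentiableOn hne
  obtain ⟨L, hL0, hL⟩ := hd.isExactOn_ball.with_val_at 0 0
  have hexp : ∀ z ∈ ball (0:ℂ) R, G z = Complex.exp (L z) := by
    have hconst : ∀ z ∈ ball (0:ℂ) R, G z * Complex.exp (-L z) = G 0 * Complex.exp (-L 0) := by
      intro z hz
      refine (convex_ball (0:ℂ) R).is_const_of_fderivWithin_eq_zero (𝕜 := ℂ) 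
        (f := fun z => G z * Complex.exp (-L z)) ?_ ?_ hz (mem_ball_self hR)
      · intro w hw
        exact ((hG w).mul ((hL w hw).differentiableAt.neg.cexp)).differentiableWithinAt
      · intro w hw
        rw [fderivWithin_of_isOpen isOpen_ball hw]
        have hder : HasDerivAt (fun z => G z * Complex.exp (-L z)) 0 w := by
          have := (hG w).hasDerivAt.mul ((hL w hw).neg.cexp)
          refine this.congr_deriv ?_
          have h2 := hne w hw
          simp only [logDeriv_apply, Pi.neg_apply]
          field_simp
          ring
        ext
        simp [hder.hasFDerivAt.fderiv]
    intro z hz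
    have := hconst z hz
    rw [hL0, h0, neg_zero, Complex.exp_zero, mul_one, Complex.exp_neg] at this
    field_simp at this
    exact this
  have hLd : DifferentiableOn ℂ L (ball 0 R) := fun z hz =>
    (hL z hz).differentiableAt.differentiableWithinAt
  have hre : Set.MapsTo L (ball 0 R) {z | z.re ≤ M} := by
    intro z hz
    have := hb z hz
    rw [hexp z hz, Complex.norm_exp, Real.exp_le_exp] at this
    exact this
  have hLb : ∀ z, ‖z‖ ≤ R / 2 → ‖L z‖ ≤ 2 * M := by
    intro z hz
    have h1 := borelCaratheodory_zero hM hLd hre hR (z := z) (by simp; linarith) hL0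
    refine h1.trans ?_
    rw [div_le_iff₀ (by linarith)]
    nlinarith
  have hder : deriv L v = logDeriv G v := (hL v (by simp; linarith)).deriv
  rw [← hder]
  have := norm_deriv_le_of_forall_mem_sphere_norm_le (c := v) (R := R / 4) (C := 2 * M) (f := L)
    (by linarith) ?_ ?_
  · refine this.trans (le_of_eq ?_); field_simp; norm_num
  · refine DifferentiableOn.diffContOnCl ?_
    refine hLd.mono ?_
    rw [closure_ball _ (by linarith)]
    intro z hz
    have h1 : ‖z - v‖ ≤ R / 4 := by simpa [dist_eq_norm] using hz
    have h2 := norm_add_le (z - v) v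
    simp at h2 ⊢
    linarith
  · intro z hz
    have h1 : ‖z - v‖ = R / 4 := by simpa [dist_eq_norm] using hz
    have h2 := norm_add_le (z - v) v
    simp at h2
    exact hLb z (by linarith)

/-- The zeros of `f` of norm at most `R`, as a finset of the subtype of all zeros. -/
noncomputable def zerosUpTo (f : ℂ → ℂ) (R : ℝ) : Finset {a : ℂ // f a = 0} :=
  open Classical in
  if h : ({a : {a : ℂ // f a = 0} | ‖(a : ℂ)‖ ≤ R}).Finite then h.toFinset else ∅

lemma mem_zerosUpTo {f : ℂ → ℂ} (hf : Differentiable ℂ f) {c : ℂ} (hc : f c ≠ 0) {R : ℝ}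
    {a : {a : ℂ // f a = 0}} : a ∈ zerosUpTo f R ↔ ‖(a : ℂ)‖ ≤ R := by
  have h : ({a : {a : ℂ // f a = 0} | ‖(a : ℂ)‖ ≤ R}).Finite := by
    refine Set.Finite.of_finite_image (f := Subtype.val) ?_ Subtype.val_injective.injOn
    refine (finite_zeros_closedBall hf hc R).subset ?_
    rintro _ ⟨a, ha, rfl⟩
    exact ⟨a.2, ha⟩
  simp [zerosUpTo, dif_pos h]

lemma tendsto_zerosUpTo {f : ℂ → ℂ} (hf : Differentiable ℂ f) {c : ℂ} (hc : f c ≠ 0) :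
    Tendsto (zerosUpTo f) atTop atTop := by
  refine tendsto_atTop_finset_of_monotone ?_ fun a => ⟨‖(a:ℂ)‖, ?_⟩
  · intro R R' h a ha
    rw [mem_zerosUpTo hf hc] at ha ⊢
    exact ha.trans h
  · rw [mem_zerosUpTo hf hc]

/-- Hadamard's partial fraction expansion for entire functions of order less than one. -/
lemma tendsto_sum_zeros_logDeriv {f : ℂ → ℂ} (hf : Differentiable ℂ f) (h0 : f 0 = 1) {C : ℝ}
    (hgr : ∀ v, ‖f v‖ ≤ Real.exp (C * (1 + ‖v‖) ^ (3 / 4 : ℝ))) {v : ℂ} (hv : f v ≠ 0) :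
    Tendsto (fun R => ∑ a ∈ zerosUpTo f R, (analyticOrderNatAt f a : ℂ) / (v - a)) atTop
      (𝓝 (logDeriv f v)) := by
  classical
  have hc : f 0 ≠ 0 := by simp [h0]
  set K := max C 1 with hK
  have hK1 : 0 < K := lt_of_lt_of_le one_pos (le_max_right _ _)
  have key : ∀ R : ℝ, 1 ≤ R → 4 * ‖v‖ ≤ R →
      ‖logDeriv f v - ∑ a ∈ zerosUpTo f R, (analyticOrderNatAt f a : ℂ) / (v - a)‖ ≤
        8 * (K * (1 + 4 * R) ^ (3 / 4 : ℝ)) / R := by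
    intro R hR hvR
    have hR0 : 0 < R := by linarith
    obtain ⟨g, hg, hfg, hgT⟩ := exists_entire_factor_finset hf
      (analyticOrderAt_ne_top_of_entire hf hc) ((zerosUpTo f R).map (Function.Embedding.subtype _))
    simp only [Finset.prod_map, Function.Embedding.subtype_apply, Finset.mem_map] at hfg hgT
    have hmem : ∀ a, f a = 0 → ‖a‖ ≤ R → g a ≠ 0 := fun a ha hR =>
      hgT a ⟨⟨a, ha⟩, (mem_zerosUpTo hf hc).2 hR, rfl⟩
    set P : ℂ → ℂ := fun v => ∏ a ∈ zerosUpTo f R, (v - a) ^ (analyticOrderNatAt f a)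
    have hPg0 : P 0 * g 0 = 1 := by rw [← hfg, h0]
    have hg0 : g 0 ≠ 0 := right_ne_zero_of_mul (hPg0 ▸ one_ne_zero)
    have hPv : P v ≠ 0 := by
      have := hfg v ▸ hv
      exact left_ne_zero_of_mul this
    have hgv : g v ≠ 0 := by
      have := hfg v ▸ hv
      exact right_ne_zero_of_mul this
    have hlog : logDeriv f v = ∑ a ∈ zerosUpTo f R, (analyticOrderNatAt f a : ℂ) / (v - a) +
        logDeriv g v := by
      have hPd : DifferentiableAt ℂ P v := by
        exact DifferentiableAt.fun_finsetProd fun i _ => by fun_prop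
      have hfe : logDeriv f v = logDeriv (fun v => P v * g v) v :=
        congrArg (fun h => logDeriv h v) (funext hfg)
      rw [hfe, logDeriv_mul v hPv hgv hPd (hg v)]
      congr 1
      have hne : ∀ a ∈ zerosUpTo f R, (v - a) ^ (analyticOrderNatAt f a) ≠ 0 :=
        Finset.prod_ne_zero_iff.1 hPv
      have := logDeriv_prod (𝕜 := ℂ) (s := zerosUpTo f R)
        (f := fun a v => (v - (a:ℂ)) ^ (analyticOrderNatAt f a)) (x := v) hne
        (fun i _ => by fun_prop)
      rw [this]
      refine Finset.sum_congr rfl fun a _ => ?_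
      rw [logDeriv_fun_pow (by fun_prop)]
      simp [logDeriv_apply, div_eq_mul_inv]
    rw [hlog, add_sub_cancel_left]
    have hG : Differentiable ℂ (fun v => P 0 * g v) := fun z => (hg z).const_mul _
    have hP0 : P 0 ≠ 0 := left_ne_zero_of_mul (hPg0 ▸ one_ne_zero)
    have hGl : logDeriv (fun v => P 0 * g v) v = logDeriv g v := logDeriv_const_mul v _ hP0
    rw [← hGl]
    refine norm_logDeriv_le_of_ne_zero hG hR0 (by positivity) hPg0 ?_ ?_ (by linarith)
    · intro z hz
      refine mul_ne_zero hP0 ?_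
      intro hgz
      exact hmem z (by rw [hfg, hgz, mul_zero]) (by simpa using (mem_ball.1 hz).le) hgz
    · intro z hz
      have hmax := Complex.norm_le_of_forall_mem_frontier_norm_le (U := ball (0:ℂ) (4 * R))
        (f := fun v => P 0 * g v) (C := Real.exp (K * (1 + 4 * R) ^ (3 / 4 : ℝ)))
        isBounded_ball hG.diffContOnCl ?_ (z := z) ?_
      · exact hmax
      · intro w hw
        rw [frontier_ball _ (by linarith)] at hw
        have hw : ‖w‖ = 4 * R := by simpa using hw
        have hPP : ‖P 0‖ ≤ ‖P w‖ := by
          simp only [P, norm_prod, norm_pow]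
          refine Finset.prod_le_prod (fun _ _ => by positivity) fun a ha => ?_
          refine pow_le_pow_left₀ (norm_nonneg _) ?_ _
          have ha := (mem_zerosUpTo hf hc).1 ha
          have := norm_sub_norm_le w a
          simp only [zero_sub, norm_neg]
          linarith
        calc ‖P 0 * g w‖ ≤ ‖P w‖ * ‖g w‖ := by rw [norm_mul]; gcongr
          _ = ‖f w‖ := by rw [hfg w, norm_mul]
          _ ≤ _ := hgr w
          _ ≤ _ := by rw [hw]; gcongr; exact le_max_left _ _
      · refine subset_closure ?_
        refine ball_subset_ball (by linarith) hz
  rw [tendsto_iff_norm_sub_tendsto_zero]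
  have hlim : Tendsto (fun R : ℝ => 40 * K * R ^ (-(1 / 4) : ℝ)) atTop (𝓝 0) := by
    have := (tendsto_rpow_neg_atTop (y := 1 / 4) (by norm_num)).const_mul (40 * K)
    simpa using this
  refine squeeze_zero' (Eventually.of_forall fun _ => norm_nonneg _) ?_ hlim
  filter_upwards [eventually_ge_atTop 1, eventually_ge_atTop (4 * ‖v‖)] with R h1 h2
  rw [norm_sub_rev]
  refine (key R h1 h2).trans ?_
  have hR0 : 0 < R := by linarith
  have e1 : (1 + 4 * R) ^ (3 / 4 : ℝ) ≤ 5 * R ^ (3 / 4 : ℝ) := by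
    calc (1 + 4 * R) ^ (3 / 4 : ℝ) ≤ (5 * R) ^ (3 / 4 : ℝ) := by
          gcongr; linarith
      _ = 5 ^ (3 / 4 : ℝ) * R ^ (3 / 4 : ℝ) := Real.mul_rpow (by norm_num) hR0.le
      _ ≤ 5 * R ^ (3 / 4 : ℝ) := by
          gcongr
          calc (5:ℝ) ^ (3 / 4 : ℝ) ≤ 5 ^ (1:ℝ) :=
                Real.rpow_le_rpow_of_exponent_le (by norm_num) (by norm_num)
            _ = 5 := by simp
  rw [div_le_iff₀ hR0]
  have e2 : R ^ (-(1 / 4) : ℝ) * R = R ^ (3 / 4 : ℝ) := by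
    nth_rewrite 2 [← Real.rpow_one R]
    rw [← Real.rpow_add hR0]; norm_num
  calc 8 * (K * (1 + 4 * R) ^ (3 / 4 : ℝ)) ≤ 8 * (K * (5 * R ^ (3 / 4 : ℝ))) := by gcongr
    _ = 40 * K * (R ^ (-(1 / 4) : ℝ) * R) := by rw [e2]; ring
    _ = _ := by ring

end

section

open Complex Filter Topology Metric

lemma exists_entire_comp_sq {G : ℂ → ℂ} (hG : Differentiable ℂ G) (hev : ∀ z, G (-z) = G z) :
    ∃ H : ℂ → ℂ, Differentiable ℂ H ∧ ∀ z, H (z ^ 2) = G z := by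
  have hroot : ∀ a b : ℂ, a ^ 2 = b ^ 2 → G a = G b := by
    intro a b h
    rcases sq_eq_sq_iff_eq_or_eq_neg.1 h with h | h
    · rw [h]
    · rw [h, hev]
  have hsq : ∀ z : ℂ, (z ^ (1 / 2 : ℂ)) ^ 2 = z := fun z => by
    rw [← Complex.cpow_nat_mul]; simp
  refine ⟨fun z => G (z ^ (1 / 2 : ℂ)), ?_, fun z => hroot _ _ (by rw [hsq])⟩
  have hne : ∀ z : ℂ, z ≠ 0 → DifferentiableAt ℂ (fun z => G (z ^ (1 / 2 : ℂ))) z := by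
    intro z hz
    by_cases hs : z ∈ slitPlane
    · exact (hG _).comp z (differentiableAt_id.cpow_const hs)
    · have hs' : -z ∈ slitPlane := by
        rw [mem_slitPlane_iff] at hs ⊢
        push Not at hs
        left
        have : z.re ≠ 0 := fun h => hz (Complex.ext h hs.2)
        rw [neg_re]
        exact neg_pos.2 (lt_of_le_of_ne hs.1 this)
      have hd : DifferentiableAt ℂ (fun z : ℂ => G (I * (-z) ^ (1 / 2 : ℂ))) z :=
        (hG _).comp z ((differentiableAt_id.neg.cpow_const hs').const_mul I)
      refine hd.congr_of_eventuallyEq (Eventually.of_forall fun w => hroot _ _ ?_)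
      rw [hsq, mul_pow, hsq]; simp
  have hcont : ContinuousAt (fun z => G (z ^ (1 / 2 : ℂ))) 0 := by
    refine hG.continuous.continuousAt.comp ?_
    exact (continuousAt_cpow_zero_of_re_pos (z := 1 / 2) (by norm_num)).comp
      (f := fun z : ℂ => (z, (1 / 2 : ℂ))) (by fun_prop)
  intro z
  by_cases hz : z = 0
  · subst hz
    refine (analyticAt_of_differentiable_on_punctured_nhds_of_continuousAt ?_ hcont).differentiableAt
    filter_upwards [self_mem_nhdsWithin] with w hw using hne w hw
  · exact hne z hz

open HurwitzZeta in
lemma hurwitzEvenFEPair_f_modif_eq_norm {x : ℝ} (hx : 0 < x) :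
    (hurwitzEvenFEPair 0).f_modif x = (‖(hurwitzEvenFEPair 0).f_modif x‖ : ℂ) := by
  have key : ∀ y : ℝ, 0 < y → 1 ≤ evenKernel 0 y := by
    intro y hy
    have h := hasSum_int_evenKernel 0 hy
    have := le_hasSum h 0 (fun _ _ => by positivity)
    simpa using this
  have hex : ∃ r : ℝ, 0 ≤ r ∧ (hurwitzEvenFEPair 0).f_modif x = (r : ℂ) := by
    rcases lt_trichotomy x 1 with h | h | h
    · refine ⟨evenKernel 0 x - x ^ (-(1 / 2) : ℝ), ?_, ?_⟩
      · rw [evenKernel_functional_equation, ← evenKernel_eq_cosKernel_of_zero,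
          Real.rpow_neg hx.le, one_div (x ^ _)]
        have := key (1 / x) (by positivity)
        have h2 : 0 ≤ (x ^ (1 / 2 : ℝ))⁻¹ := by positivity
        nlinarith
      · simp [WeakFEPair.f_modif, hurwitzEvenFEPair, h, hx, not_lt.2 h.le]
    · exact ⟨0, le_rfl, by simp [WeakFEPair.f_modif, h]⟩
    · refine ⟨evenKernel 0 x - 1, by linarith [key x hx], ?_⟩
      simp [WeakFEPair.f_modif, hurwitzEvenFEPair, h, not_lt.2 h.le]
  obtain ⟨r, hr, h⟩ := hex
  rw [h, Complex.norm_real, Real.norm_of_nonneg hr]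

open HurwitzZeta MeasureTheory Set in
lemma norm_completedRiemannZeta₀_le {s : ℂ} {k : ℕ} (h1 : 1 / 2 ≤ s.re) (h2 : s.re ≤ 2 * k) :
    ‖completedRiemannZeta₀ s‖ ≤
      ‖completedRiemannZeta₀ (1 / 2 : ℝ)‖ + ‖completedRiemannZeta₀ ((2 * k : ℝ) : ℂ)‖ := by
  set m := (hurwitzEvenFEPair 0).f_modif with hm
  have hconv : ∀ w : ℂ, MellinConvergent m w := fun w =>
    ((hurwitzEvenFEPair 0).isStrongFEPair_toStrongFEPair.hasMellin w).1
  have hval : ∀ s, completedRiemannZeta₀ s = mellin m (s / 2) / 2 := fun s => rfl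
  have hnorm : ∀ w : ℂ, ∀ x ∈ Ioi (0:ℝ), ‖(x:ℂ) ^ (w - 1) • m x‖ = x ^ (w.re - 1) * ‖m x‖ := by
    intro w x hx
    rw [norm_smul, Complex.norm_cpow_eq_rpow_re_of_pos hx]; simp
  have hint : ∀ w : ℂ, IntegrableOn (fun x => x ^ (w.re - 1) * ‖m x‖) (Ioi (0:ℝ)) := fun w =>
    IntegrableOn.congr_fun (Integrable.norm (hconv w)) (hnorm w) measurableSet_Ioi
  have hle : ∀ w : ℂ, ‖mellin m w‖ ≤ ∫ x in Ioi (0:ℝ), x ^ (w.re - 1) * ‖m x‖ := by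
    intro w
    refine (norm_integral_le_integral_norm _).trans (le_of_eq ?_)
    exact setIntegral_congr_fun measurableSet_Ioi (hnorm w)
  have hreal : ∀ σ : ℝ, ‖mellin m σ‖ = ∫ x in Ioi (0:ℝ), x ^ (σ - 1) * ‖m x‖ := by
    intro σ
    have : mellin m σ = ((∫ x in Ioi (0:ℝ), x ^ (σ - 1) * ‖m x‖ : ℝ) : ℂ) := by
      rw [mellin, ← integral_complex_ofReal]
      refine setIntegral_congr_fun measurableSet_Ioi fun x hx => ?_
      rw [hm, hurwitzEvenFEPair_f_modif_eq_norm hx, ofReal_mul, ofReal_cpow (le_of_lt hx)]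
      simp
    rw [this, Complex.norm_real, Real.norm_of_nonneg]
    exact setIntegral_nonneg measurableSet_Ioi fun x hx => by
      have : (0:ℝ) < x := hx
      positivity
  have hmain : ‖mellin m (s / 2)‖ ≤ ‖mellin m ((1 / 4 : ℝ) : ℂ)‖ + ‖mellin m ((k : ℝ) : ℂ)‖ := by
    rw [hreal, hreal, ← integral_add]
    · refine (hle _).trans (setIntegral_mono_on (hint _) ?_ measurableSet_Ioi ?_)
      · have a := hint ((1 / 4 : ℝ) : ℂ)
        have b := hint ((k : ℝ) : ℂ)
        rw [ofReal_re] at a b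
        exact a.add b
      · intro x hx
        have hx0 : (0:ℝ) < x := hx
        have e : (s / 2).re = s.re / 2 := by simp
        rw [← add_mul, e]
        gcongr
        rcases le_total x 1 with h | h
        · have := Real.rpow_le_rpow_of_exponent_ge hx0 h (show (1 / 4 : ℝ) - 1 ≤ s.re / 2 - 1 by linarith)
          have h3 : 0 ≤ x ^ ((k:ℝ) - 1) := by positivity
          linarith
        · have := Real.rpow_le_rpow_of_exponent_le h (show s.re / 2 - 1 ≤ (k:ℝ) - 1 by linarith)
          have h3 : 0 ≤ x ^ ((1 / 4:ℝ) - 1) := by positivity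
          linarith
    · exact hint ((1 / 4 : ℝ) : ℂ)
    · exact hint ((k : ℝ) : ℂ)
  rw [hval, hval, hval, norm_div, norm_div, norm_div]
  have e1 : (((1 / 2 : ℝ) : ℂ) / 2) = ((1 / 4 : ℝ) : ℂ) := by push_cast; norm_num
  have e2 : (((2 * k : ℝ) : ℂ) / 2) = ((k : ℝ) : ℂ) := by push_cast; field_simp
  rw [e1, e2, ← add_div]
  gcongr

lemma exists_norm_completedRiemannZeta₀_two_mul_le :
    ∃ Z : ℝ, 0 ≤ Z ∧ ∀ k : ℕ, 1 ≤ k →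
      ‖completedRiemannZeta₀ ((2 * k : ℝ) : ℂ)‖ ≤ Z * (k - 1).factorial + 2 := by
  refine ⟨∑' n : ℕ, 1 / (n : ℝ) ^ 2, tsum_nonneg fun n => by positivity, fun k hk => ?_⟩
  have hk' : (1:ℝ) ≤ k := by exact_mod_cast hk
  set s : ℂ := ((2 * k : ℝ) : ℂ) with hs
  have hsk : s = ((2 * k : ℕ) : ℂ) := by rw [hs]; push_cast; ring
  have hs0 : s ≠ 0 := by rw [hs, ofReal_ne_zero]; positivity
  have hΓ : Gammaℝ s ≠ 0 := Gammaℝ_ne_zero_of_re_pos (by rw [hs, ofReal_re]; positivity)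
  have h1 : completedRiemannZeta s = riemannZeta s * Gammaℝ s := by
    rw [riemannZeta_def_of_ne_zero hs0]; field_simp
  have hz : ‖riemannZeta s‖ ≤ ∑' n : ℕ, 1 / (n : ℝ) ^ 2 := by
    have hsum : Summable fun n : ℕ => 1 / (n : ℝ) ^ (2 * k) :=
      Real.summable_one_div_nat_pow.2 (by omega)
    have hsum2 : Summable fun n : ℕ => 1 / (n : ℝ) ^ 2 :=
      Real.summable_one_div_nat_pow.2 (by omega)
    rw [hsk, zeta_nat_eq_tsum_of_gt_one (by omega)]
    have hn : ∀ n : ℕ, ‖(1 : ℂ) / (n : ℂ) ^ (2 * k)‖ = 1 / (n : ℝ) ^ (2 * k) := by intro n; simp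
    refine (norm_tsum_le_tsum_norm ?_).trans ?_
    · simpa only [hn] using hsum
    · simp only [hn]
      refine hsum.tsum_le_tsum (fun n => ?_) hsum2
      rcases Nat.eq_zero_or_pos n with rfl | hn
      · have : 2 * k ≠ 0 := by omega
        simp [this]
      · have : (1:ℝ) ≤ n := by exact_mod_cast hn
        have h2 : (n:ℝ) ^ 2 ≤ (n:ℝ) ^ (2 * k) := pow_le_pow_right₀ this (by omega)
        gcongr
  have hg : ‖Gammaℝ s‖ ≤ (k - 1).factorial := by
    have e : s / 2 = ((k - 1 : ℕ) : ℂ) + 1 := by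
      rw [hs]; push_cast [Nat.cast_sub hk]; ring
    rw [Gammaℝ_def, e, Complex.Gamma_nat_eq_factorial, norm_mul]
    have hpi : ‖(Real.pi : ℂ) ^ (-s / 2)‖ ≤ 1 := by
      rw [Complex.norm_cpow_eq_rpow_re_of_pos Real.pi_pos]
      refine Real.rpow_le_one_of_one_le_of_nonpos (by linarith [Real.pi_gt_three]) ?_
      have : (-s / 2).re = -k := by
        rw [hs, show -((2 * k : ℝ) : ℂ) / 2 = ((-k : ℝ) : ℂ) by push_cast; ring, ofReal_re]
      rw [this]; linarith
    calc _ ≤ 1 * ‖(((k - 1).factorial : ℕ) : ℂ)‖ := by gcongr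
      _ = _ := by simp
  have h2 : completedRiemannZeta₀ s = completedRiemannZeta s + 1 / s + 1 / (1 - s) := by
    rw [completedRiemannZeta_eq]; ring
  have h3 : ‖1 / s‖ ≤ 1 := by
    rw [hs, norm_div, Complex.norm_real, norm_one, Real.norm_of_nonneg (by positivity)]
    rw [div_le_one (by positivity)]; linarith
  have h4 : ‖1 / (1 - s)‖ ≤ 1 := by
    have : (1 - s) = ((1 - 2 * k : ℝ) : ℂ) := by rw [hs]; push_cast; ring
    rw [this, norm_div, Complex.norm_real, norm_one, Real.norm_eq_abs,
      abs_of_nonpos (by linarith), div_le_one (by linarith)]; linarith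
  rw [h2]
  calc ‖completedRiemannZeta s + 1 / s + 1 / (1 - s)‖
      ≤ ‖completedRiemannZeta s‖ + ‖1 / s‖ + ‖1 / (1 - s)‖ := norm_add₃_le
    _ ≤ ‖riemannZeta s‖ * ‖Gammaℝ s‖ + 1 + 1 := by rw [h1, norm_mul]; gcongr
    _ ≤ (∑' n : ℕ, 1 / (n : ℝ) ^ 2) * (k - 1).factorial + 1 + 1 := by gcongr
    _ = _ := by ring

lemma exists_norm_xi_le :
    ∃ C : ℝ, ∀ s : ℂ, 1 / 2 ≤ s.re →
      ‖1 + s * (s - 1) * completedRiemannZeta₀ s‖ ≤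
        Real.exp (C * (1 + ‖s * (s - 1)‖) ^ (3 / 4 : ℝ)) := by
  obtain ⟨Z, hZ, hZk⟩ := exists_norm_completedRiemannZeta₀_two_mul_le
  set A := ‖completedRiemannZeta₀ (1 / 2 : ℝ)‖ with hA
  have hA0 : 0 ≤ A := norm_nonneg _
  refine ⟨Real.log (Z + A + 3) + 48, fun s hs => ?_⟩
  set r := 1 + ‖s * (s - 1)‖ with hr
  have hr1 : 1 ≤ r := by rw [hr]; linarith [norm_nonneg (s * (s - 1))]
  set q := Real.sqrt r with hq
  have hq1 : 1 ≤ q := by rw [hq]; exact Real.one_le_sqrt.2 hr1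
  have hqq : q * q = r := Real.mul_self_sqrt (by linarith)
  have hsq : ‖s‖ ≤ 2 * q := by
    have h1 : ‖s‖ - 1 ≤ ‖s - 1‖ := by simpa using norm_sub_norm_le s 1
    have h2 : ‖s‖ * ‖s - 1‖ = q * q - 1 := by rw [hqq, hr, norm_mul]; ring
    by_contra hcon
    push Not at hcon
    nlinarith [norm_nonneg s]
  set k := ⌈s.re / 2⌉₊ + 1 with hk
  have hre : s.re ≤ ‖s‖ := re_le_norm s
  have hk1 : (k:ℝ) ≤ 3 * q := by
    have := Nat.ceil_lt_add_one (show 0 ≤ s.re / 2 by linarith)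
    rw [hk]; push_cast; linarith
  have hk2 : s.re ≤ 2 * k := by
    have := Nat.le_ceil (s.re / 2)
    rw [hk]; push_cast; linarith
  have hL := (norm_completedRiemannZeta₀_le hs hk2).trans (add_le_add_right (hZk k (by omega)) _)
  have hX : r ^ (3 / 4 : ℝ) = q * Real.sqrt q := by
    rw [hq, Real.sqrt_eq_rpow, Real.sqrt_eq_rpow, ← Real.rpow_mul (by linarith),
      ← Real.rpow_add (by linarith)]
    norm_num
  set X := r ^ (3 / 4 : ℝ) with hXdef
  have hsq1 : 1 ≤ Real.sqrt q := Real.one_le_sqrt.2 hq1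
  have hqX : q ≤ X := by rw [hX]; nlinarith
  have hX1 : 1 ≤ X := hq1.trans hqX
  have hfac : ((k - 1).factorial : ℝ) ≤ Real.exp (18 * X) := by
    have h1 : ((k - 1).factorial : ℝ) ≤ (k:ℝ) ^ k := by
      have : (k - 1).factorial ≤ k ^ k :=
        (Nat.factorial_le (Nat.sub_le k 1)).trans (Nat.factorial_le_pow k)
      exact_mod_cast this
    have hk0 : (0:ℝ) < k := by rw [hk]; positivity
    have hlog : Real.log k ≤ 6 * Real.sqrt q := by
      have : Real.log k ≤ Real.log (3 * q) := Real.log_le_log hk0 hk1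
      have h3 : Real.log (3 * q) = Real.log 3 + 2 * Real.log (Real.sqrt q) := by
        rw [Real.log_mul (by norm_num) (by linarith), Real.log_sqrt (x := q) (by linarith)]; ring
      have h4 := Real.log_le_sub_one_of_pos (show (0:ℝ) < 3 by norm_num)
      have h5 := Real.log_le_sub_one_of_pos (show (0:ℝ) < Real.sqrt q by linarith)
      linarith
    calc ((k - 1).factorial : ℝ) ≤ (k:ℝ) ^ k := h1
      _ = Real.exp (Real.log k * k) := by
        rw [← Real.rpow_natCast, Real.rpow_def_of_pos hk0]
      _ ≤ Real.exp (18 * X) := by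
        rw [Real.exp_le_exp, hX]
        calc Real.log k * k ≤ (6 * Real.sqrt q) * (3 * q) := by gcongr
          _ = _ := by ring
  have hrX : r ≤ Real.exp (2 * X) := by
    have h5 := Real.log_le_sub_one_of_pos (show (0:ℝ) < q by linarith)
    rw [← Real.exp_log (show 0 < r by linarith), Real.exp_le_exp, ← hqq,
      Real.log_mul (by linarith) (by linarith)]
    linarith
  have hE1 : 1 ≤ Real.exp (18 * X) := Real.one_le_exp (by linarith)
  have hexp : Real.exp ((Real.log (Z + A + 3) + 48) * X) ≥
      (Z + A + 3) * Real.exp (18 * X) * Real.exp (2 * X) := by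
    rw [ge_iff_le, ← Real.exp_log (show 0 < Z + A + 3 by linarith), ← Real.exp_add,
      ← Real.exp_add, Real.exp_le_exp, Real.log_exp]
    have : 0 ≤ Real.log (Z + A + 3) := Real.log_nonneg (by linarith)
    nlinarith
  refine le_trans ?_ hexp
  calc ‖1 + s * (s - 1) * completedRiemannZeta₀ s‖
      ≤ 1 + ‖s * (s - 1)‖ * ‖completedRiemannZeta₀ s‖ := by
        refine (norm_add_le _ _).trans ?_
        rw [norm_one, norm_mul (s * (s - 1))]
    _ ≤ 1 + ‖s * (s - 1)‖ * (A + (Z * (k - 1).factorial + 2)) := by gcongr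
    _ ≤ (1 + ‖s * (s - 1)‖) * (Z * (k - 1).factorial + (A + 3)) := by
        have := norm_nonneg (s * (s - 1))
        have h2 : 0 ≤ Z * ((k - 1).factorial : ℝ) := by positivity
        nlinarith
    _ ≤ r * (Z * Real.exp (18 * X) + (A + 3) * Real.exp (18 * X)) := by
        rw [← hr]; gcongr
        nlinarith
    _ ≤ Real.exp (2 * X) * (Z * Real.exp (18 * X) + (A + 3) * Real.exp (18 * X)) := by gcongr
    _ = _ := by ring

lemma exists_xiFun : ∃ F : ℂ → ℂ, Differentiable ℂ F ∧
    (∀ s, F (s * (s - 1)) = 1 + s * (s - 1) * completedRiemannZeta₀ s) ∧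
    ∃ C : ℝ, ∀ v, ‖F v‖ ≤ Real.exp (C * (1 + ‖v‖) ^ (3 / 4 : ℝ)) := by
  set G : ℂ → ℂ := fun w => 1 + (1 / 2 + w) * (1 / 2 + w - 1) * completedRiemannZeta₀ (1 / 2 + w)
  have hG : Differentiable ℂ G := by
    have : Differentiable ℂ fun w => completedRiemannZeta₀ (1 / 2 + w) :=
      differentiable_completedZeta₀.comp (by fun_prop)
    fun_prop
  have hev : ∀ z, G (-z) = G z := by
    intro z
    simp only [G]
    rw [← completedRiemannZeta₀_one_sub (1 / 2 + z)]
    ring_nf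
  obtain ⟨H, hH, hHG⟩ := exists_entire_comp_sq hG hev
  have hF : ∀ s : ℂ, H (s * (s - 1) + 1 / 4) = 1 + s * (s - 1) * completedRiemannZeta₀ s := by
    intro s
    have := hHG (s - 1 / 2)
    simp only [G] at this
    rw [show s * (s - 1) + 1 / 4 = (s - 1 / 2) ^ 2 by ring, this]
    ring_nf
  obtain ⟨C, hC⟩ := exists_norm_xi_le
  refine ⟨fun v => H (v + 1 / 4), hH.comp (by fun_prop), hF, C, fun v => ?_⟩
  obtain ⟨s, hs, hsv⟩ : ∃ s : ℂ, 1 / 2 ≤ s.re ∧ s * (s - 1) = v := by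
    have hw : ((v + 1 / 4) ^ (1 / 2 : ℂ)) ^ 2 = v + 1 / 4 := by
      rw [← Complex.cpow_nat_mul]; simp
    set w := (v + 1 / 4) ^ (1 / 2 : ℂ)
    rcases le_total 0 w.re with h | h
    · refine ⟨1 / 2 + w, by simp [h], ?_⟩
      linear_combination hw
    · refine ⟨1 / 2 - w, by simp [h], ?_⟩
      linear_combination hw
  have := hC s hs
  rwa [← hF s, hsv] at this

end

section

open Complex Filter Topology Metric

/-- The series `∑ (1/(k+1) - 1/(z+k+1))`, equal to `digamma (z+1) + γ`. -/
noncomputable def digammaSeries (z : ℂ) : ℂ := ∑' k : ℕ, z / ((k + 1) * (z + (k + 1)))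

lemma add_natCast_ne_zero {z : ℂ} (hz : 0 ≤ z.re) (k : ℕ) : z + ((k : ℂ) + 1) ≠ 0 := by
  intro h
  have := congrArg Complex.re h
  simp at this
  have : (0:ℝ) ≤ k := k.cast_nonneg
  linarith

lemma norm_digammaSeries_term_le {z : ℂ} (hz : 0 ≤ z.re) (k : ℕ) :
    ‖z / ((k + 1) * (z + (k + 1)))‖ ≤ ‖z‖ * (1 / ((k : ℝ) + 1) ^ 2) := by
  have h1 : ‖((k : ℂ) + 1)‖ = (k : ℝ) + 1 := by
    rw [show ((k : ℂ) + 1) = ((k + 1 : ℝ) : ℂ) by push_cast; ring, Complex.norm_real,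
      Real.norm_of_nonneg (by positivity)]
  have h2 : (k : ℝ) + 1 ≤ ‖z + (k + 1)‖ := by
    have := re_le_norm (z + (k + 1))
    simp at this
    linarith
  rw [norm_div, norm_mul, h1, div_eq_mul_one_div, sq]
  gcongr

lemma summable_one_div_succ_sq : Summable fun k : ℕ => 1 / ((k : ℝ) + 1) ^ 2 := by
  have := (summable_nat_add_iff 1).2 (Real.summable_one_div_nat_pow (p := 2).2 (by norm_num))
  simpa using this

lemma summable_digammaSeries {z : ℂ} (hz : 0 ≤ z.re) :
    Summable fun k : ℕ => z / ((k + 1) * (z + (k + 1))) :=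
  Summable.of_norm_bounded (summable_one_div_succ_sq.mul_left ‖z‖) (norm_digammaSeries_term_le hz)

lemma differentiableOn_digammaSeries : DifferentiableOn ℂ digammaSeries {z | 0 < z.re} := by
  intro z hz
  set U : Set ℂ := {w | 0 < w.re} ∩ ball 0 (‖z‖ + 1)
  have hU : IsOpen U := (isOpen_lt continuous_const continuous_re).inter isOpen_ball
  have hzU : z ∈ U := ⟨hz, by simp⟩
  have := differentiableOn_tsum_of_summable_norm (U := U)
    (F := fun (k : ℕ) (w : ℂ) => w / ((k + 1) * (w + (k + 1))))
    (summable_one_div_succ_sq.mul_left (‖z‖ + 1)) ?_ hU ?_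
  · exact ((this z hzU).differentiableAt (hU.mem_nhds hzU)).differentiableWithinAt
  · intro k w hw
    have h1 := add_natCast_ne_zero hw.1.le k
    have h2 : ((k:ℂ) + 1) ≠ 0 := Nat.cast_add_one_ne_zero k
    refine DifferentiableAt.differentiableWithinAt ?_
    refine DifferentiableAt.div (by fun_prop) (by fun_prop) (mul_ne_zero h2 h1)
  · intro k w hw
    refine (norm_digammaSeries_term_le hw.1.le k).trans ?_
    have : ‖w‖ ≤ ‖z‖ + 1 := by simpa using (mem_ball.1 hw.2).le
    gcongr

lemma digammaSeries_add_one {z : ℂ} (hz : 0 ≤ z.re) :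
    digammaSeries (z + 1) = digammaSeries z + 1 / (z + 1) := by
  have hz1 : 0 ≤ (z + 1).re := by simp; linarith
  have h1 := summable_digammaSeries hz
  have h2 := summable_digammaSeries hz1
  have hne := add_natCast_ne_zero hz
  have e : ∀ k : ℕ, (z + 1) / ((k + 1) * (z + 1 + (k + 1))) - z / ((k + 1) * (z + (k + 1))) =
      1 / (z + (k + 1)) - 1 / (z + ((k + 1 : ℕ) + 1)) := by
    intro k
    have a := hne k
    have b := hne (k + 1)
    have c : ((k:ℂ) + 1) ≠ 0 := Nat.cast_add_one_ne_zero k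
    push_cast at b ⊢
    rw [show z + 1 + ((k:ℂ) + 1) = z + (k + 1 + 1) by ring]
    field_simp
    ring
  have h3 : HasSum (fun k : ℕ => 1 / (z + ((k:ℂ) + 1)) - 1 / (z + (((k + 1 : ℕ) : ℂ) + 1)))
      (digammaSeries (z + 1) - digammaSeries z) := by
    have := h2.hasSum.sub h1.hasSum
    simp only [e] at this
    exact this
  have h4 := h3.tendsto_sum_nat
  have h5 : Tendsto (fun n : ℕ => 1 / (z + (((0:ℕ):ℂ) + 1)) - 1 / (z + ((n:ℂ) + 1))) atTop
      (𝓝 (1 / (z + (((0:ℕ):ℂ) + 1)) - 0)) := by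
    refine tendsto_const_nhds.sub ?_
    rw [tendsto_zero_iff_norm_tendsto_zero]
    refine squeeze_zero (fun _ => norm_nonneg _) (fun n => ?_) tendsto_one_div_add_atTop_nhds_zero_nat
    rw [norm_div, norm_one]
    have := re_le_norm (z + (n + 1))
    simp at this
    gcongr
    linarith
  have h6 := tendsto_nhds_unique (h4.congr fun n => Finset.sum_range_sub' _ n) h5
  simp at h6
  rw [sub_eq_iff_eq_add] at h6
  rw [h6]; ring

lemma digammaSeries_ofReal_mono {x y : ℝ} (hx : 0 ≤ x) (hxy : x ≤ y) :
    (digammaSeries x).re ≤ (digammaSeries y).re := by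
  have hx' : 0 ≤ (x : ℂ).re := by simpa
  have hy' : 0 ≤ (y : ℂ).re := by simpa using hx.trans hxy
  have h1 := Complex.hasSum_re (summable_digammaSeries hx').hasSum
  have h2 := Complex.hasSum_re (summable_digammaSeries hy').hasSum
  refine hasSum_le (fun k => ?_) h1 h2
  have e : ∀ t : ℝ, ((t : ℂ) / ((k + 1) * (t + (k + 1)))).re = t / ((k + 1) * (t + (k + 1))) := by
    intro t
    rw [← ofReal_re (t / ((k + 1) * (t + (k + 1))))]; push_cast; rfl
  rw [e, e, div_le_div_iff₀ (by positivity) (by positivity)]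
  have : (0:ℝ) ≤ k := k.cast_nonneg
  nlinarith [mul_le_mul_of_nonneg_left hxy (show (0:ℝ) ≤ (k + 1) * (k + 1) by positivity)]

/-- The derivative of `log Γ` on the reals is the digamma function. -/
lemma hasDerivAt_log_Gamma {x : ℝ} (hx : 0 < x) :
    HasDerivAt (Real.log ∘ Real.Gamma) (digamma x).re x ∧ (digamma x).im = 0 := by
  have hd : HasDerivAt Real.Gamma (deriv Real.Gamma x) x :=
    (Real.differentiableAt_Gamma fun m => by
      have : (0:ℝ) ≤ m := m.cast_nonneg
      linarith).hasDerivAt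
  have hdc : HasDerivAt Complex.Gamma (deriv Complex.Gamma x) (x : ℂ) :=
    (Complex.differentiableAt_Gamma _ fun m h => by
      have := congrArg Complex.re h
      have h2 : (0:ℝ) ≤ m := m.cast_nonneg
      simp at this
      linarith).hasDerivAt
  have h1 : HasDerivAt (fun y : ℝ => ((Real.Gamma y : ℝ) : ℂ)) (deriv Complex.Gamma x) x := by
    simpa only [Complex.Gamma_ofReal] using hdc.comp_ofReal
  have h2 : deriv Complex.Gamma x = ((deriv Real.Gamma x : ℝ) : ℂ) := h1.unique hd.ofReal_comp
  have h3 : digamma x = ((deriv Real.Gamma x / Real.Gamma x : ℝ) : ℂ) := by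
    rw [digamma_def, logDeriv_apply, h2, Complex.Gamma_ofReal]; push_cast; rfl
  rw [h3, ofReal_re, ofReal_im]
  exact ⟨hd.log (Real.Gamma_pos_of_pos hx).ne', rfl⟩

lemma digamma_mono {x y : ℝ} (hx : 0 < x) (hxy : x ≤ y) : (digamma x).re ≤ (digamma y).re := by
  rcases hxy.eq_or_lt with rfl | h
  · rfl
  have hy : 0 < y := hx.trans h
  have h1 := Real.convexOn_log_Gamma.le_slope_of_hasDerivAt (x := x) (y := y) hx hy h
    (hasDerivAt_log_Gamma hx).1
  have h2 := Real.convexOn_log_Gamma.slope_le_of_hasDerivAt (x := x) (y := y) hx hy h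
    (hasDerivAt_log_Gamma hy).1
  exact h1.trans h2

lemma digamma_re_le_log {x : ℝ} (hx : 0 < x) : (digamma x).re ≤ Real.log x := by
  have h1 := Real.convexOn_log_Gamma.le_slope_of_hasDerivAt (x := x) (y := x + 1) hx
    (show (0:ℝ) < x + 1 by linarith) (by linarith) (hasDerivAt_log_Gamma hx).1
  rw [slope_def_field] at h1
  simp only [Function.comp_apply, Real.Gamma_add_one hx.ne'] at h1
  rw [Real.log_mul hx.ne' (Real.Gamma_pos_of_pos hx).ne'] at h1
  simpa using h1

lemma digamma_add_one_ofReal {x : ℝ} (hx : 0 ≤ x) :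
    digamma (x + 1) = -Real.eulerMascheroniConstant + digammaSeries x := by
  set e : ℝ → ℂ := fun x => digamma (x + 1) - (-Real.eulerMascheroniConstant + digammaSeries x)
    with he
  have hper : ∀ x : ℝ, 0 ≤ x → e (x + 1) = e x := by
    intro x hx
    simp only [he]
    push_cast
    rw [digammaSeries_add_one (by simpa), digamma_apply_add_one ((x : ℂ) + 1)]
    · ring
    · intro m h
      have := congrArg Complex.re h
      have h2 : (0:ℝ) ≤ m := m.cast_nonneg
      simp at this
      linarith
  have hperN : ∀ n : ℕ, ∀ x : ℝ, 0 ≤ x → e (x + n) = e x := by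
    intro n
    induction n with
    | zero => intro x _; simp
    | succ n ih =>
      intro x hx
      push_cast
      rw [← add_assoc, hper _ (by positivity), ih x hx]
  have he0 : e 0 = 0 := by
    simp [he, digamma_one, digammaSeries]
  have heN : ∀ n : ℕ, e n = 0 := fun n => by simpa [he0] using hperN n 0 le_rfl
  have hre : ∀ x : ℝ, 0 ≤ x → |(e x).re| ≤ 1 / (⌊x⌋₊ + 1) := by
    intro x hx
    set N := ⌊x⌋₊ with hN
    have h1 : (N:ℝ) ≤ x := Nat.floor_le hx
    have h2 : x ≤ (N + 1 : ℕ) := by push_cast; exact (Nat.lt_floor_add_one x).le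
    have a1 := digammaSeries_ofReal_mono N.cast_nonneg h1
    have a2 := digammaSeries_ofReal_mono hx h2
    have N0 : (0:ℝ) ≤ N := N.cast_nonneg
    have b1 := digamma_mono (x := N + 1) (y := x + 1) (by positivity) (by linarith)
    have b2 := digamma_mono (x := x + 1) (y := (N + 1 : ℕ) + 1) (by positivity) (by linarith)
    have c1 := congrArg Complex.re (heN N)
    have c2 := congrArg Complex.re (heN (N + 1))
    have d := digammaSeries_add_one (z := (N : ℝ)) (by simp)
    have d' := congrArg Complex.re d
    have d2 : (1 / (((N:ℝ):ℂ) + 1)).re = 1 / ((N:ℝ) + 1) := by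
      rw [← ofReal_re (1 / ((N:ℝ) + 1))]; push_cast; rfl
    simp only [he] at c1 c2 ⊢
    push_cast at *
    simp only [add_re, sub_re, zero_re, neg_re] at c1 c2 d' d2 ⊢
    rw [abs_le]
    constructor <;> linarith
  have him : ∀ x : ℝ, 0 ≤ x → (e x).im = 0 := by
    intro x hx
    have h1 := (hasDerivAt_log_Gamma (show 0 < x + 1 by linarith)).2
    have h2 : (digammaSeries x).im = 0 := by
      have := (Complex.hasSum_im (summable_digammaSeries (z := x) (by simpa)).hasSum).tsum_eq
      rw [digammaSeries, ← this, ← tsum_zero (β := ℕ)]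
      congr 1; ext k
      rw [← ofReal_im (x / ((k + 1) * (x + (k + 1))))]; push_cast; rfl
    simp only [he]
    push_cast at h1
    simp [h1, h2]
  have hzero : e x = 0 := by
    refine Complex.ext ?_ (him x hx)
    rw [zero_re, ← abs_nonpos_iff]
    refine le_of_tendsto_of_tendsto' tendsto_const_nhds
      tendsto_one_div_add_atTop_nhds_zero_nat (fun n => ?_)
    rw [← hperN n x hx]
    refine (hre _ (by positivity)).trans ?_
    have : n ≤ ⌊x + n⌋₊ := Nat.le_floor (by linarith)
    have : (n:ℝ) ≤ ⌊x + n⌋₊ := by exact_mod_cast this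
    gcongr
  rw [← sub_eq_zero]; exact hzero

/-- The partial fraction expansion of the digamma function. -/
lemma digamma_add_one_eq {z : ℂ} (hz : 0 < z.re) :
    digamma (z + 1) = -Real.eulerMascheroniConstant + digammaSeries z := by
  have hU : IsOpen {z : ℂ | 0 < z.re} := isOpen_lt continuous_const continuous_re
  have h1 : AnalyticOnNhd ℂ (fun z => digamma (z + 1)) {z : ℂ | 0 < z.re} := by
    refine DifferentiableOn.analyticOnNhd ?_ hU
    have hG : DifferentiableOn ℂ (fun z => Complex.Gamma (z + 1)) {z : ℂ | 0 < z.re} := by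
      intro w hw
      refine DifferentiableAt.differentiableWithinAt ?_
      refine (Complex.differentiableAt_Gamma _ fun m h => ?_).comp w (by fun_prop)
      have := congrArg Complex.re h
      have h2 : (0:ℝ) ≤ m := m.cast_nonneg
      simp at this
      have : 0 < w.re := hw
      linarith
    have : (fun z => digamma (z + 1)) = logDeriv fun z => Complex.Gamma (z + 1) := by
      ext w; simp [digamma_def, logDeriv_apply, deriv_comp_add_const]
    rw [this]
    refine (hG.deriv hU).div hG fun w hw => Complex.Gamma_ne_zero_of_re_pos ?_
    have : 0 < w.re := hw
    simp; linarith
  have h2 : AnalyticOnNhd ℂ (fun z => -(Real.eulerMascheroniConstant : ℂ) + digammaSeries z)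
      {z : ℂ | 0 < z.re} :=
    (differentiableOn_digammaSeries.const_add _).analyticOnNhd hU
  refine h1.eqOn_of_preconnected_of_frequently_eq h2 ?_ (z₀ := 1) (by simp) ?_ hz
  · exact (convex_halfSpace_re_gt 0).isPreconnected
  · have ht : Tendsto (fun n : ℕ => ((1 + 1 / ((n:ℝ) + 1) : ℝ) : ℂ)) atTop (𝓝[≠] 1) := by
      refine tendsto_nhdsWithin_iff.2 ⟨?_, Eventually.of_forall fun n => ?_⟩
      · have := (tendsto_const_nhds (x := (1:ℝ))).add (tendsto_one_div_add_atTop_nhds_zero_nat (𝕜 := ℝ))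
        rw [add_zero] at this
        exact (continuous_ofReal.tendsto _).comp this
      · have : (1:ℝ) / ((n:ℝ) + 1) ≠ 0 := by positivity
        simp only [Set.mem_compl_iff, Set.mem_singleton_iff]
        rw [← ofReal_one, ofReal_inj]
        intro h; apply this; linarith
    refine ht.frequently (Frequently.of_forall fun n => ?_)
    exact digamma_add_one_ofReal (by positivity)

lemma one_div_sq_add_sq_le_arctan {y b : ℝ} (hy : 0 < y) (hb : 1 ≤ b) :
    1 / (y ^ 2 + b ^ 2) ≤ (1 / y) * (Real.arctan (b / y) - Real.arctan ((b - 1) / y)) := by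
  have hlt : (b - 1) / y < b / y := by gcongr; linarith
  obtain ⟨c, hc, hcd⟩ := exists_deriv_eq_slope Real.arctan hlt
    Real.continuous_arctan.continuousOn Real.differentiable_arctan.differentiableOn
  rw [Real.deriv_arctan] at hcd
  have e : b / y - (b - 1) / y = 1 / y := by field_simp; ring
  rw [e, eq_div_iff (by positivity)] at hcd
  rw [← hcd]
  have hc0 : 0 ≤ c := (div_nonneg (by linarith) hy.le).trans hc.1.le
  have hcb : c * y ≤ b := by
    have := hc.2.le
    rwa [le_div_iff₀ hy] at this
  rw [show 1 / y * (1 / (1 + c ^ 2) * (1 / y)) = 1 / (y ^ 2 + (c * y) ^ 2) by field_simp]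
  gcongr

/-- Upper bound for the real part of digamma. -/
lemma digamma_re_le {w : ℂ} (hw : 1 < w.re) (hy : 0 < w.im) :
    (digamma w).re ≤ Real.log ‖w‖ + Real.pi / (4 * w.im) := by
  set σ := w.re with hσ
  set y := w.im with hyd
  have hz : 0 < (w - 1).re := by simp; linarith
  have h1 := digamma_add_one_eq hz
  rw [sub_add_cancel] at h1
  have h2 := (Complex.hasSum_re (summable_digammaSeries hz.le).hasSum).tendsto_sum_nat
  have hnsq : ∀ k : ℕ, ‖w + k‖ ^ 2 = y ^ 2 + (σ + k) ^ 2 := by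
    intro k
    rw [← Complex.normSq_eq_norm_sq, Complex.normSq_apply]
    simp [← hσ, ← hyd]; ring
  have hpos : ∀ k : ℕ, 0 < ‖w + k‖ := fun k => by
    have : 0 < ‖w + k‖ ^ 2 := by rw [hnsq]; positivity
    exact lt_of_le_of_ne (norm_nonneg _) fun h => by rw [← h] at this; simp at this
  have hne : ∀ k : ℕ, w + k ≠ 0 := fun k => norm_pos_iff.1 (hpos k)
  have hterm : ∀ k : ℕ, ((w - 1) / (((k:ℂ) + 1) * (w - 1 + (k + 1)))).re =
      1 / ((k:ℝ) + 1) - (σ + k) / (y ^ 2 + (σ + k) ^ 2) := by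
    intro k
    have c : ((k:ℂ) + 1) ≠ 0 := Nat.cast_add_one_ne_zero k
    have e : (w - 1) / (((k:ℂ) + 1) * (w - 1 + (k + 1))) =
        ((1 / ((k:ℝ) + 1) : ℝ) : ℂ) - (w + k)⁻¹ := by
      have := hne k
      push_cast
      rw [show w - 1 + ((k:ℂ) + 1) = w + k by ring]
      field_simp
      ring
    rw [e, sub_re, ofReal_re, inv_re, Complex.normSq_eq_norm_sq, hnsq]
    simp [← hσ]
  have hstep : ∀ k : ℕ, Real.log ‖w + (k + 1 : ℕ)‖ - Real.log ‖w + k‖ ≤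
      (σ + k) / (y ^ 2 + (σ + k) ^ 2) + (1 / 2) * (1 / y *
        (Real.arctan ((σ + k) / y) - Real.arctan ((σ + k - 1) / y))) := by
    intro k
    have k0 : (0:ℝ) ≤ k := k.cast_nonneg
    have a := one_div_sq_add_sq_le_arctan hy (b := σ + k) (by linarith)
    have b : 2 * (Real.log ‖w + (k + 1 : ℕ)‖ - Real.log ‖w + k‖) =
        Real.log (‖w + (k + 1 : ℕ)‖ ^ 2 / ‖w + k‖ ^ 2) := by
      rw [Real.log_div (pow_pos (hpos _) 2).ne' (pow_pos (hpos _) 2).ne', Real.log_pow,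
        Real.log_pow]
      push_cast; ring
    have hq : 0 < y ^ 2 + (σ + k) ^ 2 := by positivity
    have c := Real.log_le_sub_one_of_pos (x := ‖w + (k + 1 : ℕ)‖ ^ 2 / ‖w + k‖ ^ 2)
      (div_pos (pow_pos (hpos _) 2) (pow_pos (hpos _) 2))
    rw [← b, hnsq, hnsq] at c
    have d : (y ^ 2 + (σ + (k + 1 : ℕ)) ^ 2) / (y ^ 2 + (σ + k) ^ 2) - 1 =
        2 * ((σ + k) / (y ^ 2 + (σ + k) ^ 2)) + 1 / (y ^ 2 + (σ + k) ^ 2) := by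
      push_cast; field_simp; ring
    rw [d] at c
    linarith
  have hpart : ∀ n : ℕ, 1 ≤ n → ∑ k ∈ Finset.range n, ((w - 1) / (((k:ℂ) + 1) * (w - 1 + (k + 1)))).re ≤
      ((harmonic n : ℝ) - Real.log n) + (Real.log ‖w‖ + Real.pi / (4 * y)) := by
    intro n hn
    have s1 := Finset.sum_le_sum (s := Finset.range n) fun k _ => hstep k
    rw [Finset.sum_range_sub (fun k : ℕ => Real.log ‖w + k‖), Finset.sum_add_distrib,
      ← Finset.mul_sum, ← Finset.mul_sum] at s1
    have s2 := Finset.sum_range_sub (fun k : ℕ => Real.arctan ((σ + k - 1) / y)) n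
    have s3 : ∑ i ∈ Finset.range n, (Real.arctan ((σ + i) / y) - Real.arctan ((σ + i - 1) / y)) =
        Real.arctan ((σ + n - 1) / y) - Real.arctan ((σ + (0:ℕ) - 1) / y) := by
      rw [← s2]; refine Finset.sum_congr rfl fun k _ => ?_
      push_cast; ring_nf
    rw [s3] at s1
    have s4 := (Real.arctan_lt_pi_div_two ((σ + n - 1) / y)).le
    have s5 : 0 ≤ Real.arctan ((σ + (0:ℕ) - 1) / y) :=
      Real.arctan_nonneg.2 (div_nonneg (by push_cast; linarith) hy.le)
    have s6 : 1 / 2 * (1 / y * (Real.arctan ((σ + n - 1) / y) -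
        Real.arctan ((σ + (0:ℕ) - 1) / y))) ≤ Real.pi / (4 * y) := by
      calc _ ≤ 1 / 2 * (1 / y * (Real.pi / 2)) := by gcongr; linarith
        _ = _ := by field_simp; norm_num
    have s7 : Real.log n ≤ Real.log ‖w + n‖ := by
      have n0 : (0:ℝ) < n := by exact_mod_cast hn
      refine Real.log_le_log n0 ?_
      have := re_le_norm (w + n)
      simp at this; linarith
    have s8 : ∑ k ∈ Finset.range n, 1 / ((k:ℝ) + 1) = (harmonic n : ℝ) := by
      simp [harmonic]
    simp only [hterm, Finset.sum_sub_distrib, s8]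
    push_cast at s1 s6
    simp only [add_zero] at s1 s6
    linarith
  have h3 : Tendsto (fun n : ℕ => ((harmonic n : ℝ) - Real.log n) +
      (Real.log ‖w‖ + Real.pi / (4 * y))) atTop
      (𝓝 (Real.eulerMascheroniConstant + (Real.log ‖w‖ + Real.pi / (4 * y)))) :=
    Real.tendsto_harmonic_sub_log.add_const _
  have h4 := le_of_tendsto_of_tendsto h2 h3
    (by filter_upwards [eventually_ge_atTop 1] with n hn using hpart n hn)
  rw [h1]
  simp only [add_re, neg_re, ofReal_re]
  have : (digammaSeries (w - 1)).re ≤ _ := h4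
  linarith

end

section

open Complex Filter Topology Metric

lemma log_succ_sub_log_bounds {t : ℝ} (ht : 0 < t) (m : ℕ) :
    2 * ∑ i ∈ Finset.range m, (1 / (2 * t + 1)) ^ (2 * i + 1) / (2 * i + 1) ≤
      Real.log (t + 1) - Real.log t ∧
    Real.log (t + 1) - Real.log t ≤
      2 * (∑ i ∈ Finset.range m, (1 / (2 * t + 1)) ^ (2 * i + 1) / (2 * i + 1) +
        (1 / (2 * t + 1)) ^ (2 * m + 1) / (1 - (1 / (2 * t + 1)) ^ 2)) := by
  have h0 : 0 ≤ 1 / (2 * t + 1) := by positivity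
  have h1 : 1 / (2 * t + 1) < 1 := by rw [div_lt_one (by positivity)]; linarith
  have e : Real.log ((1 + 1 / (2 * t + 1)) / (1 - 1 / (2 * t + 1))) =
      Real.log (t + 1) - Real.log t := by
    rw [← Real.log_div (by positivity) ht.ne']
    congr 1
    have : 2 * t + 1 - 1 ≠ 0 := by simp [ht.ne']
    field_simp
    ring
  have a := Real.sum_range_le_log_div h0 h1 m
  have b := Real.log_div_le_sum_range_add h0 h1 m
  rw [e] at a b
  constructor <;> linarith

lemma tendsto_harmonic_sub_log_sub {g : ℕ → ℝ} (hg : Tendsto g atTop (𝓝 0)) :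
    Tendsto (fun n : ℕ => (harmonic n : ℝ) - Real.log n - g n) atTop
      (𝓝 Real.eulerMascheroniConstant) := by
  simpa using Real.tendsto_harmonic_sub_log.sub hg

lemma tendsto_const_div_mul_pow_atTop (c : ℝ) {k : ℕ} (hk : k ≠ 0) :
    Tendsto (fun n : ℕ => 1 / (c * (n:ℝ) ^ k)) atTop (𝓝 0) := by
  have := ((tendsto_pow_neg_atTop (𝕜 := ℝ) hk).comp tendsto_natCast_atTop_atTop).const_mul (1 / c)
  refine (this.congr fun n => ?_).trans (by simp)
  simp [zpow_neg]
  ring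

lemma le_eulerMascheroniConstant (n : ℕ) (hn : 1 ≤ n) :
    (harmonic n : ℝ) - Real.log n - (1 / (2 * (n:ℝ) ^ 1) - 1 / (12 * (n:ℝ) ^ 2) +
      1 / (120 * (n:ℝ) ^ 4)) ≤ Real.eulerMascheroniConstant := by
  have hlim := tendsto_harmonic_sub_log_sub (g := fun n => 1 / (2 * (n:ℝ) ^ 1) -
    1 / (12 * (n:ℝ) ^ 2) + 1 / (120 * (n:ℝ) ^ 4)) (by
      simpa using ((tendsto_const_div_mul_pow_atTop 2 one_ne_zero).sub
        (tendsto_const_div_mul_pow_atTop 12 two_ne_zero)).add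
        (tendsto_const_div_mul_pow_atTop 120 four_ne_zero))
  refine ge_of_tendsto hlim (eventually_atTop.2 ⟨n, fun m hm => ?_⟩)
  induction m, hm using Nat.le_induction with
  | base => rfl
  | succ m hm ih =>
    refine ih.trans ?_
    have hm0 : (1:ℝ) ≤ m := by exact_mod_cast hn.trans hm
    obtain ⟨s, hs⟩ : ∃ s : ℝ, (m:ℝ) = s + 1 := ⟨m - 1, by ring⟩
    have hs0 : 0 ≤ s := by linarith
    have := (log_succ_sub_log_bounds (t := m) (by linarith) 4).2
    rw [harmonic_succ]
    push_cast
    simp only [Finset.sum_range_succ, Finset.sum_range_zero] at this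
    suffices h : 2 * ((1 / (2 * (m:ℝ) + 1)) ^ 1 / 1 + (1 / (2 * (m:ℝ) + 1)) ^ 3 / 3 +
        (1 / (2 * (m:ℝ) + 1)) ^ 5 / 5 + (1 / (2 * (m:ℝ) + 1)) ^ 7 / 7 +
        (1 / (2 * (m:ℝ) + 1)) ^ 9 / (1 - (1 / (2 * (m:ℝ) + 1)) ^ 2)) ≤ ((m:ℝ) + 1)⁻¹ +
        (1 / (2 * (m:ℝ) ^ 1) - 1 / (12 * (m:ℝ) ^ 2) + 1 / (120 * (m:ℝ) ^ 4)) -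
        (1 / (2 * ((m:ℝ) + 1) ^ 1) - 1 / (12 * ((m:ℝ) + 1) ^ 2) + 1 / (120 * ((m:ℝ) + 1) ^ 4)) by
      norm_num at this h ⊢
      linarith
    rw [hs]
    have e : 1 - (1 / (2 * (s + 1) + 1)) ^ 2 = 4 * (s + 1) * (s + 2) / (2 * (s + 1) + 1) ^ 2 := by
      field_simp; ring
    rw [e]
    have e2 : s + 1 + 1 = s + 2 := by ring
    rw [e2]
    field_simp
    rw [← sub_nonneg]
    ring_nf
    positivity

lemma eulerMascheroniConstant_le (n : ℕ) (hn : 1 ≤ n) :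
    Real.eulerMascheroniConstant ≤
    (harmonic n : ℝ) - Real.log n - (1 / (2 * (n:ℝ) ^ 1) - 1 / (12 * (n:ℝ) ^ 2)) := by
  have hlim := tendsto_harmonic_sub_log_sub (g := fun n => 1 / (2 * (n:ℝ) ^ 1) -
    1 / (12 * (n:ℝ) ^ 2)) (by
      simpa using ((tendsto_const_div_mul_pow_atTop 2 one_ne_zero).sub
        (tendsto_const_div_mul_pow_atTop 12 two_ne_zero)))
  refine le_of_tendsto hlim (eventually_atTop.2 ⟨n, fun m hm => ?_⟩)
  induction m, hm using Nat.le_induction with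
  | base => rfl
  | succ m hm ih =>
    refine le_trans ?_ ih
    have hm0 : (1:ℝ) ≤ m := by exact_mod_cast hn.trans hm
    obtain ⟨s, hs⟩ : ∃ s : ℝ, (m:ℝ) = s + 1 := ⟨m - 1, by ring⟩
    have hs0 : 0 ≤ s := by linarith
    have := (log_succ_sub_log_bounds (t := m) (by linarith) 3).1
    rw [harmonic_succ]
    push_cast
    simp only [Finset.sum_range_succ, Finset.sum_range_zero] at this
    suffices h : ((m:ℝ) + 1)⁻¹ +
        (1 / (2 * (m:ℝ) ^ 1) - 1 / (12 * (m:ℝ) ^ 2)) -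
        (1 / (2 * ((m:ℝ) + 1) ^ 1) - 1 / (12 * ((m:ℝ) + 1) ^ 2)) ≤
        2 * ((1 / (2 * (m:ℝ) + 1)) ^ 1 / 1 + (1 / (2 * (m:ℝ) + 1)) ^ 3 / 3 +
        (1 / (2 * (m:ℝ) + 1)) ^ 5 / 5) by
      norm_num at this h ⊢
      linarith
    rw [hs]
    have e2 : s + 1 + 1 = s + 2 := by ring
    rw [e2]
    field_simp
    rw [← sub_nonneg]
    ring_nf
    positivity

lemma eulerMascheroniConstant_gt_d8 : 0.57721566 < Real.eulerMascheroniConstant := by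
  have h := le_eulerMascheroniConstant 16 (by norm_num)
  have e : Real.log ((16:ℕ):ℝ) = 4 * Real.log 2 := by
    rw [show ((16:ℕ):ℝ) = 2 ^ 4 by norm_num, Real.log_pow]; norm_num
  rw [e] at h
  norm_num [harmonic, Finset.sum_range_succ] at h
  have := Real.log_two_lt_d9
  norm_num at this ⊢
  linarith

lemma eulerMascheroniConstant_lt_d7 : Real.eulerMascheroniConstant < 0.5772158 := by
  have h := eulerMascheroniConstant_le 16 (by norm_num)
  have e : Real.log ((16:ℕ):ℝ) = 4 * Real.log 2 := by
    rw [show ((16:ℕ):ℝ) = 2 ^ 4 by norm_num, Real.log_pow]; norm_num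
  rw [e] at h
  norm_num [harmonic, Finset.sum_range_succ] at h
  have := Real.log_two_gt_d9
  norm_num at this ⊢
  linarith

lemma log_four_mul_pi_gt : 2.531 < Real.log (4 * Real.pi) := by
  have h1 : Real.log (4 * (3 * (22188 / 21188))) ≤ Real.log (4 * Real.pi) := by
    apply Real.log_le_log (by norm_num)
    have := Real.pi_gt_d6
    norm_num at this ⊢
    linarith
  have h2 := (log_succ_sub_log_bounds (t := 21.188) (by norm_num) 1).1
  have e : Real.log (4 * (3 * (22188 / 21188))) =
      2 * Real.log 2 + (Real.log 3 + (Real.log (21.188 + 1) - Real.log 21.188)) := by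
    rw [← Real.log_div (by norm_num) (by norm_num), Real.log_mul (by norm_num) (by norm_num),
      Real.log_mul (by norm_num) (by norm_num), Real.log_four_eq]
    norm_num
  norm_num [Finset.sum_range_succ] at h2 e
  have := Real.log_two_gt_d9
  have := Real.log_three_gt_d9
  linarith

lemma completedRiemannZeta₀_one_re_lt : (completedRiemannZeta₀ 1).re < 0.02311 := by
  have h1 := log_four_mul_pi_gt
  have h2 := eulerMascheroniConstant_lt_d7
  have e : completedRiemannZeta₀ 1 =
      (((Real.eulerMascheroniConstant - Real.log (4 * Real.pi)) / 2 + 1 : ℝ) : ℂ) := by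
    rw [completedRiemannZeta₀_one]
    push_cast
    rw [Complex.ofReal_log (by positivity)]
    push_cast
    rfl
  rw [e, ofReal_re]
  norm_num at h1 h2 ⊢
  linarith

end

section

open Complex Filter Topology Metric

/-- The entire function `F` with `F (s (s - 1)) = s (s - 1) Λ(s)`. -/
noncomputable def xiFun : ℂ → ℂ := exists_xiFun.choose

lemma differentiable_xiFun : Differentiable ℂ xiFun := exists_xiFun.choose_spec.1

lemma xiFun_apply (s : ℂ) : xiFun (s * (s - 1)) = 1 + s * (s - 1) * completedRiemannZeta₀ s :=
  exists_xiFun.choose_spec.2.1 s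

lemma xiFun_zero : xiFun 0 = 1 := by simpa using xiFun_apply 0

lemma xiFun_zero_ne : xiFun 0 ≠ 0 := by simp [xiFun_zero]

lemma xiFun_eq_riemannZeta {s : ℂ} (hs : 0 < s.re) (h1 : s ≠ 1) :
    xiFun (s * (s - 1)) = s * (s - 1) * Gammaℝ s * riemannZeta s := by
  have h0 : s ≠ 0 := fun h => by simp [h] at hs
  have h1' : s - 1 ≠ 0 := sub_ne_zero.2 h1
  have h1'' : 1 - s ≠ 0 := sub_ne_zero.2 h1.symm
  rw [riemannZeta_def_of_ne_zero h0, mul_assoc, mul_div_cancel₀ _ (Gammaℝ_ne_zero_of_re_pos hs),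
    completedRiemannZeta_eq, xiFun_apply]
  field_simp
  ring

lemma xiFun_ne_zero_of_one_le_re {s : ℂ} (hs : 1 ≤ s.re) : xiFun (s * (s - 1)) ≠ 0 := by
  by_cases h1 : s = 1
  · simp [h1, xiFun_zero]
  have h0 : s ≠ 0 := fun h => by simp [h] at hs; linarith
  rw [xiFun_eq_riemannZeta (by linarith) h1]
  exact mul_ne_zero (mul_ne_zero (mul_ne_zero h0 (sub_ne_zero.2 h1))
    (Gammaℝ_ne_zero_of_re_pos (by linarith))) (riemannZeta_ne_zero_of_one_le_re hs)

lemma exists_xi_root (a : {a : ℂ // xiFun a = 0}) :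
    ∃ ρ : ℂ, ρ * (ρ - 1) = a ∧ 0 ≤ ρ.im := by
  set w : ℂ := (1 / 4 + (a:ℂ)) ^ (1 / 2 : ℂ)
  have hw : w ^ 2 = 1 / 4 + (a:ℂ) := by rw [← Complex.cpow_nat_mul]; simp
  rcases le_total 0 w.im with h | h
  · exact ⟨1 / 2 + w, by linear_combination hw, by simpa using h⟩
  · exact ⟨1 / 2 - w, by linear_combination hw, by simpa using h⟩

/-- A zero `ρ` of the zeta function with nonnegative imaginary part and `ρ (ρ - 1) = a`. -/
noncomputable def xiRoot (a : {a : ℂ // xiFun a = 0}) : ℂ := (exists_xi_root a).choose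

/-- The multiplicity of a zero of `xiFun`. -/
noncomputable def xiMult (a : {a : ℂ // xiFun a = 0}) : ℝ := analyticOrderNatAt xiFun a

variable (a : {a : ℂ // xiFun a = 0})

lemma xiRoot_mul_sub_one : xiRoot a * (xiRoot a - 1) = a := (exists_xi_root a).choose_spec.1

lemma xiRoot_im_nonneg : 0 ≤ (xiRoot a).im := (exists_xi_root a).choose_spec.2

lemma xiRoot_re_lt_one : (xiRoot a).re < 1 := by
  by_contra! h
  apply xiFun_ne_zero_of_one_le_re h
  rw [xiRoot_mul_sub_one, a.2]

lemma xiRoot_re_pos : 0 < (xiRoot a).re := by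
  by_contra! h
  apply xiFun_ne_zero_of_one_le_re (s := 1 - xiRoot a) (by simpa using h)
  rw [show (1 - xiRoot a) * (1 - xiRoot a - 1) = xiRoot a * (xiRoot a - 1) by ring,
    xiRoot_mul_sub_one, a.2]

lemma one_le_xiMult : 1 ≤ xiMult a := by
  have h : analyticOrderAt xiFun a ≠ 0 := by
    rw [Ne, (differentiable_xiFun.analyticAt _).analyticOrderAt_eq_zero, not_not]
    exact a.2
  have h' := analyticOrderAt_ne_top_of_entire differentiable_xiFun xiFun_zero_ne a
  have : analyticOrderNatAt xiFun a ≠ 0 := by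
    rw [analyticOrderNatAt, Ne, ENat.toNat_eq_zero]
    tauto
  rw [xiMult]
  exact_mod_cast Nat.one_le_iff_ne_zero.2 this

lemma xiZero_re : -(a : ℂ).re = (xiRoot a).re * (1 - (xiRoot a).re) + (xiRoot a).im ^ 2 := by
  rw [← xiRoot_mul_sub_one]; simp; ring

lemma xiZero_im : (a : ℂ).im = (xiRoot a).im * (2 * (xiRoot a).re - 1) := by
  rw [← xiRoot_mul_sub_one]; simp; ring

lemma neg_xiZero_re_pos : 0 < -(a : ℂ).re := by
  rw [xiZero_re]
  have := mul_pos (xiRoot_re_pos a) (sub_pos.2 (xiRoot_re_lt_one a))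
  positivity

lemma xiZero_im_sq_le : (a : ℂ).im ^ 2 ≤ -(a : ℂ).re := by
  rw [xiZero_re, xiZero_im]
  have h0 := xiRoot_re_pos a
  have h1 := xiRoot_re_lt_one a
  have := mul_pos h0 (sub_pos.2 h1)
  have h2 : (2 * (xiRoot a).re - 1) ^ 2 ≤ 1 := by nlinarith
  nlinarith [mul_le_mul_of_nonneg_left h2 (sq_nonneg (xiRoot a).im)]

lemma xiZero_ne_zero : (a : ℂ) ≠ 0 := fun h => by
  have := neg_xiZero_re_pos a; simp [h] at this

lemma hasDerivAt_mul_sub_one (s : ℂ) : HasDerivAt (fun s : ℂ => s * (s - 1)) (2 * s - 1) s := by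
  have := (hasDerivAt_id' s).mul ((hasDerivAt_id' s).sub_const 1)
  rwa [show 1 * (s - 1) + s * 1 = 2 * s - 1 by ring] at this

lemma hasDerivAt_xiFun_comp (s : ℂ) : HasDerivAt (fun s : ℂ => xiFun (s * (s - 1)))
    (deriv xiFun (s * (s - 1)) * (2 * s - 1)) s :=
  HasDerivAt.comp (h₂ := xiFun) s (differentiable_xiFun _).hasDerivAt (hasDerivAt_mul_sub_one s)

lemma deriv_xiFun_zero : deriv xiFun 0 = completedRiemannZeta₀ 1 := by
  have h1 := hasDerivAt_xiFun_comp 1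
  have h2 : HasDerivAt (fun s : ℂ => xiFun (s * (s - 1))) (completedRiemannZeta₀ 1) 1 := by
    have := ((hasDerivAt_mul_sub_one 1).mul (differentiable_completedZeta₀ 1).hasDerivAt).const_add 1
    simp only [xiFun_apply]
    refine (this.congr_deriv ?_)
    norm_num
  have := h1.unique h2
  norm_num at this
  exact this

lemma tendsto_xi_sum {v : ℂ} (hv : xiFun v ≠ 0) :
    Tendsto (fun R => ∑ a ∈ zerosUpTo xiFun R, (xiMult a : ℂ) / (v - a)) atTop
      (𝓝 (logDeriv xiFun v)) := by
  obtain ⟨C, hC⟩ := exists_xiFun.choose_spec.2.2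
  have := tendsto_sum_zeros_logDeriv differentiable_xiFun xiFun_zero hC hv
  simpa [xiMult] using this

lemma xi_term_re : ((xiMult a : ℂ) / (0 - a)).re = xiMult a * (-(a:ℂ).re / ‖(a:ℂ)‖ ^ 2) := by
  rw [div_eq_mul_inv, re_ofReal_mul, zero_sub, Complex.inv_re, ← Complex.normSq_eq_norm_sq]
  simp

lemma xi_term_nonneg : 0 ≤ xiMult a * (-(a:ℂ).re / ‖(a:ℂ)‖ ^ 2) :=
  mul_nonneg (zero_le_one.trans (one_le_xiMult a))
    (div_nonneg (neg_xiZero_re_pos a).le (sq_nonneg _))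

lemma xi_sum_re_le (S : Finset {a : ℂ // xiFun a = 0}) :
    ∑ a ∈ S, xiMult a * (-(a:ℂ).re / ‖(a:ℂ)‖ ^ 2) ≤ (completedRiemannZeta₀ 1).re := by
  have h1 := (Complex.continuous_re.tendsto _).comp (tendsto_xi_sum xiFun_zero_ne)
  rw [logDeriv_apply, deriv_xiFun_zero, xiFun_zero, div_one] at h1
  refine ge_of_tendsto h1 ?_
  filter_upwards [(tendsto_zerosUpTo differentiable_xiFun xiFun_zero_ne).eventually
    (eventually_ge_atTop S)] with R hR
  simp only [Function.comp_apply, Complex.re_sum, xi_term_re]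
  exact Finset.sum_le_sum_of_subset_of_nonneg hR fun a _ _ => xi_term_nonneg a

lemma normSq_xiZero_le : ‖(a:ℂ)‖ ^ 2 ≤ (-(a:ℂ).re) ^ 2 + -(a:ℂ).re := by
  have := xiZero_im_sq_le a
  rw [← Complex.normSq_eq_norm_sq, Complex.normSq_apply]
  nlinarith

lemma neg_xiZero_re_gt : 42.2 < -(a:ℂ).re := by
  have h := xi_sum_re_le {a}
  rw [Finset.sum_singleton] at h
  have h1 := one_le_xiMult a
  have h2 := neg_xiZero_re_pos a
  have h3 := normSq_xiZero_le a
  have h4 := completedRiemannZeta₀_one_re_lt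
  have hn : 0 < ‖(a:ℂ)‖ ^ 2 := pow_pos (norm_pos_iff.2 (xiZero_ne_zero a)) 2
  set q := -(a:ℂ).re
  have h5 : q / ‖(a:ℂ)‖ ^ 2 ≤ xiMult a * (q / ‖(a:ℂ)‖ ^ 2) :=
    le_mul_of_one_le_left (by positivity) h1
  have h6 : q / ‖(a:ℂ)‖ ^ 2 < 0.02311 := by linarith
  rw [div_lt_iff₀ hn] at h6
  by_contra! h7
  norm_num at h6 h7
  nlinarith

lemma xiRoot_im_gt : 6.47 < (xiRoot a).im := by
  have h := neg_xiZero_re_gt a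
  rw [xiZero_re] at h
  have h0 := xiRoot_im_nonneg a
  have : (xiRoot a).re * (1 - (xiRoot a).re) ≤ 1 / 4 := by nlinarith [sq_nonneg ((xiRoot a).re - 1 / 2)]
  by_contra! h7
  norm_num at h h7
  nlinarith

lemma norm_xiZero_le : ‖(a:ℂ)‖ ≤ 1.012 * -(a:ℂ).re := by
  have h := neg_xiZero_re_gt a
  have h3 := normSq_xiZero_le a
  refine abs_le_of_sq_le_sq' (a := ‖(a:ℂ)‖) ?_ (by linarith) |>.2
  norm_num at h ⊢
  nlinarith

lemma xiMult_div_norm_le :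
    xiMult a / ‖(a:ℂ)‖ ≤ 1.012 * (xiMult a * (-(a:ℂ).re / ‖(a:ℂ)‖ ^ 2)) := by
  have hn : 0 < ‖(a:ℂ)‖ := norm_pos_iff.2 (xiZero_ne_zero a)
  have h1 := one_le_xiMult a
  have h := norm_xiZero_le a
  rw [show 1.012 * (xiMult a * (-(a:ℂ).re / ‖(a:ℂ)‖ ^ 2)) =
    xiMult a / ‖(a:ℂ)‖ * (1.012 * -(a:ℂ).re / ‖(a:ℂ)‖) by field_simp]
  apply le_mul_of_one_le_right (by positivity)
  rwa [one_le_div hn]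

lemma sum_xiMult_div_norm_le (S : Finset {a : ℂ // xiFun a = 0}) :
    ∑ a ∈ S, xiMult a / ‖(a:ℂ)‖ ≤ 0.0234 := by
  have h := xi_sum_re_le S
  have h2 := completedRiemannZeta₀_one_re_lt
  calc _ ≤ ∑ a ∈ S, 1.012 * (xiMult a * (-(a:ℂ).re / ‖(a:ℂ)‖ ^ 2)) :=
        Finset.sum_le_sum fun a _ => xiMult_div_norm_le a
    _ ≤ _ := by rw [← Finset.mul_sum]; norm_num at h2 ⊢; linarith

lemma xiMult_div_norm_nonneg : 0 ≤ xiMult a / ‖(a:ℂ)‖ :=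
  div_nonneg (zero_le_one.trans (one_le_xiMult a)) (norm_nonneg _)

lemma summable_xiMult_div_norm : Summable fun a : {a : ℂ // xiFun a = 0} => xiMult a / ‖(a:ℂ)‖ :=
  summable_of_sum_le xiMult_div_norm_nonneg sum_xiMult_div_norm_le

lemma hasSum_logDeriv_xiFun {v : ℂ} (hv : xiFun v ≠ 0) :
    HasSum (fun a : {a : ℂ // xiFun a = 0} => (xiMult a : ℂ) / (v - a)) (logDeriv xiFun v) := by
  have hs : Summable (fun a : {a : ℂ // xiFun a = 0} => (xiMult a : ℂ) / (v - a)) := by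
    refine Summable.of_norm_bounded_eventually (summable_xiMult_div_norm.mul_left 2) ?_
    rw [Filter.eventually_cofinite]
    refine (zerosUpTo xiFun (2 * ‖v‖)).finite_toSet.subset fun a ha => ?_
    rw [Finset.mem_coe, mem_zerosUpTo differentiable_xiFun xiFun_zero_ne]
    by_contra! h
    apply ha
    have hn : 0 < ‖(a:ℂ)‖ := norm_pos_iff.2 (xiZero_ne_zero a)
    have h1 : ‖(a:ℂ)‖ / 2 ≤ ‖v - a‖ := by
      have := norm_sub_norm_le (a:ℂ) v
      rw [norm_sub_rev] at this
      linarith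
    have hm := one_le_xiMult a
    rw [norm_div, Complex.norm_real, Real.norm_of_nonneg (by linarith)]
    calc xiMult a / ‖v - a‖ ≤ xiMult a / (‖(a:ℂ)‖ / 2) := by gcongr
      _ = _ := by field_simp
  have h1 := hs.hasSum.comp (tendsto_zerosUpTo differentiable_xiFun xiFun_zero_ne)
  rw [tendsto_nhds_unique (tendsto_xi_sum hv) h1]
  exact hs.hasSum

lemma logDeriv_xiFun_comp {s : ℂ} (hs : 1 < s.re) :
    (2 * s - 1) * logDeriv xiFun (s * (s - 1)) =
      1 / (s - 1) + digamma (s / 2 + 1) / 2 - Real.log Real.pi / 2 +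
        deriv riemannZeta s / riemannZeta s := by
  have h1 : s ≠ 1 := fun h => by simp [h] at hs
  have h0 : s ≠ 0 := fun h => by simp [h] at hs; linarith
  have h1' : s - 1 ≠ 0 := sub_ne_zero.2 h1
  have hz := riemannZeta_ne_zero_of_one_le_re hs.le
  have hU : {s : ℂ | 1 < s.re} ∈ 𝓝 s := (isOpen_lt continuous_const continuous_re).mem_nhds hs
  have hpi : (Real.pi : ℂ) ≠ 0 := ofReal_ne_zero.2 Real.pi_ne_zero
  have hG : Complex.Gamma (s / 2) ≠ 0 := Gamma_ne_zero_of_re_pos (by simp; linarith)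
  have dG : DifferentiableAt ℂ Complex.Gamma (s / 2) := differentiableAt_Gamma _ fun m h => by
    have := congrArg Complex.re h
    simp at this
    have : (0:ℝ) ≤ m := m.cast_nonneg
    linarith
  have e : (fun s : ℂ => xiFun (s * (s - 1))) =ᶠ[𝓝 s]
      fun s => (s * (s - 1)) * ((Real.pi : ℂ) ^ (-s / 2) * Complex.Gamma (s / 2)) *
        riemannZeta s := by
    filter_upwards [hU] with w hw
    rw [xiFun_eq_riemannZeta (lt_trans one_pos hw) (fun h => by simp [h] at hw), Gammaℝ_def]
  have dpi : HasDerivAt (fun s : ℂ => (Real.pi : ℂ) ^ (-s / 2))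
      ((Real.pi : ℂ) ^ (-s / 2) * Complex.log Real.pi * (-1 / 2)) s :=
    ((hasDerivAt_neg' s).div_const 2).const_cpow (Or.inl hpi)
  have dG2 : HasDerivAt (fun s : ℂ => Complex.Gamma (s / 2))
      (deriv Complex.Gamma (s / 2) * (1 / 2)) s :=
    HasDerivAt.comp (h₂ := Complex.Gamma) s dG.hasDerivAt ((hasDerivAt_id' s).div_const 2)
  have hd := (hasDerivAt_xiFun_comp s).unique
    ((((hasDerivAt_mul_sub_one s).mul (dpi.mul dG2)).mul
      (differentiableAt_riemannZeta h1).hasDerivAt).congr_of_eventuallyEq e)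
  have hx := e.self_of_nhds
  simp only at hx
  rw [logDeriv_apply, mul_div_assoc', mul_comm, hd, hx]
  rw [digamma_apply_add_one (s / 2) (fun m h => by
    have := congrArg Complex.re h
    simp at this
    have : (0:ℝ) ≤ m := m.cast_nonneg
    linarith), digamma_def, logDeriv_apply, ← Complex.ofReal_log Real.pi_pos.le]
  have : (Real.pi : ℂ) ^ (-s / 2) ≠ 0 := by simp [Complex.cpow_eq_zero_iff, hpi]
  simp only [Pi.mul_apply]
  field_simp
  ring

lemma xi_partial_fraction (s : ℂ) (h : s * (s - 1) - a ≠ 0) :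
    (2 * s - 1) * ((xiMult a : ℂ) / (s * (s - 1) - a)) =
      xiMult a * (1 / (s - xiRoot a) + 1 / (s - 1 + xiRoot a)) := by
  rw [← xiRoot_mul_sub_one] at h ⊢
  have e : s * (s - 1) - xiRoot a * (xiRoot a - 1) = (s - xiRoot a) * (s - 1 + xiRoot a) := by ring
  rw [e] at h ⊢
  have h1 := left_ne_zero_of_mul h
  have h2 := right_ne_zero_of_mul h
  field_simp
  ring

lemma hasSum_xi_partial_fraction {s : ℂ} (hs : 1 < s.re) :
    HasSum (fun a : {a : ℂ // xiFun a = 0} =>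
        (xiMult a : ℂ) * (1 / (s - xiRoot a) + 1 / (s - 1 + xiRoot a)))
      (1 / (s - 1) + digamma (s / 2 + 1) / 2 - Real.log Real.pi / 2 +
        deriv riemannZeta s / riemannZeta s) := by
  have hx := xiFun_ne_zero_of_one_le_re hs.le
  have := (hasSum_logDeriv_xiFun hx).mul_left (2 * s - 1)
  rw [logDeriv_xiFun_comp hs] at this
  refine this.congr_fun fun a => ?_
  rw [xi_partial_fraction]
  intro h
  apply hx
  rw [sub_eq_zero.1 h, a.2]

end

section

open Complex Filter Topology Metric

/-- The real part of `-ζ'/ζ`. -/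
noncomputable def zetaLogDer (s : ℂ) : ℝ := (-deriv riemannZeta s / riemannZeta s).re

lemma hasSum_zetaLogDer {s : ℂ} (hs : 1 < s.re) :
    HasSum (fun n : ℕ => ((ArithmeticFunction.vonMangoldt n : ℂ) * (n:ℂ) ^ (-s)).re)
      (zetaLogDer s) := by
  have h := (ArithmeticFunction.LSeriesSummable_vonMangoldt hs).LSeriesHasSum
  rw [ArithmeticFunction.LSeries_vonMangoldt_eq_deriv_riemannZeta_div hs] at h
  refine (Complex.hasSum_re h).congr_fun fun n => ?_
  rcases eq_or_ne n 0 with rfl | hn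
  · simp
  · rw [LSeries.term_of_ne_zero hn, div_eq_mul_inv, Complex.cpow_neg]

lemma zetaLogDer_conj {σ t : ℝ} (hσ : 1 < σ) : zetaLogDer (σ + (-t : ℝ) * I) = zetaLogDer (σ + t * I) := by
  have h1 := hasSum_zetaLogDer (s := σ + (-t : ℝ) * I) (by simpa)
  have h2 := hasSum_zetaLogDer (s := σ + t * I) (by simpa)
  refine h1.unique (h2.congr_fun fun n => ?_)
  rw [re_ofReal_mul, re_ofReal_mul]
  congr 1
  have e : -(σ + (-t:ℝ) * I : ℂ) = (starRingEnd ℂ) (-(σ + t * I)) := by simp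
  rw [e, Complex.cpow_conj _ _ (by rw [Complex.natCast_arg]; exact Real.pi_ne_zero.symm),
    Complex.conj_natCast, Complex.conj_re]

lemma zetaLogDer_comb_nonneg {σ t : ℝ} (hσ : 1 < σ) :
    0 ≤ 5 * zetaLogDer σ + 8 * zetaLogDer (σ + t * I) + 4 * zetaLogDer (σ + (2 * t : ℝ) * I) +
      zetaLogDer (σ + (3 * t : ℝ) * I) := by
  have h0 := hasSum_zetaLogDer (s := σ) (by simpa)
  have h1 := hasSum_zetaLogDer (s := σ + t * I) (by simpa)
  have h2 := hasSum_zetaLogDer (s := σ + (2 * t : ℝ) * I) (by simpa)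
  have h3 := hasSum_zetaLogDer (s := σ + (3 * t : ℝ) * I) (by simpa)
  refine ((((h0.mul_left 5).add (h1.mul_left 8)).add (h2.mul_left 4)).add h3).nonneg fun n => ?_
  rcases eq_or_ne n 0 with rfl | hn
  · simp
  have hn' : (n:ℂ) ≠ 0 := Nat.cast_ne_zero.2 hn
  set w : ℂ := (n:ℂ) ^ (-(t * I) : ℂ) with hw
  have hw1 : ‖w‖ = 1 := by
    rw [hw, Complex.norm_natCast_cpow_of_pos (Nat.pos_of_ne_zero hn)]; simp
  have e : ∀ k : ℕ, (n:ℂ) ^ (-(σ + (k * t : ℝ) * I) : ℂ) = ((n:ℝ) ^ (-σ) : ℝ) * w ^ k := by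
    intro k
    rw [hw, ← Complex.cpow_nat_mul, Complex.ofReal_cpow (Nat.cast_nonneg _), ofReal_natCast,
      ← Complex.cpow_add _ _ hn']
    congr 1; push_cast; ring
  have e0 := e 0
  have e1 := e 1
  have e2 := e 2
  have e3 := e 3
  push_cast at e0 e1 e2 e3 ⊢
  simp only [zero_mul, add_zero, one_mul, pow_zero, mul_one, pow_one] at e0 e1
  rw [e0, e1, e2, e3]
  have hL : 0 ≤ ArithmeticFunction.vonMangoldt n := ArithmeticFunction.vonMangoldt_nonneg
  have hp : 0 ≤ (n:ℝ) ^ (-σ) := by positivity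
  have key : 0 ≤ 5 + 8 * w.re + 4 * (w ^ 2).re + (w ^ 3).re := by
    have : w.re ^ 2 + w.im ^ 2 = 1 := by
      have := Complex.normSq_eq_norm_sq w
      rw [hw1, Complex.normSq_apply] at this; nlinarith
    have e2 : (w ^ 2).re = 2 * w.re ^ 2 - 1 := by
      simp [pow_two]; nlinarith
    have e3 : (w ^ 3).re = 4 * w.re ^ 3 - 3 * w.re := by
      simp [pow_succ]; linear_combination (-3 * w.re) * this
    have hr : -1 ≤ w.re := by nlinarith [sq_nonneg w.im]
    rw [e2, e3]
    nlinarith [mul_nonneg (by linarith : 0 ≤ 1 + w.re) (sq_nonneg (1 + 2 * w.re))]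
  have : ∀ z : ℂ, ((ArithmeticFunction.vonMangoldt n : ℂ) * (((n:ℝ) ^ (-σ) : ℝ) * z)).re =
      ArithmeticFunction.vonMangoldt n * (n:ℝ) ^ (-σ) * z.re := fun z => by
    rw [re_ofReal_mul, re_ofReal_mul]; ring
  have e1 : (((n:ℝ) ^ (-σ) : ℝ) : ℂ) = ((n:ℝ) ^ (-σ) : ℝ) * 1 := by simp
  rw [e1, mul_one]
  nth_rewrite 1 [e1]
  simp only [this, one_re]
  nlinarith [mul_nonneg (mul_nonneg hL hp) key]

lemma digamma_conj_re {w : ℂ} (hw : 1 < w.re) :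
    (digamma ((starRingEnd ℂ) w)).re = (digamma w).re := by
  have hz : 0 < (w - 1).re := by simp; linarith
  have hz' : 0 < ((starRingEnd ℂ) w - 1).re := by simp; linarith
  have h1 := digamma_add_one_eq hz
  have h2 := digamma_add_one_eq hz'
  rw [sub_add_cancel] at h1 h2
  rw [h1, h2, add_re, add_re]
  congr 1
  refine (Complex.hasSum_re (summable_digammaSeries hz'.le).hasSum).unique
    ((Complex.hasSum_re (summable_digammaSeries hz.le).hasSum).congr_fun fun k => ?_)
  rw [← Complex.conj_re (_ / _)]
  simp

lemma digamma_re_le_abs {w : ℂ} (hw : 1 < w.re) (hy : w.im ≠ 0) :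
    (digamma w).re ≤ Real.log ‖w‖ + Real.pi / (4 * |w.im|) := by
  rcases hy.lt_or_gt with h | h
  · rw [← digamma_conj_re hw, abs_of_neg h]
    simpa using digamma_re_le (w := (starRingEnd ℂ) w) (by simpa) (by simpa)
  · rw [abs_of_pos h]
    exact digamma_re_le hw h

variable (a : {a : ℂ // xiFun a = 0})

lemma xi_re_one_div_nonneg {s : ℂ} (hs : 1 < s.re) :
    0 ≤ (1 / (s - xiRoot a)).re ∧ 0 ≤ (1 / (s - 1 + xiRoot a)).re := by
  have h0 := xiRoot_re_pos a
  have h1 := xiRoot_re_lt_one a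
  constructor <;> rw [one_div, Complex.inv_re] <;>
    exact div_nonneg (by simp; linarith) (Complex.normSq_nonneg _)

lemma zetaLogDer_eq {s : ℂ} (hs : 1 < s.re) :
    HasSum (fun a : {a : ℂ // xiFun a = 0} =>
        xiMult a * ((1 / (s - xiRoot a)).re + (1 / (s - 1 + xiRoot a)).re))
      ((1 / (s - 1)).re + (digamma (s / 2 + 1)).re / 2 - Real.log Real.pi / 2 - zetaLogDer s) := by
  have h := Complex.hasSum_re (hasSum_xi_partial_fraction hs)
  simp only [re_ofReal_mul, add_re] at h
  convert h using 1
  rw [zetaLogDer, neg_div, neg_re]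
  simp only [add_re, sub_re]
  rw [show (2:ℂ) = ((2:ℝ):ℂ) by simp, Complex.div_ofReal_re, Complex.div_ofReal_re, ofReal_re]
  ring

lemma xi_re_term_nonneg {s : ℂ} (hs : 1 < s.re) :
    0 ≤ xiMult a * ((1 / (s - xiRoot a)).re + (1 / (s - 1 + xiRoot a)).re) :=
  mul_nonneg (zero_le_one.trans (one_le_xiMult a))
    (add_nonneg (xi_re_one_div_nonneg a hs).1 (xi_re_one_div_nonneg a hs).2)

lemma zetaLogDer_le {s : ℂ} (hs : 1 < s.re) :
    zetaLogDer s ≤ (1 / (s - 1)).re + (digamma (s / 2 + 1)).re / 2 - Real.log Real.pi / 2 := by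
  have := (zetaLogDer_eq hs).nonneg fun a => xi_re_term_nonneg a hs
  linarith

lemma zetaLogDer_le_sub {s : ℂ} (hs : 1 < s.re) :
    zetaLogDer s ≤ (1 / (s - 1)).re + (digamma (s / 2 + 1)).re / 2 - Real.log Real.pi / 2 -
      ((1 / (s - xiRoot a)).re + (1 / (s - 1 + xiRoot a)).re) := by
  have h1 := le_hasSum (zetaLogDer_eq hs) a fun a _ => xi_re_term_nonneg a hs
  have h2 := le_mul_of_one_le_left
    (add_nonneg (xi_re_one_div_nonneg a hs).1 (xi_re_one_div_nonneg a hs).2) (one_le_xiMult a)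
  linarith

lemma zetaLogDer_ofReal_le {σ : ℝ} (hσ : 1 < σ) :
    zetaLogDer σ ≤ 1 / (σ - 1) + Real.log (σ / 2 + 1) / 2 - Real.log Real.pi / 2 := by
  have h := zetaLogDer_le (s := σ) (by simpa)
  have h2 := digamma_re_le_log (x := σ / 2 + 1) (by linarith)
  have e : (1 / ((σ:ℂ) - 1)).re = 1 / (σ - 1) := by
    rw [show 1 / ((σ:ℂ) - 1) = ((1 / (σ - 1) : ℝ) : ℂ) by push_cast; rfl, ofReal_re]
  push_cast at h2
  rw [e] at h
  linarith

lemma zetaLogDer_bound_im {σ t : ℝ} (hσ : 1 < σ) (hσ' : σ ≤ 1.27) (ht : 6.47 ≤ |t|) :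
    (1 / ((σ + t * I : ℂ) - 1)).re + (digamma ((σ + t * I : ℂ) / 2 + 1)).re / 2 -
      Real.log Real.pi / 2 ≤ Real.log |t| / 2 - 0.85 + 0.8272 / |t| := by
  have ht0 : 0 < |t| := lt_of_lt_of_le (by norm_num) ht
  have ht' : t ≠ 0 := abs_pos.1 ht0
  set w : ℂ := (σ + t * I : ℂ) / 2 + 1 with hw
  have hre : w.re = σ / 2 + 1 := by simp [hw]
  have him : w.im = t / 2 := by simp [hw]
  have h1 := digamma_re_le_abs (w := w) (by rw [hre]; linarith) (by rw [him]; simpa)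
  have h2 : ‖w‖ ≤ 1.1206 / 2 * |t| := by
    refine abs_le_of_sq_le_sq' (a := ‖w‖) ?_ (by positivity) |>.2
    rw [← Complex.normSq_eq_norm_sq, Complex.normSq_apply, hre, him, mul_pow, sq_abs]
    have : 6.47 ^ 2 ≤ t ^ 2 := by rw [← sq_abs t]; gcongr
    norm_num at this hσ' ⊢
    nlinarith
  have hwp : 0 < ‖w‖ := norm_pos_iff.2 fun h => by rw [h] at hre; simp at hre; linarith
  have h3 : Real.log ‖w‖ ≤ Real.log |t| + Real.log (1.1206 / 2) := by
    rw [← Real.log_mul ht0.ne' (by norm_num), mul_comm |t|]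
    exact Real.log_le_log hwp h2
  have h4 : Real.log (1.1206 / 2) - Real.log Real.pi ≤ -1.7 := by
    have hpi := Real.pi_gt_d6
    have e : Real.log (1.1206 / 2) - Real.log Real.pi = - Real.log (Real.pi * (2 / 1.1206)) := by
      rw [Real.log_mul Real.pi_ne_zero (by norm_num), Real.log_div (by norm_num) (by norm_num),
        Real.log_div (by norm_num) (by norm_num)]
      ring
    have h5 : Real.log (2 ^ 4 / 3 * 1.05) ≤ Real.log (Real.pi * (2 / 1.1206)) := by
      apply Real.log_le_log (by norm_num)
      norm_num at hpi ⊢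
      linarith
    rw [Real.log_mul (by norm_num) (by norm_num), Real.log_div (by norm_num) (by norm_num),
      Real.log_pow] at h5
    have h6 := Real.one_sub_inv_le_log_of_pos (x := 1.05) (by norm_num)
    have := Real.log_two_gt_d9
    have := Real.log_three_lt_d9
    rw [e]
    norm_num at *
    linarith
  have h5 : (1 / ((σ + t * I : ℂ) - 1)).re ≤ 0.27 / 6.47 / |t| := by
    rw [one_div, Complex.inv_re]
    have e1 : ((σ + t * I : ℂ) - 1).re = σ - 1 := by simp
    have e2 : ((σ + t * I : ℂ) - 1).im = t := by simp
    rw [Complex.normSq_apply, e1, e2]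
    calc (σ - 1) / ((σ - 1) * (σ - 1) + t * t) ≤ 0.27 / (6.47 * |t|) := by
          gcongr
          · norm_num at hσ' ⊢; linarith
          · rw [← abs_mul_abs_self t]
            nlinarith [mul_le_mul_of_nonneg_right ht ht0.le, mul_self_nonneg (σ - 1)]
      _ = _ := by field_simp
  have h6 : Real.pi / (4 * |w.im|) = Real.pi / 2 / |t| := by
    rw [him, abs_div, abs_two]; field_simp; norm_num
  rw [h6] at h1
  have h7 : 0.27 / 6.47 / |t| + Real.pi / 2 / |t| / 2 ≤ 0.8272 / |t| := by
    rw [div_div _ |t| 2, mul_comm |t| 2, ← div_div, ← add_div]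
    gcongr
    have := Real.pi_lt_d6
    norm_num at this ⊢
    linarith
  generalize (1 / ((σ + t * I : ℂ) - 1)).re = A at h5 ⊢
  generalize Real.log |t| = B at h3 ⊢
  generalize Real.log (1.1206 / 2) = C at h3 h4
  norm_num at h4 h5 h7 ⊢
  linarith

/-- A zero-free region for the zeta function, applied to the zeros `ρ` and `1 - ρ`. -/
lemma xiRoot_zero_free : 0.0539 / Real.log ((xiRoot a).im / 3) ≤ (xiRoot a).re ∧
    0.0539 / Real.log ((xiRoot a).im / 3) ≤ 1 - (xiRoot a).re := by
  set γ := (xiRoot a).im with hγ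
  set β := (xiRoot a).re with hβ
  have hg := xiRoot_im_gt a
  have h0 := xiRoot_re_pos a
  have h1 := xiRoot_re_lt_one a
  rw [← hγ] at hg
  rw [← hβ] at h0 h1
  set l := Real.log (γ / 3) with hl
  have hγ0 : 0 < γ := by linarith
  have hl1 : 0.76 < l := by
    have : Real.log (2 * 1.078) ≤ l := by
      apply Real.log_le_log (by norm_num)
      norm_num at hg ⊢
      linarith
    rw [Real.log_mul (by norm_num) (by norm_num)] at this
    have h6 := Real.one_sub_inv_le_log_of_pos (x := 1.078) (by norm_num)
    have := Real.log_two_gt_d9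
    norm_num at *
    linarith
  set σ := 1 + 1 / (5 * l) with hσ
  have hl0 : 0 < l := by linarith
  have hσ1 : 1 < σ := by rw [hσ]; linarith [show 0 < 1 / (5 * l) by positivity]
  have hσ2 : σ ≤ 1.27 := by
    have : 1 / (5 * l) ≤ 1 / (5 * 0.76) := by gcongr
    rw [hσ]; norm_num at this ⊢; linarith
  have key : ∀ c : ℝ, 0 < c → c < 1 → zetaLogDer (σ + γ * I) ≤ Real.log γ / 2 - 0.85 + 0.8272 / γ -
      1 / (σ - c) → 0.0539 / l ≤ 1 - c := by
    intro c hc0 hc1 hc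
    have b0 := zetaLogDer_ofReal_le hσ1
    have b2 := (zetaLogDer_le (s := σ + (2 * γ : ℝ) * I) (by simpa)).trans
      (zetaLogDer_bound_im hσ1 hσ2 (by rw [abs_of_pos (by positivity)]; linarith))
    have b3 := (zetaLogDer_le (s := σ + (3 * γ : ℝ) * I) (by simpa)).trans
      (zetaLogDer_bound_im hσ1 hσ2 (by rw [abs_of_pos (by positivity)]; linarith))
    have hcomb := zetaLogDer_comb_nonneg (t := γ) hσ1
    have hpi : Real.log (σ / 2 + 1) ≤ Real.log Real.pi := by
      apply Real.log_le_log (by linarith)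
      have := Real.pi_gt_three
      norm_num at hσ2
      linarith
    rw [abs_of_pos (by positivity), Real.log_mul (by norm_num) hγ0.ne'] at b2 b3
    have e2 : 0.8272 / (2 * γ) = 0.8272 / γ / 2 := by field_simp
    have e3 : 0.8272 / (3 * γ) = 0.8272 / γ / 3 := by field_simp
    rw [e2] at b2
    rw [e3] at b3
    have e4 : 0.8272 / γ ≤ 0.8272 / 6.47 := by gcongr
    have e5 : l = Real.log γ - Real.log 3 := by rw [hl, Real.log_div hγ0.ne' (by norm_num)]
    have l2 := Real.log_two_lt_d9
    have l3 := Real.log_three_lt_d9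
    have e6 : 1 / (σ - 1) = 5 * l := by rw [hσ]; field_simp; ring
    have hm : 8 / (σ - c) ≤ 31.5 * l := by
      rw [e6] at b0
      have : 8 / (σ - c) = 8 * (1 / (σ - c)) := by ring
      rw [this, e5]
      norm_num at *
      linarith
    rw [div_le_iff₀ (by linarith)] at hm
    rw [div_le_iff₀ hl0]
    have : σ * l = l + 1 / 5 := by rw [hσ]; field_simp
    norm_num at hm ⊢
    nlinarith
  have hinv : ∀ x : ℝ, (1 / (x:ℂ)).re = 1 / x := fun x => by
    rw [← ofReal_one, ← ofReal_div, ofReal_re]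
  have hroot : xiRoot a = β + γ * I := (Complex.re_add_im _).symm
  constructor
  · have := key (1 - β) (by linarith) (by linarith) ?_
    · linarith
    have hs : 1 < (σ + (-γ : ℝ) * I : ℂ).re := by simpa
    have b1 := zetaLogDer_le_sub a hs
    rw [zetaLogDer_conj hσ1] at b1
    have b2 := zetaLogDer_bound_im (t := -γ) hσ1 hσ2 (by rw [abs_neg, abs_of_pos hγ0]; exact hg.le)
    have b3 := (xi_re_one_div_nonneg a hs).1
    rw [abs_neg, abs_of_pos hγ0] at b2
    have e : (σ + (-γ : ℝ) * I : ℂ) - 1 + xiRoot a = ((σ - (1 - β) : ℝ) : ℂ) := by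
      rw [hroot]; push_cast; ring
    rw [e, hinv] at b1
    linarith
  · refine key β h0 h1 ?_
    have hs : 1 < (σ + γ * I : ℂ).re := by simpa
    have b1 := zetaLogDer_le_sub a hs
    have b2 := zetaLogDer_bound_im (t := γ) hσ1 hσ2 (by rw [abs_of_pos hγ0]; exact hg.le)
    have b3 := (xi_re_one_div_nonneg a hs).2
    rw [abs_of_pos hγ0] at b2
    have e : (σ + γ * I : ℂ) - xiRoot a = ((σ - β : ℝ) : ℂ) := by
      rw [hroot]; push_cast; ring
    rw [e, hinv] at b1
    linarith

end

section

open Complex Filter Topology Metric MeasureTheory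

/-- `G` has the absolutely convergent Laplace transform `L` at `s`. -/
def HasLaplace (G : ℝ → ℂ) (s L : ℂ) : Prop :=
  IntegrableOn (fun u : ℝ => Complex.exp (-s * u) * G u) (Set.Ioi 0) ∧
    ∫ u : ℝ in Set.Ioi 0, Complex.exp (-s * u) * G u = L

lemma HasLaplace.add {F G : ℝ → ℂ} {s K L : ℂ} (hF : HasLaplace F s K) (hG : HasLaplace G s L) :
    HasLaplace (fun u => F u + G u) s (K + L) := by
  have e : (fun u : ℝ => Complex.exp (-s * u) * (F u + G u)) =
      fun u : ℝ => Complex.exp (-s * u) * F u + Complex.exp (-s * u) * G u := by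
    ext u; ring
  rw [HasLaplace, e]
  exact ⟨hF.1.add hG.1, by rw [integral_add hF.1 hG.1, hF.2, hG.2]⟩

lemma HasLaplace.const_mul {F : ℝ → ℂ} {s K : ℂ} (hF : HasLaplace F s K) (c : ℂ) :
    HasLaplace (fun u => c * F u) s (c * K) := by
  have e : (fun u : ℝ => Complex.exp (-s * u) * (c * F u)) =
      fun u : ℝ => c * (Complex.exp (-s * u) * F u) := by
    ext u; ring
  rw [HasLaplace, e]
  exact ⟨hF.1.const_mul c, by rw [integral_const_mul, hF.2]⟩

lemma HasLaplace.sub {F G : ℝ → ℂ} {s K L : ℂ} (hF : HasLaplace F s K) (hG : HasLaplace G s L) :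
    HasLaplace (fun u => F u - G u) s (K - L) := by
  have := hF.add (hG.const_mul (-1))
  simpa [sub_eq_add_neg] using this

lemma hasLaplace_exp {w s : ℂ} (h : 0 < (s + w).re) :
    HasLaplace (fun u : ℝ => Complex.exp (-w * u)) s (1 / (s + w)) := by
  have e : (fun u : ℝ => Complex.exp (-s * u) * Complex.exp (-w * u)) =
      fun u : ℝ => Complex.exp (-(s + w) * u) := by
    ext u; rw [← Complex.exp_add]; ring_nf
  have h' : (-(s + w)).re < 0 := by rw [neg_re]; linarith
  have h0 : s + w ≠ 0 := fun h0 => by simp [h0] at h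
  rw [HasLaplace, e]
  refine ⟨integrableOn_exp_mul_complex_Ioi h' 0, ?_⟩
  rw [integral_exp_mul_complex_Ioi h']
  simp only [ofReal_zero, mul_zero, Complex.exp_zero]
  rw [neg_div_neg_eq]

lemma hasLaplace_one {s : ℂ} (h : 0 < s.re) : HasLaplace (fun _ => 1) s (1 / s) := by
  simpa using hasLaplace_exp (w := 0) (s := s) (by simpa)

lemma hasLaplace_id {s : ℂ} (h : 0 < s.re) : HasLaplace (fun u => u) s (1 / s ^ 2) := by
  have h0 : s ≠ 0 := fun h0 => by simp [h0] at h
  have hd : ∀ u : ℝ, HasDerivAt (fun u : ℝ => -(u / s + 1 / s ^ 2) * Complex.exp (-s * u))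
      (Complex.exp (-s * u) * u) u := by
    intro u
    have h1 : HasDerivAt (fun u : ℝ => (u : ℂ)) 1 u := Complex.ofRealCLM.hasDerivAt
    have h2 := (((h1.div_const s).add_const (1 / s ^ 2)).neg).mul ((h1.const_mul (-s)).cexp)
    refine h2.congr_deriv ?_
    simp only [Pi.neg_apply]
    field_simp
    ring
  have hi : IntegrableOn (fun u : ℝ => Complex.exp (-s * u) * u) (Set.Ioi 0) := by
    have := integrableOn_rpow_mul_exp_neg_mul_rpow (p := 1) (s := 1) (b := s.re) (by norm_num)
      one_pos h
    refine Integrable.mono' this (by fun_prop) ?_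
    filter_upwards [ae_restrict_mem measurableSet_Ioi] with u hu
    rw [norm_mul, Complex.norm_exp, Complex.norm_real, Real.norm_of_nonneg (le_of_lt hu),
      Real.rpow_one, mul_comm]
    simp
  refine ⟨hi, ?_⟩
  have ht : Tendsto (fun u : ℝ => -(u / s + 1 / s ^ 2) * Complex.exp (-s * u)) atTop (𝓝 0) := by
    rw [tendsto_zero_iff_norm_tendsto_zero]
    have t1 := Real.tendsto_pow_mul_exp_neg_atTop_nhds_zero 1
    have a1 : Tendsto (fun u : ℝ => u * Real.exp (-s.re * u)) atTop (𝓝 0) := by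
      have := (t1.comp (tendsto_id.const_mul_atTop h)).const_mul (1 / s.re)
      rw [mul_zero] at this
      refine this.congr fun u => ?_
      simp only [Function.comp_apply, id]
      field_simp
    have a2 : Tendsto (fun u : ℝ => Real.exp (-s.re * u)) atTop (𝓝 0) := by
      refine Real.tendsto_exp_atBot.comp ?_
      exact tendsto_id.const_mul_atTop_of_neg (by linarith)
    refine squeeze_zero' (g := fun u : ℝ => ‖1 / s‖ * (u * Real.exp (-s.re * u)) +
      ‖1 / s ^ 2‖ * Real.exp (-s.re * u)) (Eventually.of_forall fun _ => norm_nonneg _) ?_ ?_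
    · filter_upwards [eventually_ge_atTop 0] with u hu
      rw [norm_mul, norm_neg, Complex.norm_exp]
      have : ‖(u:ℂ) / s + 1 / s ^ 2‖ ≤ u * ‖1 / s‖ + ‖1 / s ^ 2‖ := by
        refine (norm_add_le _ _).trans (le_of_eq ?_)
        rw [div_eq_mul_one_div, norm_mul, Complex.norm_real, Real.norm_of_nonneg hu]
      have e : (-s * u).re = -s.re * u := by simp
      rw [e]
      calc _ ≤ (u * ‖1 / s‖ + ‖1 / s ^ 2‖) * Real.exp (-s.re * u) := by gcongr
        _ = _ := by ring
    · have := (a1.const_mul ‖1 / s‖).add (a2.const_mul ‖1 / s ^ 2‖)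
      simp only [mul_zero, add_zero] at this
      exact this
  have := integral_Ioi_of_hasDerivAt_of_tendsto' (a := 0) (fun u _ => hd u) hi ht
  rw [this]
  simp

lemma HasLaplace.tsum {ι : Type*} [Countable ι] {F : ι → ℝ → ℂ} {G : ℝ → ℂ} {s : ℂ} {L : ι → ℂ}
    {K : ℂ} (hF : ∀ i, HasLaplace (F i) s (L i))
    (hs : Summable fun i => ∫ u : ℝ in Set.Ioi 0, ‖Complex.exp (-s * u) * F i u‖)
    (hG : ∀ u : ℝ, 0 < u → HasSum (fun i => F i u) (G u)) (hK : HasSum L K) :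
    HasLaplace G s K := by
  have h1 := hasSum_integral_of_summable_integral_norm (fun i => (hF i).1) hs
  have hG' : ∀ u : ℝ, 0 < u → HasSum (fun i => Complex.exp (-s * u) * F i u)
      (Complex.exp (-s * u) * G u) := fun u hu => (hG u hu).mul_left _
  have e : ∫ u : ℝ in Set.Ioi 0, ∑' i, Complex.exp (-s * u) * F i u =
      ∫ u : ℝ in Set.Ioi 0, Complex.exp (-s * u) * G u :=
    setIntegral_congr_fun measurableSet_Ioi fun u hu => (hG' u hu).tsum_eq
  rw [e] at h1
  refine ⟨⟨?_, ?_⟩, h1.unique (by simpa only [(hF _).2] using hK)⟩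
  · refine aestronglyMeasurable_of_tendsto_ae (u := (atTop : Filter (Finset ι)))
      (f := fun S u => ∑ i ∈ S, Complex.exp (-s * (u:ℝ)) * F i u) (fun S => ?_) ?_
    · exact Finset.aestronglyMeasurable_fun_sum _ fun i _ => (hF i).1.1
    · filter_upwards [ae_restrict_mem measurableSet_Ioi] with u hu using hG' u hu
  · rw [HasFiniteIntegral]
    calc ∫⁻ u in Set.Ioi 0, ‖Complex.exp (-s * (u:ℝ)) * G u‖ₑ
        ≤ ∫⁻ u : ℝ in Set.Ioi 0, ∑' i, ‖Complex.exp (-s * u) * F i u‖ₑ := by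
          refine setLIntegral_mono_ae' measurableSet_Ioi (ae_of_all _ fun u hu => ?_)
          rw [← (hG' u hu).tsum_eq]
          exact enorm_tsum_le_tsum_enorm
      _ = ∑' i, ∫⁻ u : ℝ in Set.Ioi 0, ‖Complex.exp (-s * u) * F i u‖ₑ :=
          lintegral_tsum fun i => (hF i).1.1.enorm
      _ = ∑' i, ENNReal.ofReal (∫ u : ℝ in Set.Ioi 0, ‖Complex.exp (-s * u) * F i u‖) := by
          congr 1; ext i
          rw [ofReal_integral_norm_eq_lintegral_enorm (hF i).1]
      _ < ⊤ := by
          rw [← ENNReal.ofReal_tsum_of_nonneg (fun i => integral_nonneg fun _ => norm_nonneg _) hs]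
          exact ENNReal.ofReal_lt_top

/-- Uniqueness for Laplace transforms on a vertical line. -/
lemma eq_zero_of_hasLaplace_zero {G : ℝ → ℂ} {c : ℝ} (h : ∀ t : ℝ, HasLaplace G (c + t * I) 0)
    {u : ℝ} (hu : 0 < u) (hc : ContinuousAt G u) : G u = 0 := by
  set f : ℝ → ℂ := (Set.Ioi (0:ℝ)).indicator fun u : ℝ => Complex.exp (-c * u) * G u with hf
  have hfi : Integrable f := by
    rw [hf, integrable_indicator_iff measurableSet_Ioi]
    simpa using (h 0).1
  have hF : FourierTransform.fourier f = 0 := by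
    ext w
    rw [Real.fourier_real_eq_integral_exp_smul, Pi.zero_apply, ← (h (2 * Real.pi * w)).2,
      ← integral_indicator measurableSet_Ioi]
    congr 1
    ext v
    by_cases hv : v ∈ Set.Ioi (0:ℝ)
    · rw [hf, Set.indicator_of_mem hv, Set.indicator_of_mem hv, smul_eq_mul, ← mul_assoc,
        ← Complex.exp_add]
      congr 2
      push_cast; ring
    · rw [hf, Set.indicator_of_notMem hv, Set.indicator_of_notMem hv, smul_zero]
  have hev : f =ᶠ[𝓝 u] fun u : ℝ => Complex.exp (-c * u) * G u := by
    filter_upwards [Ioi_mem_nhds hu] with v hv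
    rw [hf, Set.indicator_of_mem hv]
  have hcf : ContinuousAt f u := by
    refine ContinuousAt.congr ?_ hev.symm
    exact ContinuousAt.mul (by fun_prop) hc
  have := hfi.fourierInv_fourier_eq (by rw [hF]; exact integrable_zero _ _ _) hcf
  rw [hF, hev.self_of_nhds] at this
  simp [Real.fourierInv_eq'] at this
  exact this

end

section

open Complex Filter Topology Metric MeasureTheory

/-- `∑_{n ≤ e^u} Λ(n) (1/n - e^{-u})`. -/
noncomputable def psiOne (u : ℝ) : ℝ :=
  ∑ n ∈ Finset.Ioc 0 ⌊Real.exp u⌋₊, ArithmeticFunction.vonMangoldt n * (1 / n - Real.exp (-u))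

lemma psiOne_eq_sum_max {u : ℝ} {N : ℕ} (hN : ⌊Real.exp u⌋₊ ≤ N) :
    psiOne u = ∑ n ∈ Finset.Ioc 0 N,
      ArithmeticFunction.vonMangoldt n * max 0 (1 / (n:ℝ) - Real.exp (-u)) := by
  rw [← Finset.sum_subset (Finset.Ioc_subset_Ioc_right hN), psiOne]
  · refine Finset.sum_congr rfl fun n hn => ?_
    rw [Finset.mem_Ioc] at hn
    rw [max_eq_right]
    have hn0 : (0:ℝ) < n := by exact_mod_cast hn.1
    rw [Real.exp_neg, sub_nonneg, one_div]
    gcongr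
    exact (Nat.le_floor_iff (Real.exp_pos u).le).1 hn.2
  · intro n hn hn'
    rw [Finset.mem_Ioc] at hn hn'
    have hn0 : (0:ℝ) < n := by exact_mod_cast hn.1
    rw [max_eq_left, mul_zero]
    have : Real.exp u < n := (Nat.floor_lt (Real.exp_pos u).le).1 (by omega)
    rw [Real.exp_neg, sub_nonpos, one_div]
    gcongr

lemma hasSum_psiOne (u : ℝ) :
    HasSum (fun n : ℕ => ArithmeticFunction.vonMangoldt n * max 0 (1 / (n:ℝ) - Real.exp (-u)))
      (psiOne u) := by
  rw [psiOne_eq_sum_max le_rfl]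
  refine hasSum_sum_of_ne_finset_zero fun n hn => ?_
  rcases Nat.eq_zero_or_pos n with rfl | h
  · simp
  rw [Finset.mem_Ioc, not_and] at hn
  have hn0 : (0:ℝ) < n := by exact_mod_cast h
  rw [max_eq_left, mul_zero]
  have : Real.exp u < n := (Nat.floor_lt (Real.exp_pos u).le).1 (by have := hn h; omega)
  rw [Real.exp_neg, sub_nonpos, one_div]
  gcongr

lemma continuous_psiOne : Continuous psiOne := by
  rw [continuous_iff_continuousAt]
  intro u
  have hev : (fun v => ∑ n ∈ Finset.Ioc 0 ⌊Real.exp (u + 1)⌋₊,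
      ArithmeticFunction.vonMangoldt n * max 0 (1 / (n:ℝ) - Real.exp (-v))) =ᶠ[𝓝 u] psiOne := by
    filter_upwards [Iio_mem_nhds (show u < u + 1 by linarith)] with v hv
    exact (psiOne_eq_sum_max (Nat.floor_le_floor (Real.exp_le_exp.2 (le_of_lt hv)))).symm
  refine ContinuousAt.congr ?_ hev
  fun_prop

lemma hasLaplace_max {n : ℕ} (hn : 1 ≤ n) {s : ℂ} (hs : 0 < s.re) :
    HasLaplace (fun u : ℝ => ((max 0 (1 / (n:ℝ) - Real.exp (-u)) : ℝ) : ℂ)) s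
      ((n:ℂ) ^ (-(1 + s)) / (s * (s + 1))) := by
  have hn0 : (0:ℝ) < n := by exact_mod_cast hn
  have hl : 0 ≤ Real.log n := Real.log_nonneg (by exact_mod_cast hn)
  have e : (fun u : ℝ => Complex.exp (-s * u) * ((max 0 (1 / (n:ℝ) - Real.exp (-u)) : ℝ) : ℂ)) =
      (Set.Ioi (Real.log n)).indicator fun u : ℝ =>
        1 / (n:ℂ) * Complex.exp (-s * u) - Complex.exp (-(s + 1) * u) := by
    ext u
    by_cases hu : Real.log n < u
    · rw [Set.indicator_of_mem (by exact hu), max_eq_right]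
      · push_cast
        rw [mul_sub, ← Complex.exp_add]
        ring_nf
      · rw [Real.exp_neg, sub_nonneg, one_div]
        gcongr
        exact ((Real.log_lt_iff_lt_exp hn0).1 hu).le
    · rw [Set.indicator_of_notMem (by exact hu), max_eq_left, ofReal_zero, mul_zero]
      rw [Real.exp_neg, sub_nonpos, one_div]
      have := (Real.le_log_iff_exp_le hn0).1 (not_lt.1 hu)
      gcongr
  have hsub : Set.Ioi (0:ℝ) ∩ Set.Ioi (Real.log n) = Set.Ioi (Real.log n) := by
    rw [Set.inter_eq_right]; exact Set.Ioi_subset_Ioi hl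
  have i1 := (integrableOn_exp_mul_complex_Ioi (a := -s) (by simpa using hs) (Real.log n)).const_mul
    (1 / (n:ℂ))
  have i2 := integrableOn_exp_mul_complex_Ioi (a := -(s + 1)) (by simp; linarith) (Real.log n)
  rw [HasLaplace, e]
  constructor
  · rw [IntegrableOn, integrable_indicator_iff measurableSet_Ioi, IntegrableOn,
      Measure.restrict_restrict measurableSet_Ioi, Set.inter_comm, hsub]
    exact i1.sub i2
  · rw [setIntegral_indicator measurableSet_Ioi, hsub, integral_sub i1 i2, integral_const_mul,
      integral_exp_mul_complex_Ioi (by simpa using hs),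
      integral_exp_mul_complex_Ioi (by simp; linarith)]
    have h0 : s ≠ 0 := fun h0 => by simp [h0] at hs
    have h1 : s + 1 ≠ 0 := fun h1 => by
      have := congrArg Complex.re h1; simp at this; linarith
    have hnc : (n:ℂ) ≠ 0 := by exact_mod_cast hn0.ne'
    rw [Complex.cpow_def_of_ne_zero hnc, ← Complex.natCast_log]
    have e1 : Complex.exp (-(s + 1) * (Real.log n : ℝ)) = Complex.exp (-s * (Real.log n : ℝ)) / n := by
      rw [show -(s + 1) * ((Real.log n : ℝ) : ℂ) = -s * (Real.log n : ℝ) - (Real.log n : ℝ) by ring,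
        Complex.exp_sub, ← Complex.ofReal_exp, Real.exp_log hn0, ofReal_natCast]
    have e2 : Complex.exp (((Real.log n : ℝ) : ℂ) * -(1 + s)) =
        Complex.exp (-s * (Real.log n : ℝ)) / n := by rw [← e1]; ring_nf
    rw [e2, e1]
    field_simp
    ring

lemma hasLaplace_psiOne {s : ℂ} (hs : 0 < s.re) :
    HasLaplace (fun u => (psiOne u : ℂ)) s
      (-deriv riemannZeta (1 + s) / riemannZeta (1 + s) / (s * (s + 1))) := by
  have hs1 : 1 < (1 + s).re := by simpa
  have hT : ∀ {s : ℂ}, 0 < s.re → ∀ n : ℕ, HasLaplace (fun u : ℝ =>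
      ((ArithmeticFunction.vonMangoldt n * max 0 (1 / (n:ℝ) - Real.exp (-u)) : ℝ) : ℂ)) s
      (LSeries.term (fun n => (ArithmeticFunction.vonMangoldt n : ℂ)) (1 + s) n / (s * (s + 1))) := by
    intro s hs n
    rcases Nat.eq_zero_or_pos n with rfl | h
    · simp [HasLaplace]
    · have := (hasLaplace_max h hs).const_mul (ArithmeticFunction.vonMangoldt n : ℂ)
      rw [LSeries.term_of_ne_zero (by omega), div_eq_mul_inv _ ((n:ℂ) ^ (1 + s)), ← Complex.cpow_neg,
        mul_div_assoc]
      simpa only [ofReal_mul] using this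
  refine HasLaplace.tsum (hT hs) ?_ (fun u _ => ?_) ?_
  · have hsr : 0 < ((s.re : ℂ)).re := by simpa
    have hsum := ((ArithmeticFunction.LSeriesSummable_vonMangoldt
      (s := 1 + (s.re : ℂ)) (by simpa)).norm.div_const ‖(s.re : ℂ) * (s.re + 1)‖)
    refine hsum.congr fun n => ?_
    rw [← norm_div, ← (hT hsr n).2]
    have : ∀ u : ℝ, Complex.exp (-(s.re:ℂ) * u) *
        ((ArithmeticFunction.vonMangoldt n * max 0 (1 / (n:ℝ) - Real.exp (-u)) : ℝ) : ℂ) =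
        ((‖Complex.exp (-s * u) *
        ((ArithmeticFunction.vonMangoldt n * max 0 (1 / (n:ℝ) - Real.exp (-u)) : ℝ) : ℂ)‖ : ℝ) : ℂ) := by
      intro u
      rw [norm_mul, Complex.norm_exp, Complex.norm_real, Real.norm_of_nonneg
        (mul_nonneg ArithmeticFunction.vonMangoldt_nonneg (le_max_left _ _))]
      push_cast
      simp
    simp_rw [this]
    rw [integral_complex_ofReal, Complex.norm_real, Real.norm_of_nonneg
      (integral_nonneg fun _ => norm_nonneg _)]
  · exact_mod_cast Complex.hasSum_ofReal.2 (hasSum_psiOne u)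
  · have h := (ArithmeticFunction.LSeriesSummable_vonMangoldt hs1).LSeriesHasSum
    rw [ArithmeticFunction.LSeries_vonMangoldt_eq_deriv_riemannZeta_div hs1] at h
    exact h.div_const _

end

section

open Complex Filter Topology Metric MeasureTheory

lemma HasLaplace.tsum_of_norm_le {ι : Type*} [Countable ι] {F : ι → ℝ → ℂ} {G : ℝ → ℂ} {s : ℂ}
    {L : ι → ℂ} {K : ℂ} {b : ι → ℝ} (hs : 0 < s.re) (hF : ∀ i, HasLaplace (F i) s (L i))
    (hb : Summable b) (hFb : ∀ i, ∀ u : ℝ, 0 < u → ‖F i u‖ ≤ b i)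
    (hG : ∀ u : ℝ, 0 < u → HasSum (fun i => F i u) (G u)) (hK : HasSum L K) :
    HasLaplace G s K := by
  refine HasLaplace.tsum hF ?_ hG hK
  have hi : IntegrableOn (fun u : ℝ => Real.exp (-s.re * u)) (Set.Ioi 0) :=
    integrableOn_exp_mul_Ioi (by linarith) 0
  have hv : ∫ u : ℝ in Set.Ioi 0, Real.exp (-s.re * u) = 1 / s.re := by
    rw [integral_exp_mul_Ioi (by linarith)]
    simp [neg_div_neg_eq]
  refine Summable.of_nonneg_of_le (fun i => integral_nonneg fun _ => norm_nonneg _) (fun i => ?_)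
    (hb.mul_right (1 / s.re))
  rw [← hv, ← integral_const_mul]
  refine setIntegral_mono_on (hF i).1.norm (hi.const_mul _) measurableSet_Ioi fun u hu => ?_
  rw [norm_mul, Complex.norm_exp, mul_comm]
  have e : (-s * (u:ℂ)).re = -s.re * u := by simp
  rw [e]
  gcongr
  exact hFb i u hu

lemma hasLaplace_ofReal_exp {s : ℂ} (hs : 0 < s.re) {c : ℝ} (hc : 0 ≤ c) :
    HasLaplace (fun u : ℝ => ((Real.exp (-c * u) : ℝ) : ℂ)) s (1 / (s + c)) := by
  have := hasLaplace_exp (w := (c : ℂ)) (s := s) (by simp; linarith)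
  convert this using 2 with u
  push_cast
  rfl

/-- The weights of the trivial zeros. -/
noncomputable def trivialWeight (k : ℕ) : ℝ := 1 / ((2 * k + 2) * (2 * k + 3))

lemma trivialWeight_pos (k : ℕ) : 0 < trivialWeight k := by unfold trivialWeight; positivity

lemma hasSum_trivialWeight : HasSum trivialWeight (1 - Real.log 2) := by
  have h1 := digamma_add_one_ofReal (x := 1 / 2) (by norm_num)
  have h2 := Complex.digamma_apply_add_one (1 / 2) (fun m h => by
    have := congrArg Complex.re h
    simp at this
    have h3 : (0:ℝ) ≤ m := by positivity
    linarith)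
  rw [Complex.digamma_one_half] at h2
  have h3 : ((1 / 2 : ℝ) : ℂ) = 1 / 2 := by push_cast; rfl
  rw [h3, h2] at h1
  have h4 := (summable_digammaSeries (z := 1 / 2) (by norm_num)).hasSum
  have h5 : digammaSeries (1 / 2) = ((2 * (1 - Real.log 2) : ℝ) : ℂ) := by
    have h6 : Complex.log 2 = ((Real.log 2 : ℝ) : ℂ) := by
      rw [Complex.ofReal_log (by norm_num)]; norm_num
    rw [h6] at h1
    push_cast
    linear_combination -h1
  have h4' : HasSum (fun k : ℕ => (1 / 2 : ℂ) / ((k + 1) * (1 / 2 + (k + 1)))) (digammaSeries (1 / 2)) := h4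
  rw [h5] at h4'
  have h6 : (fun k : ℕ => (1 / 2 : ℂ) / ((k + 1) * (1 / 2 + (k + 1)))) =
      fun k => ((2 * trivialWeight k : ℝ) : ℂ) := by
    ext k
    have e1 : ((k:ℂ) + 1) ≠ 0 := by exact_mod_cast Nat.succ_ne_zero k
    have e2 : (2 * (k:ℂ) + 3) ≠ 0 := by exact_mod_cast (show 2 * k + 3 ≠ 0 by omega)
    have e3 : (2 * (k:ℂ) + 2) ≠ 0 := by exact_mod_cast (show 2 * k + 2 ≠ 0 by omega)
    have e4 : (1 / 2 + ((k:ℂ) + 1)) ≠ 0 := by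
      intro h; apply e2; linear_combination 2 * h
    have e5 : (1 / 2 + ((k:ℂ) + 1)) = (2 * k + 3) / 2 := by ring
    rw [e5]
    unfold trivialWeight
    push_cast
    field_simp
  rw [h6, Complex.hasSum_ofReal] at h4'
  have h7 := h4'.mul_left (1 / 2 : ℝ)
  rw [show (1 / 2 : ℝ) * (2 * (1 - Real.log 2)) = 1 - Real.log 2 by ring] at h7
  refine h7.congr_fun fun k => ?_
  ring

/-- The contribution of the trivial zeros. -/
noncomputable def trivialSum (u : ℝ) : ℝ := ∑' k : ℕ, trivialWeight k * Real.exp (-(2 * k + 3) * u)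

lemma trivial_term_le (k : ℕ) {u : ℝ} (hu : 0 ≤ u) :
    trivialWeight k * Real.exp (-(2 * k + 3) * u) ≤ trivialWeight k * Real.exp (-u) := by
  have := trivialWeight_pos k
  gcongr
  have : (0:ℝ) ≤ k * u := by positivity
  nlinarith

lemma summable_trivial {u : ℝ} (hu : 0 ≤ u) :
    Summable fun k : ℕ => trivialWeight k * Real.exp (-(2 * k + 3) * u) :=
  Summable.of_nonneg_of_le (fun k => mul_nonneg (trivialWeight_pos k).le (Real.exp_pos _).le)
    (fun k => trivial_term_le k hu) (hasSum_trivialWeight.summable.mul_right _)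

lemma trivialSum_nonneg (u : ℝ) : 0 ≤ trivialSum u :=
  tsum_nonneg fun k => mul_nonneg (trivialWeight_pos k).le (Real.exp_pos _).le

lemma trivialSum_le {u : ℝ} (hu : 0 ≤ u) : trivialSum u ≤ (1 - Real.log 2) * Real.exp (-u) :=
  (summable_trivial hu).tsum_le_tsum (fun k => trivial_term_le k hu)
    (hasSum_trivialWeight.summable.mul_right _) |>.trans_eq
    (hasSum_trivialWeight.mul_right _).tsum_eq

lemma continuousOn_trivialSum : ContinuousOn trivialSum (Set.Ioi 0) := by
  refine continuousOn_tsum (u := trivialWeight) (fun k => by fun_prop) hasSum_trivialWeight.summable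
    fun k u hu => ?_
  rw [Real.norm_of_nonneg (mul_nonneg (trivialWeight_pos k).le (Real.exp_pos _).le)]
  refine (trivial_term_le k (le_of_lt hu)).trans ?_
  have : Real.exp (-u) ≤ 1 := Real.exp_le_one_iff.2 (by simpa using le_of_lt hu)
  nlinarith [trivialWeight_pos k]

lemma hasLaplace_trivial {s : ℂ} (hs : 0 < s.re) :
    HasLaplace (fun u => ((1 - Real.log 2 - trivialSum u : ℝ) : ℂ)) s
      (digammaSeries ((s + 1) / 2) / 2 / (s * (s + 1))) := by
  have h0 : s ≠ 0 := fun h0 => by simp [h0] at hs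
  have h1 : s + 1 ≠ 0 := fun h1 => by
    have := congrArg Complex.re h1; simp at this; linarith
  refine HasLaplace.tsum_of_norm_le (ι := ℕ) (b := trivialWeight)
    (F := fun k u => (trivialWeight k : ℂ) * (1 - ((Real.exp (-(2 * k + 3) * u) : ℝ) : ℂ)))
    (L := fun k => (trivialWeight k : ℂ) * (1 / s - 1 / (s + (2 * k + 3 : ℝ)))) hs
    (fun k => ?_) hasSum_trivialWeight.summable (fun k u hu => ?_) (fun u hu => ?_) ?_
  · exact ((hasLaplace_one hs).sub (hasLaplace_ofReal_exp hs (by positivity))).const_mul _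
  · have hw := trivialWeight_pos k
    have h : Real.exp (-(2 * k + 3) * u) ≤ 1 := Real.exp_le_one_iff.2 (by
      have : 0 < (2 * (k:ℝ) + 3) * u := by positivity
      linarith)
    rw [← ofReal_one, ← ofReal_sub, ← ofReal_mul, Complex.norm_real, Real.norm_of_nonneg
      (mul_nonneg hw.le (sub_nonneg.2 h))]
    nlinarith [Real.exp_pos (-(2 * k + 3) * u)]
  · have h := hasSum_trivialWeight.sub (summable_trivial hu.le).hasSum
    have := Complex.hasSum_ofReal.2 h
    refine this.congr_fun fun k => ?_
    push_cast; ring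
  · have h := ((summable_digammaSeries (z := (s + 1) / 2) (by simp; linarith)).hasSum).div_const
      (2 * (s * (s + 1)))
    have h' : HasSum (fun k : ℕ => (s + 1) / 2 / ((k + 1) * ((s + 1) / 2 + (k + 1))) / (2 * (s * (s + 1))))
      (digammaSeries ((s + 1) / 2) / (2 * (s * (s + 1)))) := h
    rw [div_div]
    convert h' using 1
    ext k
    have e1 : ((k:ℂ) + 1) ≠ 0 := by exact_mod_cast Nat.succ_ne_zero k
    have e2 : (2 * (k:ℂ) + 3) ≠ 0 := by exact_mod_cast (show 2 * k + 3 ≠ 0 by omega)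
    have e3 : (2 * (k:ℂ) + 2) ≠ 0 := by exact_mod_cast (show 2 * k + 2 ≠ 0 by omega)
    have e4 : s + (2 * (k:ℂ) + 3) ≠ 0 := fun h => by
      have := congrArg Complex.re h
      simp at this
      have h3 : (0:ℝ) ≤ k := by positivity
      linarith
    have e5 : (s + 1) / 2 + ((k:ℂ) + 1) ≠ 0 := fun h => by apply e4; linear_combination 2 * h
    have e6 : (s + 1) / 2 + ((k:ℂ) + 1) = (s + (2 * (k:ℂ) + 3)) / 2 := by ring
    rw [e6]
    unfold trivialWeight
    push_cast
    field_simp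
    ring

section
variable (a : {a : ℂ // xiFun a = 0})

instance countable_xiZeros : Countable {a : ℂ // xiFun a = 0} := by
  have := summable_xiMult_div_norm.countable_support
  rw [show Function.support _ = Set.univ from Set.eq_univ_of_forall fun a =>
    (div_pos (zero_lt_one.trans_le (one_le_xiMult a)) (norm_pos_iff.2 (xiZero_ne_zero a))).ne'] at this
  exact Set.countable_univ_iff.1 this

/-- The pair of terms of the explicit formula that belong to the zeros `ρ`, `1 - ρ`. -/
noncomputable def zeroTerm (u : ℝ) : ℂ :=
  (xiMult a : ℂ) / (0 - a) * (Complex.exp (-(1 - xiRoot a) * u) + Complex.exp (-xiRoot a * u))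

lemma norm_zeroTerm_le_exp (u : ℝ) : ‖zeroTerm a u‖ ≤ xiMult a / ‖(a:ℂ)‖ *
    (Real.exp (-(1 - (xiRoot a).re) * u) + Real.exp (-(xiRoot a).re * u)) := by
  rw [zeroTerm, norm_mul, norm_div, zero_sub, norm_neg, Complex.norm_real, Real.norm_of_nonneg
    (zero_le_one.trans (one_le_xiMult a))]
  refine mul_le_mul_of_nonneg_left ((norm_add_le _ _).trans_eq ?_) (xiMult_div_norm_nonneg a)
  rw [Complex.norm_exp, Complex.norm_exp]
  simp

lemma norm_zeroTerm_le {u : ℝ} (hu : 0 < u) : ‖zeroTerm a u‖ ≤ 2 * (xiMult a / ‖(a:ℂ)‖) := by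
  refine (norm_zeroTerm_le_exp a u).trans ?_
  rw [mul_comm]
  refine mul_le_mul_of_nonneg_right ?_ (xiMult_div_norm_nonneg a)
  have h1 : Real.exp (-(1 - (xiRoot a).re) * u) ≤ 1 := Real.exp_le_one_iff.2 (by
    have := mul_pos (sub_pos.2 (xiRoot_re_lt_one a)) hu; linarith)
  have h2 : Real.exp (-(xiRoot a).re * u) ≤ 1 := Real.exp_le_one_iff.2 (by
    have := mul_pos (xiRoot_re_pos a) hu; linarith)
  linarith

lemma summable_zeroTerm {u : ℝ} (hu : 0 < u) : Summable fun a => zeroTerm a u :=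
  Summable.of_norm_bounded (summable_xiMult_div_norm.mul_left 2) fun a => norm_zeroTerm_le a hu

lemma continuousOn_tsum_zeroTerm : ContinuousOn (fun u => ∑' a, zeroTerm a u) (Set.Ioi 0) := by
  refine continuousOn_tsum (fun a => ?_) (summable_xiMult_div_norm.mul_left 2)
    fun a u hu => norm_zeroTerm_le a hu
  unfold zeroTerm
  fun_prop

lemma hasLaplace_zeroTerm {s : ℂ} (hs : 0 < s.re) : HasLaplace (zeroTerm a) s
    ((2 * s + 1) / (s * (s + 1)) * ((xiMult a : ℂ) / (0 - a) - (xiMult a : ℂ) / (s * (s + 1) - a))) := by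
  have r1 : 0 < (s + (1 - xiRoot a)).re := by
    have := xiRoot_re_lt_one a; simp; linarith
  have r2 : 0 < (s + xiRoot a).re := by
    have := xiRoot_re_pos a; simp; linarith
  have := ((hasLaplace_exp r1).add (hasLaplace_exp r2)).const_mul ((xiMult a : ℂ) / (0 - a))
  refine ⟨this.1, this.2.trans ?_⟩
  have h0 : s ≠ 0 := fun h0 => by simp [h0] at hs
  have h1 : s + 1 ≠ 0 := fun h1 => by
    have := congrArg Complex.re h1; simp at this; linarith
  have n1 : s + (1 - xiRoot a) ≠ 0 := fun h => by simp [h] at r1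
  have n2 : s + xiRoot a ≠ 0 := fun h => by simp [h] at r2
  have ha := xiZero_ne_zero a
  have e : s * (s + 1) - a = (s + (1 - xiRoot a)) * (s + xiRoot a) := by
    rw [← xiRoot_mul_sub_one a]; ring
  have ha' : (0 - (a:ℂ)) ≠ 0 := by simpa using ha
  have e2 : (xiMult a : ℂ) / (0 - a) - (xiMult a : ℂ) / (s * (s + 1) - a) =
      (xiMult a : ℂ) * (s * (s + 1)) / ((0 - a) * ((s + (1 - xiRoot a)) * (s + xiRoot a))) := by
    rw [div_sub_div _ _ ha' (by rw [e]; exact mul_ne_zero n1 n2), e]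
    congr 1
    linear_combination (-(xiMult a : ℂ)) * e
  rw [e2]
  field_simp
  ring
end

lemma hasLaplace_tsum_zeroTerm {s : ℂ} (hs : 0 < s.re) :
    HasLaplace (fun u => ∑' a, zeroTerm a u) s ((2 * s + 1) / (s * (s + 1)) * completedRiemannZeta₀ 1 -
      (1 / s + digamma ((s + 1) / 2 + 1) / 2 - Real.log Real.pi / 2 +
        deriv riemannZeta (1 + s) / riemannZeta (1 + s)) / (s * (s + 1))) := by
  have h0 : s ≠ 0 := fun h0 => by simp [h0] at hs
  have h1 : s + 1 ≠ 0 := fun h1 => by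
    have := congrArg Complex.re h1; simp at this; linarith
  have hs1 : 1 < (s + 1).re := by simpa
  refine HasLaplace.tsum_of_norm_le hs (fun a => hasLaplace_zeroTerm a hs)
    (summable_xiMult_div_norm.mul_left 2) (fun a u hu => norm_zeroTerm_le a hu)
    (fun u hu => (summable_zeroTerm hu).hasSum) ?_
  have hv0 : xiFun 0 ≠ 0 := xiFun_zero_ne
  have hv : xiFun (s * (s + 1)) ≠ 0 := by
    have := xiFun_ne_zero_of_one_le_re hs1.le
    simpa [mul_comm] using this
  have hc := logDeriv_xiFun_comp hs1
  rw [show (s + 1) * (s + 1 - 1) = s * (s + 1) by ring] at hc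
  have h := ((hasSum_logDeriv_xiFun hv0).sub (hasSum_logDeriv_xiFun hv)).mul_left
    ((2 * s + 1) / (s * (s + 1)))
  suffices e : (2 * s + 1) / (s * (s + 1)) * (logDeriv xiFun 0 - logDeriv xiFun (s * (s + 1))) =
      (2 * s + 1) / (s * (s + 1)) * completedRiemannZeta₀ 1 -
      (1 / s + digamma ((s + 1) / 2 + 1) / 2 - Real.log Real.pi / 2 +
        deriv riemannZeta (1 + s) / riemannZeta (1 + s)) / (s * (s + 1)) by
    rw [e] at h
    exact h
  rw [logDeriv_apply xiFun 0, deriv_xiFun_zero, xiFun_zero, div_one, mul_sub]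
  congr 1
  rw [div_mul_eq_mul_div]
  congr 1
  rw [show 2 * s + 1 = 2 * (s + 1) - 1 by ring, hc, show s + 1 - 1 = s by ring, add_comm 1 s]

/-- The error term of the explicit formula. -/
noncomputable def psiOneErr (u : ℝ) : ℝ := psiOne u - (u - Real.eulerMascheroniConstant - 1)

lemma psiOneErr_eq {u : ℝ} (hu : 0 < u) :
    (psiOneErr u : ℂ) = (∑' a, zeroTerm a u) + ((Real.log (2 * Real.pi) * Real.exp (-u) - trivialSum u : ℝ) : ℂ) := by
  set G : ℝ → ℂ := fun u => (psiOneErr u : ℂ) - ((∑' a, zeroTerm a u) +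
    ((Real.log (2 * Real.pi) * Real.exp (-u) - trivialSum u : ℝ) : ℂ)) with hG
  have hl4 : Real.log (4 * Real.pi) = 2 * Real.log 2 + Real.log Real.pi := by
    rw [Real.log_mul (by norm_num) Real.pi_ne_zero, show (4:ℝ) = 2 ^ 2 by norm_num, Real.log_pow]
    norm_num
  have hl2 : Real.log (2 * Real.pi) = Real.log 2 + Real.log Real.pi :=
    Real.log_mul (by norm_num) Real.pi_ne_zero
  have hB : completedRiemannZeta₀ 1 = ((1 + Real.eulerMascheroniConstant / 2 - Real.log (4 * Real.pi) / 2 : ℝ) : ℂ) := by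
    rw [completedRiemannZeta₀_one]
    have : Complex.log (4 * Real.pi) = ((Real.log (4 * Real.pi) : ℝ) : ℂ) := by
      rw [Complex.ofReal_log (by positivity)]; push_cast; rfl
    rw [this]; push_cast; ring
  have hL : ∀ s : ℂ, 0 < s.re → HasLaplace G s 0 := by
    intro s hs
    have h0 : s ≠ 0 := fun h0 => by simp [h0] at hs
    have h1 : s + 1 ≠ 0 := fun h1 => by
      have := congrArg Complex.re h1; simp at this; linarith
    have hdg := digamma_add_one_eq (z := (s + 1) / 2) (by simp; linarith)
    have hexp := hasLaplace_ofReal_exp hs (c := 1) zero_le_one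
    have H := ((((((hasLaplace_psiOne hs).sub (hasLaplace_id hs)).add ((hasLaplace_one hs).const_mul
      ((Real.eulerMascheroniConstant + 1 : ℝ) : ℂ))).sub (hasLaplace_tsum_zeroTerm hs)).sub
      (hexp.const_mul (Real.log (2 * Real.pi) : ℂ))).sub (hasLaplace_trivial hs)).add
      ((hasLaplace_one hs).const_mul ((1 - Real.log 2 : ℝ) : ℂ))
    convert H using 1
    · ext u
      simp only [hG, psiOneErr]
      push_cast
      ring_nf
    · rw [hdg, hB, hl4, hl2]
      push_cast
      field_simp
      ring
  have hcont : ContinuousAt G u := by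
    have hmem : Set.Ioi (0:ℝ) ∈ 𝓝 u := Ioi_mem_nhds hu
    have c1 := continuousOn_tsum_zeroTerm.continuousAt hmem
    have c2 := continuousOn_trivialSum.continuousAt hmem
    have c3 := continuous_psiOne.continuousAt (x := u)
    have c4 : ContinuousAt psiOneErr u := by unfold psiOneErr; fun_prop
    have c5 : ContinuousAt (fun u => Real.log (2 * Real.pi) * Real.exp (-u) - trivialSum u) u := by fun_prop
    exact (Complex.continuous_ofReal.continuousAt.comp c4).sub
      (c1.add (Complex.continuous_ofReal.continuousAt.comp c5))
  have := eq_zero_of_hasLaplace_zero (c := 1) (fun t => hL _ (by simp)) hu hcont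
  exact sub_eq_zero.1 this

lemma summable_zero_bound {u : ℝ} (hu : 0 < u) : Summable fun a => xiMult a / ‖(a:ℂ)‖ *
    (Real.exp (-(1 - (xiRoot a).re) * u) + Real.exp (-(xiRoot a).re * u)) := by
  refine Summable.of_nonneg_of_le (fun a => mul_nonneg (xiMult_div_norm_nonneg a) (by positivity))
    (fun a => ?_) (summable_xiMult_div_norm.mul_left 2)
  rw [mul_comm]
  refine mul_le_mul_of_nonneg_right ?_ (xiMult_div_norm_nonneg a)
  have h1 : Real.exp (-(1 - (xiRoot a).re) * u) ≤ 1 := Real.exp_le_one_iff.2 (by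
    have := mul_pos (sub_pos.2 (xiRoot_re_lt_one a)) hu; linarith)
  have h2 : Real.exp (-(xiRoot a).re * u) ≤ 1 := Real.exp_le_one_iff.2 (by
    have := mul_pos (xiRoot_re_pos a) hu; linarith)
  linarith

theorem abs_psiOneErr_le {u : ℝ} (hu : 0 < u) : |psiOneErr u| ≤ (∑' a, xiMult a / ‖(a:ℂ)‖ *
    (Real.exp (-(1 - (xiRoot a).re) * u) + Real.exp (-(xiRoot a).re * u))) +
      Real.log (2 * Real.pi) * Real.exp (-u) := by
  rw [← Real.norm_eq_abs, ← Complex.norm_real, psiOneErr_eq hu]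
  refine (norm_add_le _ _).trans (add_le_add (tsum_of_norm_bounded (summable_zero_bound hu).hasSum
    fun a => norm_zeroTerm_le_exp a u) ?_)
  have h1 := trivialSum_nonneg u
  have h2 := trivialSum_le hu.le
  have h3 : 1 - Real.log 2 ≤ Real.log (2 * Real.pi) := by
    have a1 := Real.log_two_gt_d9
    have : Real.log 4 ≤ Real.log (2 * Real.pi) :=
      Real.log_le_log (by norm_num) (by linarith [Real.pi_gt_three])
    rw [show (4:ℝ) = 2 ^ 2 by norm_num, Real.log_pow] at this
    push_cast at this
    linarith
  rw [Complex.norm_real, Real.norm_of_nonneg]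
  · linarith
  · nlinarith [Real.exp_pos (-u)]

end

section

open Complex Filter Topology Metric

lemma zetaLogDer_ofReal_nonneg {σ : ℝ} (hσ : 1 < σ) : 0 ≤ zetaLogDer σ := by
  refine (hasSum_zetaLogDer (s := σ) (by simpa)).nonneg fun n => ?_
  have : ((n:ℂ) ^ (-(σ:ℂ))) = (((n:ℝ) ^ (-σ) : ℝ) : ℂ) := by
    rw [Complex.ofReal_cpow (Nat.cast_nonneg _)]; push_cast; rfl
  rw [this, ← ofReal_mul, ofReal_re]
  exact mul_nonneg ArithmeticFunction.vonMangoldt_nonneg (by positivity)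

lemma xiMult_div_norm_add_le (a : {a : ℂ // xiFun a = 0}) {W : ℝ} (hW : 0 ≤ W) :
    xiMult a / (‖(a:ℂ)‖ + W) ≤ 1.012 * ((xiMult a : ℂ) / (W - a)).re := by
  have h1 := one_le_xiMult a
  have h2 := norm_xiZero_le a
  have h3 := neg_xiZero_re_pos a
  have h4 : 0 < ‖(a:ℂ)‖ := norm_pos_iff.2 (xiZero_ne_zero a)
  have hre : ((W:ℂ) - a).re = W + -(a:ℂ).re := by simp [sub_eq_add_neg]
  have h5 : ‖(W:ℂ) - a‖ ≤ ‖(a:ℂ)‖ + W := by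
    refine (norm_sub_le _ _).trans_eq ?_
    rw [Complex.norm_real, Real.norm_of_nonneg hW, add_comm]
  have h6 : 0 < ‖(W:ℂ) - a‖ := by
    refine lt_of_lt_of_le ?_ (Complex.re_le_norm _)
    rw [hre]; linarith
  have e : ((xiMult a : ℂ) / (W - a)).re = xiMult a * (W + -(a:ℂ).re) / ‖(W:ℂ) - a‖ ^ 2 := by
    rw [div_eq_mul_inv, re_ofReal_mul, Complex.inv_re, Complex.normSq_eq_norm_sq, hre]
    ring
  rw [e, ← mul_div_assoc, div_le_div_iff₀ (by positivity) (by positivity)]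
  have h7 : ‖(W:ℂ) - a‖ ^ 2 ≤ (‖(a:ℂ)‖ + W) ^ 2 := by gcongr
  have h8 : ‖(a:ℂ)‖ + W ≤ 1.012 * (W + -(a:ℂ).re) := by norm_num at h2 ⊢; linarith
  calc xiMult a * ‖(W:ℂ) - a‖ ^ 2 ≤ xiMult a * ((‖(a:ℂ)‖ + W) * (‖(a:ℂ)‖ + W)) := by
        rw [← sq]; gcongr
    _ ≤ xiMult a * ((1.012 * (W + -(a:ℂ).re)) * (‖(a:ℂ)‖ + W)) := by gcongr
    _ = _ := by ring

lemma sum_xiMult_div_norm_add_le (S : Finset {a : ℂ // xiFun a = 0}) {s : ℝ} (hs : 1 < s) :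
    ∑ a ∈ S, xiMult a / (‖(a:ℂ)‖ + s * (s - 1)) ≤
      1.012 * ((1 / (s - 1) + Real.log (s / 2 + 1) / 2 - Real.log Real.pi / 2) / (2 * s - 1)) := by
  have hW : 0 ≤ s * (s - 1) := by nlinarith
  have hv : xiFun ((s * (s - 1) : ℝ) : ℂ) ≠ 0 := by
    push_cast
    exact xiFun_ne_zero_of_one_le_re (by simpa using hs.le)
  have h := Complex.hasSum_re (hasSum_logDeriv_xiFun hv)
  have hn : ∀ a, 0 ≤ ((xiMult a : ℂ) / (((s * (s - 1) : ℝ) : ℂ) - a)).re := fun a => by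
    have h1 := xiMult_div_norm_add_le a hW
    have h2 : 0 ≤ xiMult a / (‖(a:ℂ)‖ + s * (s - 1)) :=
      div_nonneg (zero_le_one.trans (one_le_xiMult a)) (by positivity)
    norm_num at h1 h2 ⊢
    linarith
  calc _ ≤ ∑ a ∈ S, 1.012 * ((xiMult a : ℂ) / (((s * (s - 1) : ℝ) : ℂ) - a)).re :=
        Finset.sum_le_sum fun a _ => xiMult_div_norm_add_le a hW
    _ ≤ 1.012 * (logDeriv xiFun ((s * (s - 1) : ℝ) : ℂ)).re := by
        rw [← Finset.mul_sum]
        gcongr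
        exact sum_le_hasSum S (fun a _ => hn a) h
    _ ≤ _ := by
        gcongr
        rw [le_div_iff₀ (by linarith)]
        have hc := congrArg Complex.re (logDeriv_xiFun_comp (s := s) (by simpa))
        have e1 : (2 * (s:ℂ) - 1) = ((2 * s - 1 : ℝ) : ℂ) := by push_cast; ring
        have e2 : (1 / ((s:ℂ) - 1)) = ((1 / (s - 1) : ℝ) : ℂ) := by push_cast; rfl
        have e3 : deriv riemannZeta s / riemannZeta s = -(-deriv riemannZeta s / riemannZeta s) := by ring
        have e4 : (s:ℂ) / 2 + 1 = ((s / 2 + 1 : ℝ) : ℂ) := by push_cast; ring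
        have e5 : ((Real.log Real.pi : ℂ) / 2) = ((Real.log Real.pi / 2 : ℝ) : ℂ) := by push_cast; rfl
        have e6 : ((s:ℂ) * ((s:ℂ) - 1)) = ((s * (s - 1) : ℝ) : ℂ) := by push_cast; ring
        rw [e1, e2, e3, e4, e5, e6, re_ofReal_mul] at hc
        simp only [add_re, sub_re, neg_re, ofReal_re] at hc
        have e7 : (digamma ((s / 2 + 1 : ℝ) : ℂ) / 2).re = (digamma ((s / 2 + 1 : ℝ) : ℂ)).re / 2 := by
          simp
        have h1 := zetaLogDer_ofReal_nonneg hs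
        have h2 := digamma_re_le_log (x := s / 2 + 1) (by linarith)
        rw [zetaLogDer] at h1
        rw [e7] at hc
        linarith

/-- The sample points at which the sum over zeros is evaluated. -/
noncomputable def samplePoint (j : ℕ) : ℝ := 20 * 2 ^ j * (20 * 2 ^ j - 1)

lemma samplePoint_ge (j : ℕ) : 380 * 2 ^ j ≤ samplePoint j := by
  have : (1:ℝ) ≤ 2 ^ j := one_le_pow₀ (by norm_num)
  unfold samplePoint
  nlinarith

lemma sum_samplePoint_le (S : Finset {a : ℂ // xiFun a = 0}) (j : ℕ) :
    ∑ a ∈ S, xiMult a / (‖(a:ℂ)‖ + samplePoint (j + 1)) ≤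
      1.012 * ((0.347 * (j + 1) + 0.63) / 2 ^ (j + 1) / 39.5) := by
  have hp : (1:ℝ) ≤ 2 ^ j := one_le_pow₀ (by norm_num)
  refine (sum_xiMult_div_norm_add_le S (s := 20 * 2 ^ (j + 1)) (by rw [pow_succ]; linarith)).trans ?_
  refine mul_le_mul_of_nonneg_left ?_ (by norm_num)
  rw [div_div]
  have hlog : Real.log (20 * 2 ^ (j + 1) / 2 + 1) ≤ (j + 1) * Real.log 2 + 2.3526 := by
    have h1 : Real.log (20 * 2 ^ (j + 1) / 2 + 1) ≤ Real.log (2 ^ (j + 1) * (2 * 5 * 1.05)) :=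
      Real.log_le_log (by positivity) (by rw [pow_succ]; linarith)
    rw [Real.log_mul (by positivity) (by norm_num), Real.log_mul (by norm_num) (by norm_num),
      Real.log_mul (by norm_num) (by norm_num), Real.log_pow] at h1
    have h2 := Real.log_le_sub_one_of_pos (x := 1.05) (by norm_num)
    have h3 := Real.log_two_lt_d9
    have h4 := Real.log_five_lt_d9
    push_cast at h1
    norm_num at h2 h3 h4 ⊢
    linarith
  have hpi : 1.1447 ≤ Real.log Real.pi := by
    have h1 := log_four_mul_pi_gt
    rw [Real.log_mul (by norm_num) Real.pi_ne_zero, show (4:ℝ) = 2 ^ 2 by norm_num, Real.log_pow] at h1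
    have h3 := Real.log_two_lt_d9
    push_cast at h1
    norm_num at h1 h3 ⊢
    linarith
  have h5 : 1 / (20 * 2 ^ (j + 1) - 1 : ℝ) ≤ 1 / 39 := by
    apply one_div_le_one_div_of_le (by norm_num)
    rw [pow_succ]; linarith
  have h6 : (j + 1) * Real.log 2 ≤ (j + 1) * 0.694 := by
    gcongr
    exact Real.log_two_lt_d9.le.trans (by norm_num)
  apply div_le_div₀
  · positivity
  · norm_num at hlog hpi h5 h6 ⊢
    linarith
  · positivity
  · rw [pow_succ]; linarith

lemma log_one_add_div_le {r W V c : ℝ} (hr : 0 ≤ r) (hW : 0 < W) (hV : 0 < V) (hc : V / W - 1 ≤ c) :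
    Real.log (1 + r / W) ≤ Real.log (1 + r / V) + c * (r / (r + V)) := by
  have h1 := Real.log_le_sub_one_of_pos (x := (1 + r / W) / (1 + r / V)) (by positivity)
  rw [Real.log_div (by positivity) (by positivity)] at h1
  have e : (1 + r / W) / (1 + r / V) - 1 = (V / W - 1) * (r / (r + V)) := by field_simp; ring
  rw [e] at h1
  have : (V / W - 1) * (r / (r + V)) ≤ c * (r / (r + V)) := by gcongr
  linarith

lemma samplePoint_ratio (j : ℕ) : samplePoint (j + 1) / samplePoint j - 1 ≤ 3.11 := by
  have hp : (1:ℝ) ≤ 2 ^ j := one_le_pow₀ (by norm_num)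
  have : 0 < samplePoint j := by linarith [samplePoint_ge j]
  rw [sub_le_iff_le_add, div_le_iff₀ this]
  unfold samplePoint
  rw [pow_succ]
  norm_num
  nlinarith

lemma sum_log_one_add_le (S : Finset {a : ℂ // xiFun a = 0}) (J : ℕ) :
    ∑ a ∈ S, xiMult a / ‖(a:ℂ)‖ * Real.log (1 + ‖(a:ℂ)‖ / samplePoint 0) ≤
      ∑ a ∈ S, xiMult a / ‖(a:ℂ)‖ * Real.log (1 + ‖(a:ℂ)‖ / samplePoint J) +
        3.11 * 1.012 / 39.5 * (1.324 - (0.347 * J + 1.324) / 2 ^ J) := by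
  induction J with
  | zero => norm_num
  | succ J ih =>
    have hpos : ∀ j, 0 < samplePoint j := fun j => by
      have : (1:ℝ) ≤ 2 ^ j := one_le_pow₀ (by norm_num)
      linarith [samplePoint_ge j]
    have h1 : ∑ a ∈ S, xiMult a / ‖(a:ℂ)‖ * Real.log (1 + ‖(a:ℂ)‖ / samplePoint J) ≤
        ∑ a ∈ S, xiMult a / ‖(a:ℂ)‖ * Real.log (1 + ‖(a:ℂ)‖ / samplePoint (J + 1)) +
        3.11 * ∑ a ∈ S, xiMult a / (‖(a:ℂ)‖ + samplePoint (J + 1)) := by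
      rw [Finset.mul_sum, ← Finset.sum_add_distrib]
      refine Finset.sum_le_sum fun a _ => ?_
      have hr : 0 < ‖(a:ℂ)‖ := norm_pos_iff.2 (xiZero_ne_zero a)
      have := mul_le_mul_of_nonneg_left (log_one_add_div_le hr.le (hpos J) (hpos (J + 1))
        (samplePoint_ratio J)) (xiMult_div_norm_nonneg a)
      refine this.trans_eq ?_
      have := hpos (J + 1)
      rw [mul_add]
      field_simp
    have h2 := sum_samplePoint_le S J
    have h3 : (0.347 * ((J + 1 : ℕ) : ℝ) + 1.324) / 2 ^ (J + 1) = (0.347 * J + 1.324) / 2 ^ J -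
        (0.347 * (J + 1) + 0.63) / 2 ^ (J + 1) := by
      rw [pow_succ]; push_cast; field_simp; ring
    rw [h3]
    generalize ∑ a ∈ S, xiMult a / (‖(a:ℂ)‖ + samplePoint (J + 1)) = X at *
    generalize (0.347 * ((J:ℝ) + 1) + 0.63) / 2 ^ (J + 1) = Y at *
    generalize (0.347 * (J:ℝ) + 1.324) / 2 ^ J = Z at *
    norm_num at *
    linarith

lemma sum_log_one_add_le_const (S : Finset {a : ℂ // xiFun a = 0}) :
    ∑ a ∈ S, xiMult a / ‖(a:ℂ)‖ * Real.log (1 + ‖(a:ℂ)‖ / samplePoint 0) ≤ 0.1056 := by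
  have h0 : (∑ a ∈ S, xiMult a / ‖(a:ℂ)‖ * Real.log (1 + ‖(a:ℂ)‖ / samplePoint 0)) -
      3.11 * 1.012 / 39.5 * 1.324 ≤ 0 := by
    have ht : Tendsto (fun J : ℕ => (∑ a ∈ S, xiMult a) / 380 * (1 / 2) ^ J) atTop (𝓝 0) := by
      simpa using (tendsto_pow_atTop_nhds_zero_of_lt_one (r := (1 / 2 : ℝ)) (by norm_num)
        (by norm_num)).const_mul ((∑ a ∈ S, xiMult a) / 380)
    refine ge_of_tendsto' ht fun J => ?_
    have h1 := sum_log_one_add_le S J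
    have h2 : ∑ a ∈ S, xiMult a / ‖(a:ℂ)‖ * Real.log (1 + ‖(a:ℂ)‖ / samplePoint J) ≤
        (∑ a ∈ S, xiMult a) / 380 * (1 / 2) ^ J := by
      rw [Finset.sum_div, Finset.sum_mul]
      refine Finset.sum_le_sum fun a _ => ?_
      have hr : 0 < ‖(a:ℂ)‖ := norm_pos_iff.2 (xiZero_ne_zero a)
      have hs := samplePoint_ge J
      have hs0 : (0:ℝ) < 380 * 2 ^ J := by positivity
      have hs1 : 0 < samplePoint J := by linarith
      have hm := one_le_xiMult a
      calc _ ≤ xiMult a / ‖(a:ℂ)‖ * (‖(a:ℂ)‖ / (380 * 2 ^ J)) := by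
            refine mul_le_mul_of_nonneg_left ?_ (xiMult_div_norm_nonneg a)
            have h3 := Real.log_le_sub_one_of_pos (x := 1 + ‖(a:ℂ)‖ / samplePoint J) (by positivity)
            have h4 : ‖(a:ℂ)‖ / samplePoint J ≤ ‖(a:ℂ)‖ / (380 * 2 ^ J) := by gcongr
            linarith
        _ = _ := by rw [one_div, inv_pow]; field_simp
    have h3 : 0 ≤ (0.347 * (J:ℝ) + 1.324) / 2 ^ J := by positivity
    norm_num at h1 h2 h3 ⊢
    linarith
  norm_num at h0 ⊢
  linarith

lemma log_im_div_three_le (a : {a : ℂ // xiFun a = 0}) : Real.log ((xiRoot a).im / 3) ≤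
    1 / 2 * (3.7853 + Real.log (1 + ‖(a:ℂ)‖ / samplePoint 0)) := by
  have h1 := xiZero_re a
  have h2 := Complex.abs_re_le_norm (a:ℂ)
  have h3 := neg_le_abs (a:ℂ).re
  have hi : 0 < (xiRoot a).im := by have := xiRoot_im_gt a; norm_num at this; linarith
  have hb : 0 ≤ (xiRoot a).re * (1 - (xiRoot a).re) :=
    mul_nonneg (xiRoot_re_pos a).le (sub_nonneg.2 (xiRoot_re_lt_one a).le)
  have hs : samplePoint 0 = 380 := by norm_num [samplePoint]
  have h4 : Real.log (((xiRoot a).im / 3) ^ 2) ≤ Real.log (2 ^ 5 * 1.3195 * (1 + ‖(a:ℂ)‖ / samplePoint 0)) := by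
    apply Real.log_le_log (by positivity)
    rw [hs]
    have : 0 ≤ ‖(a:ℂ)‖ := norm_nonneg _
    norm_num
    linarith
  have hr : 0 ≤ ‖(a:ℂ)‖ / samplePoint 0 := by rw [hs]; positivity
  rw [Real.log_mul (by norm_num) (by linarith), Real.log_mul (by norm_num) (by norm_num), Real.log_pow,
    Real.log_pow] at h4
  have h5 := Real.log_two_lt_d9
  have h6 := Real.log_le_sub_one_of_pos (x := 1.3195) (by norm_num)
  push_cast at h4
  generalize Real.log ((xiRoot a).im / 3) = X at *
  generalize Real.log (1 + ‖(a:ℂ)‖ / samplePoint 0) = Y at *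
  norm_num at *
  linarith

lemma sum_log_im_le (S : Finset {a : ℂ // xiFun a = 0}) :
    ∑ a ∈ S, xiMult a / ‖(a:ℂ)‖ * Real.log ((xiRoot a).im / 3) ≤ 0.0972 := by
  have h1 := sum_log_one_add_le_const S
  have h2 := sum_xiMult_div_norm_le S
  have h3 : ∑ a ∈ S, xiMult a / ‖(a:ℂ)‖ * Real.log ((xiRoot a).im / 3) ≤
      1 / 2 * (3.7853 * ∑ a ∈ S, xiMult a / ‖(a:ℂ)‖ +
        ∑ a ∈ S, xiMult a / ‖(a:ℂ)‖ * Real.log (1 + ‖(a:ℂ)‖ / samplePoint 0)) := by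
    rw [Finset.mul_sum, ← Finset.sum_add_distrib, Finset.mul_sum]
    refine Finset.sum_le_sum fun a _ => ?_
    refine (mul_le_mul_of_nonneg_left (log_im_div_three_le a) (xiMult_div_norm_nonneg a)).trans_eq ?_
    ring
  generalize ∑ a ∈ S, xiMult a / ‖(a:ℂ)‖ = X at *
  norm_num at *
  linarith

lemma exp_pair_le {β u c : ℝ} (hu : 0 ≤ u) (h1 : c ≤ β) (h2 : c ≤ 1 - β) :
    Real.exp (-(1 - β) * u) + Real.exp (-β * u) ≤ Real.exp (-c * u) + Real.exp (-u / 2) := by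
  rcases le_total β (1 / 2) with h | h
  · rw [add_comm]
    exact add_le_add (Real.exp_le_exp.2 (by nlinarith)) (Real.exp_le_exp.2 (by nlinarith))
  · exact add_le_add (Real.exp_le_exp.2 (by nlinarith)) (Real.exp_le_exp.2 (by nlinarith))

lemma log_two_mul_pi_le : Real.log (2 * Real.pi) ≤ 2 := by
  rw [Real.log_le_iff_le_exp (by positivity), show (2:ℝ) = 1 + 1 by norm_num, Real.exp_add]
  nlinarith [Real.exp_one_gt_d9, Real.pi_lt_d2]

/-- `|ψ₁-error| ≤ 0.0239` once `u ≥ 9.2`. -/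
theorem abs_psiOneErr_le_const {u : ℝ} (hu : 9.2 ≤ u) : |psiOneErr u| ≤ 0.0239 := by
  have hu0 : 0 < u := lt_of_lt_of_le (by norm_num) hu
  refine (abs_psiOneErr_le hu0).trans ?_
  have hS : (∑' a, xiMult a / ‖(a:ℂ)‖ * (Real.exp (-(1 - (xiRoot a).re) * u) +
      Real.exp (-(xiRoot a).re * u))) ≤ 0.0234 * (1 + Real.exp (-u / 2)) := by
    refine (summable_zero_bound hu0).tsum_le_of_sum_le fun S => ?_
    refine le_trans ?_ (mul_le_mul_of_nonneg_right (sum_xiMult_div_norm_le S) (by positivity))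
    rw [Finset.sum_mul]
    refine Finset.sum_le_sum fun a _ => mul_le_mul_of_nonneg_left ?_ (xiMult_div_norm_nonneg a)
    simpa using exp_pair_le (c := 0) hu0.le (xiRoot_re_pos a).le (sub_nonneg.2 (xiRoot_re_lt_one a).le)
  have he : Real.exp (-u / 2) ≤ 0.0101 := by
    have h1 : (1.105166:ℝ) ≤ Real.exp 0.1 := by
      refine le_trans ?_ (Real.sum_le_exp_of_nonneg (by norm_num) 4)
      norm_num [Finset.sum_range_succ, Nat.factorial]
    have h2 : (1.105166:ℝ) ^ 46 ≤ Real.exp 4.6 := by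
      rw [show (4.6:ℝ) = (46:ℕ) * 0.1 by norm_num, Real.exp_nat_mul]
      gcongr
    calc Real.exp (-u / 2) ≤ Real.exp (-4.6) := by gcongr; norm_num at hu ⊢; linarith
      _ = (Real.exp 4.6)⁻¹ := Real.exp_neg _
      _ ≤ (1.105166 ^ 46)⁻¹ := by gcongr
      _ ≤ _ := by norm_num
  have he2 : Real.exp (-u) = Real.exp (-u / 2) ^ 2 := by rw [← Real.exp_nat_mul]; ring_nf
  have hl := log_two_mul_pi_le
  rw [he2]
  have hp := Real.exp_pos (-u / 2)
  have h3 : Real.log (2 * Real.pi) * Real.exp (-u / 2) ^ 2 ≤ 2 * 0.0101 ^ 2 := by gcongr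
  generalize Real.exp (-u / 2) = E at *
  norm_num at *
  linarith

/-- `|ψ₁-error| ≤ 0.67 / u` once `u ≥ 20`. -/
theorem abs_psiOneErr_le_div {u : ℝ} (hu : 20 ≤ u) : |psiOneErr u| ≤ 0.67 / u := by
  have hu0 : 0 < u := lt_of_lt_of_le (by norm_num) hu
  rw [le_div_iff₀ hu0]
  have he : Real.exp (-u / 2) * u ≤ 0.048 := by
    have h1 : (u / 2) ^ 4 / (Nat.factorial 4 : ℝ) ≤ Real.exp (u / 2) := Real.pow_div_factorial_le_exp _ (by positivity) 4
    have h2 : Real.exp (-u / 2) * Real.exp (u / 2) = 1 := by rw [← Real.exp_add]; ring_nf; simp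
    have hp := Real.exp_pos (-u / 2)
    have h3 := mul_le_mul_of_nonneg_left h1 hp.le
    rw [h2] at h3
    norm_num [Nat.factorial] at h3
    have h4 : (20:ℝ) ^ 3 ≤ u ^ 3 := by gcongr
    have h5 : 0 ≤ Real.exp (-u / 2) * u * (u ^ 3 - 20 ^ 3) := mul_nonneg (by positivity) (by linarith)
    norm_num at h5 ⊢
    nlinarith
  have he' : Real.exp (-u / 2) ≤ 0.0024 := by
    have := Real.exp_pos (-u / 2)
    norm_num at *
    nlinarith
  have hS : (∑' a, xiMult a / ‖(a:ℂ)‖ * (Real.exp (-(1 - (xiRoot a).re) * u) +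
      Real.exp (-(xiRoot a).re * u))) ≤ (6.826 * 0.0972 + 0.0234 * 0.048) / u := by
    refine (summable_zero_bound hu0).tsum_le_of_sum_le fun S => ?_
    rw [le_div_iff₀ hu0, Finset.sum_mul]
    have hterm : ∀ a ∈ S, xiMult a / ‖(a:ℂ)‖ * (Real.exp (-(1 - (xiRoot a).re) * u) +
        Real.exp (-(xiRoot a).re * u)) * u ≤ 6.826 * (xiMult a / ‖(a:ℂ)‖ * Real.log ((xiRoot a).im / 3))
          + xiMult a / ‖(a:ℂ)‖ * 0.048 := by
      intro a _
      obtain ⟨z1, z2⟩ := xiRoot_zero_free a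
      have hl : 0 < Real.log ((xiRoot a).im / 3) := Real.log_pos (by
        have := xiRoot_im_gt a; norm_num at this; linarith)
      set l := Real.log ((xiRoot a).im / 3) with hldef
      have hp := exp_pair_le hu0.le z1 z2
      have hexp : Real.exp (-(0.0539 / l) * u) * u ≤ 6.826 * l := by
        have k1 := Real.add_one_le_exp (0.0539 / l * u - 1)
        have k2 : Real.exp (-(0.0539 / l) * u) * Real.exp (0.0539 / l * u - 1) = Real.exp (-1) := by
          rw [← Real.exp_add]; ring_nf
        have k3 := mul_le_mul_of_nonneg_left k1 (Real.exp_pos (-(0.0539 / l) * u)).le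
        rw [k2, sub_add_cancel] at k3
        have k4 : Real.exp (-1) ≤ 0.3679 := Real.exp_neg_one_lt_d9.le.trans (by norm_num)
        have k5 : Real.exp (-(0.0539 / l) * u) * (0.0539 / l * u) =
          Real.exp (-(0.0539 / l) * u) * u * 0.0539 / l := by ring
        rw [k5, div_le_iff₀ hl] at k3
        have k6 : Real.exp (-1) * l ≤ 0.3679 * l := by gcongr
        generalize Real.exp (-(0.0539 / l) * u) = E at *
        generalize Real.exp (-1) = E1 at *
        norm_num at *
        linarith
      have hw := xiMult_div_norm_nonneg a
      calc _ ≤ xiMult a / ‖(a:ℂ)‖ * (Real.exp (-(0.0539 / l) * u) + Real.exp (-u / 2)) * u := by gcongr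
        _ = xiMult a / ‖(a:ℂ)‖ * (Real.exp (-(0.0539 / l) * u) * u + Real.exp (-u / 2) * u) := by ring
        _ ≤ xiMult a / ‖(a:ℂ)‖ * (6.826 * l + 0.048) := by gcongr
        _ = _ := by ring
    refine (Finset.sum_le_sum hterm).trans ?_
    rw [Finset.sum_add_distrib, ← Finset.mul_sum, ← Finset.sum_mul]
    have := sum_log_im_le S
    have := sum_xiMult_div_norm_le S
    gcongr
  have h1 := abs_psiOneErr_le hu0
  have he2 : Real.exp (-u) = Real.exp (-u / 2) ^ 2 := by rw [← Real.exp_nat_mul]; ring_nf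
  have hl := log_two_mul_pi_le
  have hp := Real.exp_pos (-u / 2)
  have h3 : Real.log (2 * Real.pi) * Real.exp (-u) * u ≤ 2 * 0.0024 * 0.048 := by
    rw [he2, show Real.log (2 * Real.pi) * Real.exp (-u / 2) ^ 2 * u =
      Real.log (2 * Real.pi) * Real.exp (-u / 2) * (Real.exp (-u / 2) * u) by ring]
    gcongr
  rw [le_div_iff₀ hu0] at hS
  have h4 := mul_le_mul_of_nonneg_right h1 hu0.le
  rw [add_mul] at h4
  refine h4.trans ((add_le_add hS h3).trans (by norm_num))

end

section

open Complex Filter Topology Metric MeasureTheory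

lemma hasDerivAt_one_div {u : ℝ} (hu : u ≠ 0) : HasDerivAt (fun u : ℝ => 1 / u) (-1 / u ^ 2) u := by
  simpa [neg_div] using hasDerivAt_inv hu

lemma hasDerivAt_one_div_sq {u : ℝ} (hu : u ≠ 0) :
    HasDerivAt (fun u : ℝ => 1 / u ^ 2) (-2 / u ^ 3) u := by
  have := (hasDerivAt_pow 2 u).inv (pow_ne_zero 2 hu)
  refine HasDerivAt.congr_deriv (f := fun u : ℝ => 1 / u ^ 2) (f' := -(2 * u) / (u ^ 2) ^ 2) ?_ ?_
  · have e : (fun u : ℝ => 1 / u ^ 2) = (fun u : ℝ => u ^ 2)⁻¹ := by ext v; simp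
    rw [e]
    exact this.congr_deriv (by norm_num)
  · field_simp

/-- The difference of `e^{-t} / t - e^{-u} / u` and its multiple of `e^{-t} - e^{-u}` of matching
derivative, extended by `0` to `u < t`. -/
noncomputable def mertensKernel (t u : ℝ) : ℝ :=
  if t ≤ u then Real.exp (-t) / t - Real.exp (-u) / u
    - (Real.exp (-t) - Real.exp (-u)) * (1 / u + 1 / u ^ 2) else 0

lemma hasDerivAt_mertensKernel_aux {t u : ℝ} (hu : 0 < u) :
    HasDerivAt (fun u : ℝ => Real.exp (-t) / t - Real.exp (-u) / u
      - (Real.exp (-t) - Real.exp (-u)) * (1 / u + 1 / u ^ 2))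
      ((Real.exp (-t) - Real.exp (-u)) * (1 / u ^ 2 + 2 / u ^ 3)) u := by
  have h1 : HasDerivAt (fun u : ℝ => Real.exp (-u)) (-Real.exp (-u)) u := by
    simpa using (hasDerivAt_id u).neg.exp
  have h2 := hasDerivAt_one_div hu.ne'
  have h3 := hasDerivAt_one_div_sq hu.ne'
  have h4 := h1.div (hasDerivAt_id u) hu.ne'
  have h5 := ((h4.const_sub (Real.exp (-t) / t)).sub ((h1.const_sub (Real.exp (-t))).mul (h2.add h3)))
  refine h5.congr_deriv ?_
  simp only [id, Pi.add_apply]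
  field_simp
  ring

lemma hasDerivAt_mertensKernel {t u : ℝ} (ht : 0 < t) (hu : 0 < u) :
    HasDerivAt (mertensKernel t)
      (max 0 (Real.exp (-t) - Real.exp (-u)) * (1 / u ^ 2 + 2 / u ^ 3)) u := by
  rcases lt_trichotomy t u with h | rfl | h
  · rw [max_eq_right (by simpa using h.le)]
    refine (hasDerivAt_mertensKernel_aux hu).congr_of_eventuallyEq ?_
    filter_upwards [Ioi_mem_nhds h] with v hv
    rw [mertensKernel, if_pos (le_of_lt hv)]
  · have h := hasDerivAt_mertensKernel_aux (t := t) ht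
    simp only [sub_self, max_self, zero_mul] at h ⊢
    rw [hasDerivAt_iff_isLittleO] at h ⊢
    refine Asymptotics.IsBigO.trans_isLittleO (Asymptotics.isBigO_of_le _ fun v => ?_) h
    have : mertensKernel t t = 0 := by simp [mertensKernel]
    rw [this]
    simp only [sub_self, zero_mul, sub_zero, smul_zero, mertensKernel]
    split_ifs
    · rfl
    · simp
  · rw [max_eq_left (by simpa using h.le), zero_mul]
    refine (hasDerivAt_const u (0:ℝ)).congr_of_eventuallyEq ?_
    filter_upwards [Iio_mem_nhds h] with v hv
    rw [mertensKernel, if_neg (not_le.2 hv)]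

/-- `∑_{n ≤ e^u} Λ(n) (1 / (n log n) - e^{-u} / u)`. -/
noncomputable def mertensSum (u : ℝ) : ℝ :=
  ∑ n ∈ Finset.Ioc 0 ⌊Real.exp u⌋₊,
    ArithmeticFunction.vonMangoldt n * (1 / (n * Real.log n) - Real.exp (-u) / u)

lemma mertensSum_sub_eq {u : ℝ} {N : ℕ} (hN : ⌊Real.exp u⌋₊ ≤ N) :
    mertensSum u - psiOne u * (1 / u + 1 / u ^ 2) =
      ∑ n ∈ Finset.Ioc 0 N, ArithmeticFunction.vonMangoldt n * mertensKernel (Real.log n) u := by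
  rw [← Finset.sum_subset (Finset.Ioc_subset_Ioc_right hN), psiOne, mertensSum, Finset.sum_mul,
    ← Finset.sum_sub_distrib]
  · refine Finset.sum_congr rfl fun n hn => ?_
    rw [Finset.mem_Ioc] at hn
    have hn0 : (0:ℝ) < n := by exact_mod_cast hn.1
    have hle := (Nat.le_floor_iff (Real.exp_pos u).le).1 hn.2
    rw [mertensKernel, if_pos ((Real.log_le_iff_le_exp hn0).2 hle), Real.exp_neg (Real.log n),
      Real.exp_log hn0]
    field_simp
  · intro n hn hn'
    rw [Finset.mem_Ioc] at hn hn'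
    have hn0 : (0:ℝ) < n := by exact_mod_cast hn.1
    have : Real.exp u < n := (Nat.floor_lt (Real.exp_pos u).le).1 (by omega)
    rw [mertensKernel, if_neg, mul_zero]
    rw [not_le]
    exact (Real.lt_log_iff_exp_lt hn0).2 this

lemma hasDerivAt_mertensSum_sub {u : ℝ} (hu : 0 < u) :
    HasDerivAt (fun u => mertensSum u - psiOne u * (1 / u + 1 / u ^ 2))
      (psiOne u * (1 / u ^ 2 + 2 / u ^ 3)) u := by
  have hev : (fun v => mertensSum v - psiOne v * (1 / v + 1 / v ^ 2)) =ᶠ[𝓝 u] fun v =>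
      ∑ n ∈ Finset.Ioc 0 ⌊Real.exp (u + 1)⌋₊,
        ArithmeticFunction.vonMangoldt n * mertensKernel (Real.log n) v := by
    filter_upwards [Iio_mem_nhds (show u < u + 1 by linarith)] with v hv
    exact mertensSum_sub_eq (Nat.floor_le_floor (Real.exp_le_exp.2 (le_of_lt hv)))
  refine HasDerivAt.congr_of_eventuallyEq ?_ hev
  rw [psiOne_eq_sum_max (Nat.floor_le_floor (Real.exp_le_exp.2 (show u ≤ u + 1 by linarith))),
    Finset.sum_mul]
  refine HasDerivAt.fun_sum fun n hn => ?_
  rw [Finset.mem_Ioc] at hn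
  rcases (Nat.succ_le_of_lt hn.1).eq_or_lt with h | h
  · obtain rfl : n = 1 := by omega
    simpa using hasDerivAt_const u (0:ℝ)
  · have hn0 : (1:ℝ) < n := by exact_mod_cast (show 1 < n by omega)
    have := (hasDerivAt_mertensKernel (Real.log_pos hn0) hu).const_mul
      (ArithmeticFunction.vonMangoldt n)
    rw [Real.exp_neg (Real.log n), Real.exp_log (by linarith)] at this
    refine this.congr_deriv ?_
    rw [one_div (n:ℝ), mul_assoc]

lemma hasDerivAt_log_main {u : ℝ} (hu : 0 < u) (c : ℝ) :
    HasDerivAt (fun u : ℝ => Real.log u - 2 / u + c * (1 / u + 1 / u ^ 2))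
      ((u - c) * (1 / u ^ 2 + 2 / u ^ 3)) u := by
  have h2 := hasDerivAt_one_div hu.ne'
  have h2' : HasDerivAt (fun u : ℝ => 2 / u) (-2 / u ^ 2) u := by
    have := h2.const_mul 2
    simp only [mul_one_div] at this
    exact this.congr_deriv (by ring)
  have h3 := hasDerivAt_one_div_sq hu.ne'
  refine (((Real.hasDerivAt_log hu.ne').sub h2').add ((h2.add h3).const_mul c)).congr_deriv ?_
  field_simp
  ring

/-- A bound `δ` for `psiOneErr` gives Mertens' theorem with an explicit error term. -/
lemma exists_mertensSum_bound {a : ℝ} (ha : 0 < a) {e δ : ℝ → ℝ} (hδ : ∀ u, a ≤ u → |psiOneErr u| ≤ δ u)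
    (he : ∀ u, a ≤ u → HasDerivAt e (-(δ u * (1 / u ^ 2 + 2 / u ^ 3))) u)
    (he0 : ∀ u, a ≤ u → 0 ≤ e u) :
    ∃ C, ∀ u, a ≤ u → |mertensSum u - (Real.log u - 1 / u + C)| ≤ e u + δ u * (1 / u + 1 / u ^ 2) := by
  set c := Real.eulerMascheroniConstant + 1 with hc
  set H : ℝ → ℝ := fun u => mertensSum u - psiOne u * (1 / u + 1 / u ^ 2) with hH
  set M : ℝ → ℝ := fun u => Real.log u - 2 / u + c * (1 / u + 1 / u ^ 2) with hM
  have hd (u : ℝ) (hu : a ≤ u) : HasDerivAt (fun u => H u - M u)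
      (psiOneErr u * (1 / u ^ 2 + 2 / u ^ 3)) u := by
    refine ((hasDerivAt_mertensSum_sub (ha.trans_le hu)).sub
      (hasDerivAt_log_main (ha.trans_le hu) c)).congr_deriv ?_
    rw [psiOneErr, hc]; ring
  have hmono : MonotoneOn (fun u => H u - M u - e u) (Set.Ici a) := by
    refine monotoneOn_of_hasDerivWithinAt_nonneg (convex_Ici a)
      (fun u hu => ((hd u hu).sub (he u hu)).continuousAt.continuousWithinAt)
      (fun u hu => ((hd u (interior_subset hu)).sub (he u (interior_subset hu))).hasDerivWithinAt)
      fun u hu => ?_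
    have hu' := interior_subset hu
    have hu0 : 0 < u := ha.trans_le hu'
    rw [sub_neg_eq_add, ← add_mul]
    exact mul_nonneg (by linarith [neg_abs_le (psiOneErr u), hδ u hu']) (by positivity)
  have hanti : AntitoneOn (fun u => H u - M u + e u) (Set.Ici a) := by
    refine antitoneOn_of_hasDerivWithinAt_nonpos (convex_Ici a)
      (fun u hu => ((hd u hu).add (he u hu)).continuousAt.continuousWithinAt)
      (fun u hu => ((hd u (interior_subset hu)).add (he u (interior_subset hu))).hasDerivWithinAt)
      fun u hu => ?_
    have hu' := interior_subset hu
    have hu0 : 0 < u := ha.trans_le hu'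
    rw [← sub_eq_add_neg, ← sub_mul]
    exact mul_nonpos_of_nonpos_of_nonneg (by linarith [le_abs_self (psiOneErr u), hδ u hu'])
      (by positivity)
  set S := (fun u => H u - M u - e u) '' Set.Ici a with hS
  have hne : S.Nonempty := ⟨_, a, Set.self_mem_Ici, rfl⟩
  have hcross (u v : ℝ) (hu : a ≤ u) (hv : a ≤ v) : H u - M u - e u ≤ H v - M v + e v := by
    rcases le_total u v with h | h
    · have := hmono (Set.mem_Ici.2 hu) (Set.mem_Ici.2 hv) h
      simp only at this
      linarith [he0 v hv]
    · have := hanti (Set.mem_Ici.2 hv) (Set.mem_Ici.2 hu) h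
      simp only at this
      linarith [he0 u hu]
  have hbdd : BddAbove S := ⟨_, by rintro _ ⟨u, hu, rfl⟩; exact hcross u a hu le_rfl⟩
  refine ⟨sSup S + 1, fun u hu => ?_⟩
  have h1 : H u - M u - e u ≤ sSup S := le_csSup hbdd ⟨u, hu, rfl⟩
  have h2 : sSup S ≤ H u - M u + e u := csSup_le hne (by
    rintro _ ⟨v, hv, rfl⟩; exact hcross v u hv hu)
  have hu0 : 0 < u := ha.trans_le hu
  have key : mertensSum u - (Real.log u - 1 / u + (sSup S + 1)) =
      (H u - M u - sSup S) + psiOneErr u * (1 / u + 1 / u ^ 2) := by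
    simp only [hH, hM, psiOneErr, hc]
    field_simp
    ring
  rw [key]
  refine (abs_add_le _ _).trans (add_le_add ?_ ?_)
  · rw [abs_le]; constructor <;> linarith
  · rw [abs_mul, abs_of_pos (show 0 < 1 / u + 1 / u ^ 2 by positivity)]
    exact mul_le_mul_of_nonneg_right (hδ u hu) (by positivity)

end

section

open Complex Filter Topology Metric MeasureTheory

lemma hasLaplace_step {t ε : ℝ} (ht : 0 ≤ t) (hε : 0 < ε) :
    HasLaplace (fun u : ℝ => (((if t ≤ u then 1 else 0 : ℝ)) : ℂ)) ε
      ((Real.exp (-ε * t) / ε : ℝ) : ℂ) := by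
  have e : (fun u : ℝ => Complex.exp (-(ε:ℂ) * u) * (((if t ≤ u then 1 else 0 : ℝ)) : ℂ)) =
      (Set.Ici t).indicator fun u : ℝ => Complex.exp (-(ε:ℂ) * u) := by
    ext u
    by_cases hu : t ≤ u
    · rw [Set.indicator_of_mem (by exact hu), if_pos hu]; simp
    · rw [Set.indicator_of_notMem (by exact hu), if_neg hu]; simp
  have hae : (Set.Ici t).indicator (fun u : ℝ => Complex.exp (-(ε:ℂ) * u)) =ᵐ[volume.restrict (Set.Ioi 0)]
      (Set.Ioi t).indicator fun u : ℝ => Complex.exp (-(ε:ℂ) * u) :=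
    indicator_ae_eq_of_ae_eq_set (ae_restrict_of_ae Ioi_ae_eq_Ici.symm)
  have hsub : Set.Ioi (0:ℝ) ∩ Set.Ioi t = Set.Ioi t := by
    rw [Set.inter_eq_right]; exact Set.Ioi_subset_Ioi ht
  have hre : (-(ε:ℂ)).re < 0 := by simpa
  have i1 := integrableOn_exp_mul_complex_Ioi hre t
  rw [HasLaplace, e]
  constructor
  · rw [IntegrableOn, integrable_congr hae, integrable_indicator_iff measurableSet_Ioi, IntegrableOn,
      Measure.restrict_restrict measurableSet_Ioi, Set.inter_comm, hsub]
    exact i1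
  · rw [integral_congr_ae hae, setIntegral_indicator measurableSet_Ioi, hsub,
      integral_exp_mul_complex_Ioi hre]
    push_cast
    rw [neg_div_neg_eq]

lemma hasLaplace_stepSum {a t : ℕ → ℝ} (ha : ∀ n, 0 ≤ a n) (ht : ∀ n, 0 ≤ t n) {ε S : ℝ}
    (hε : 0 < ε) (hS : HasSum (fun n => a n * Real.exp (-ε * t n)) S) {F : ℝ → ℝ}
    (hF : ∀ u, 0 < u → HasSum (fun n => a n * if t n ≤ u then 1 else 0) (F u)) :
    HasLaplace (fun u => (F u : ℂ)) ε ((S / ε : ℝ) : ℂ) := by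
  have hT (n : ℕ) : HasLaplace (fun u : ℝ => ((a n * if t n ≤ u then 1 else 0 : ℝ) : ℂ)) ε
      ((a n * Real.exp (-ε * t n) / ε : ℝ) : ℂ) := by
    have := (hasLaplace_step (ht n) hε).const_mul (a n : ℂ)
    rw [mul_div_assoc]
    simpa only [ofReal_mul] using this
  have hK := hS.div_const ε
  refine HasLaplace.tsum hT ?_ (fun u hu => Complex.hasSum_ofReal.2 (hF u hu))
    (Complex.hasSum_ofReal.2 hK)
  refine hK.summable.congr fun n => ?_
  have : ∀ u : ℝ, ((‖Complex.exp (-(ε:ℂ) * u) * ((a n * if t n ≤ u then 1 else 0 : ℝ) : ℂ)‖ : ℝ) : ℂ)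
      = Complex.exp (-(ε:ℂ) * u) * ((a n * if t n ≤ u then 1 else 0 : ℝ) : ℂ) := by
    intro u
    rw [norm_mul, Complex.norm_exp, Complex.norm_real, Real.norm_of_nonneg
      (mul_nonneg (ha n) (by split_ifs <;> norm_num))]
    push_cast
    simp
  have h2 := (hT n).2
  rw [integral_congr_ae (Eventually.of_forall fun u => (this u).symm), integral_complex_ofReal] at h2
  exact (Complex.ofReal_injective h2).symm

/-- Abelian final value theorem for the Laplace transform. -/
lemma tendsto_mul_laplace {F : ℝ → ℝ} {L : ℝ → ℝ} {l : ℝ}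
    (hL : ∀ ε : ℝ, 0 < ε → HasLaplace (fun u => (F u : ℂ)) ε (L ε : ℂ))
    (hlim : Tendsto F atTop (𝓝 l)) (hb : ∀ T, ∃ B, ∀ u, 0 < u → u ≤ T → |F u| ≤ B) :
    Tendsto (fun ε => ε * L ε) (𝓝[>] 0) (𝓝 l) := by
  rw [Metric.tendsto_nhds]
  intro η hη
  rw [Metric.tendsto_atTop] at hlim
  obtain ⟨T, hT⟩ := hlim (η / 2) (by linarith)
  obtain ⟨B, hB⟩ := hb T
  have hbd (u : ℝ) (hu : 0 < u) :
      |F u - l| ≤ η / 2 + (|B| + |l|) * Real.exp T * Real.exp (-u) := by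
    rcases le_total T u with h | h
    · have := (hT u h).le
      rw [Real.dist_eq] at this
      have : 0 ≤ (|B| + |l|) * Real.exp T * Real.exp (-u) := by positivity
      linarith
    · have h1 := (hB u hu h).trans (le_abs_self B)
      have h2 : 1 ≤ Real.exp T * Real.exp (-u) := by
        rw [← Real.exp_add]; exact Real.one_le_exp (by linarith)
      have h3 : |F u - l| ≤ |F u| + |l| := abs_sub _ _
      have h4 : (|B| + |l|) * 1 ≤ (|B| + |l|) * (Real.exp T * Real.exp (-u)) := by gcongr
      rw [mul_assoc]
      linarith
  set K := (|B| + |l|) * Real.exp T with hK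
  have hK0 : 0 ≤ K := by positivity
  have main (ε : ℝ) (hε : 0 < ε) : |ε * L ε - l| ≤ η / 2 + K * ε := by
    have hre : 0 < (ε:ℂ).re := by simpa
    have h1 : HasLaplace (fun u => ((F u - l : ℝ) : ℂ)) ε ((L ε - l / ε : ℝ) : ℂ) := by
      have := (hL ε hε).sub ((hasLaplace_one hre).const_mul (l:ℂ))
      push_cast
      simpa only [mul_one_div, mul_one] using this
    have h2 : HasLaplace (fun u => ((η / 2 + K * Real.exp (-u) : ℝ) : ℂ)) ε
        ((η / 2 / ε + K / (ε + 1) : ℝ) : ℂ) := by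
      have := ((hasLaplace_one hre).const_mul ((η / 2 : ℝ):ℂ)).add
        ((hasLaplace_exp (w := 1) (s := (ε:ℂ)) (by simp; linarith)).const_mul (K:ℂ))
      push_cast at this ⊢
      simpa only [mul_one_div, mul_one, neg_mul, one_mul] using this
    have h3 : |L ε - l / ε| ≤ η / 2 / ε + K / (ε + 1) := by
      rw [← Real.norm_eq_abs, ← Complex.norm_real, ← h1.2]
      have h4 : ∫ u in Set.Ioi (0:ℝ), Real.exp (-ε * u) * (η / 2 + K * Real.exp (-u)) =
          η / 2 / ε + K / (ε + 1) := by
        have := h2.2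
        have e : ∀ u : ℝ, Complex.exp (-(ε:ℂ) * u) * ((η / 2 + K * Real.exp (-u) : ℝ) : ℂ) =
          ((Real.exp (-ε * u) * (η / 2 + K * Real.exp (-u)) : ℝ) : ℂ) := by
          intro u; push_cast; rfl
        simp_rw [e] at this
        rw [integral_complex_ofReal] at this
        exact Complex.ofReal_injective this
      rw [← h4]
      refine norm_integral_le_of_norm_le ?_ ?_
      · have := h2.1.re
        refine this.congr (Eventually.of_forall fun u => ?_)
        have e : Complex.exp (-(ε:ℂ) * u) * ((η / 2 + K * Real.exp (-u) : ℝ) : ℂ) =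
          ((Real.exp (-ε * u) * (η / 2 + K * Real.exp (-u)) : ℝ) : ℂ) := by
          push_cast; rfl
        simp only [e]
        exact Complex.ofReal_re _
      · rw [ae_restrict_iff' measurableSet_Ioi]
        refine Eventually.of_forall fun u hu => ?_
        rw [norm_mul, Complex.norm_exp, Complex.norm_real, Real.norm_eq_abs]
        have : (-(ε:ℂ) * u).re = -ε * u := by simp
        rw [this]
        exact mul_le_mul_of_nonneg_left (hbd u hu) (Real.exp_pos _).le
    have h5 : ε * L ε - l = ε * (L ε - l / ε) := by field_simp
    rw [h5, abs_mul, abs_of_pos hε]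
    calc ε * |L ε - l / ε| ≤ ε * (η / 2 / ε + K / (ε + 1)) := by gcongr
      _ = η / 2 + K * ε / (ε + 1) := by field_simp
      _ ≤ η / 2 + K * ε := by
        gcongr
        exact div_le_self (by positivity) (by linarith)
  have hlt : ∀ᶠ ε in 𝓝[>] (0:ℝ), K * ε < η / 2 := by
    have : Tendsto (fun ε : ℝ => K * ε) (𝓝[>] 0) (𝓝 (K * 0)) :=
      (continuous_const.mul continuous_id).continuousAt.tendsto.mono_left nhdsWithin_le_nhds
    rw [mul_zero] at this
    exact this.eventually_lt_const (by linarith)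
  filter_upwards [hlt, self_mem_nhdsWithin] with ε h1 h2
  rw [Real.dist_eq]
  linarith [main ε h2]

end

section

open Complex Filter Topology Metric MeasureTheory

/-- `∑_{n ≤ e^u} Λ(n) / (n log n)`. -/
noncomputable def mangoldtLogSum (u : ℝ) : ℝ :=
  ∑ n ∈ Finset.Ioc 0 ⌊Real.exp u⌋₊, ArithmeticFunction.vonMangoldt n / (n * Real.log n)

lemma mangoldt_div_nonneg (n : ℕ) : 0 ≤ ArithmeticFunction.vonMangoldt n / (n * Real.log n) :=
  div_nonneg ArithmeticFunction.vonMangoldt_nonneg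
    (mul_nonneg n.cast_nonneg (Real.log_natCast_nonneg n))

lemma hasSum_mangoldtLogSum (u : ℝ) :
    HasSum (fun n : ℕ => ArithmeticFunction.vonMangoldt n / (n * Real.log n) *
      if Real.log n ≤ u then 1 else 0) (mangoldtLogSum u) := by
  have : mangoldtLogSum u = ∑ n ∈ Finset.Ioc 0 ⌊Real.exp u⌋₊,
      ArithmeticFunction.vonMangoldt n / (n * Real.log n) * if Real.log n ≤ u then 1 else 0 := by
    refine Finset.sum_congr rfl fun n hn => ?_
    rw [Finset.mem_Ioc, Nat.le_floor_iff (Real.exp_pos u).le] at hn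
    have hn0 : (0:ℝ) < n := by exact_mod_cast hn.1
    rw [if_pos ((Real.log_le_iff_le_exp hn0).2 hn.2), mul_one]
  rw [this]
  refine hasSum_sum_of_ne_finset_zero fun n hn => ?_
  rcases Nat.eq_zero_or_pos n with rfl | h
  · simp
  rw [Finset.mem_Ioc, not_and, Nat.le_floor_iff (Real.exp_pos u).le] at hn
  have hn0 : (0:ℝ) < n := by exact_mod_cast h
  rw [if_neg fun h' => hn h ((Real.log_le_iff_le_exp hn0).1 h'), mul_zero]

lemma hasSum_log_riemannZeta {ε : ℝ} (hε : 0 < ε) :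
    HasSum (fun n : ℕ => ArithmeticFunction.vonMangoldt n / (n * Real.log n) *
      Real.exp (-ε * Real.log n)) (Real.log (riemannZeta ((1 + ε : ℝ) : ℂ)).re) := by
  have hs : 1 < 1 + ε := by linarith
  have e (n : ℕ) : ArithmeticFunction.vonMangoldt n / (n * Real.log n) * Real.exp (-ε * Real.log n)
      = ArithmeticFunction.vonMangoldt n / ((n:ℝ) ^ (1 + ε) * Real.log n) := by
    rcases Nat.eq_zero_or_pos n with rfl | h
    · simp
    have hn0 : (0:ℝ) < n := by exact_mod_cast h
    rw [Real.rpow_add hn0, Real.rpow_one, neg_mul, Real.exp_neg, mul_comm ε,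
      ← Real.rpow_def_of_pos hn0]
    have := Real.rpow_pos_of_pos hn0 ε
    field_simp
  simp_rw [e]
  rw [log_riemannZeta_eq hs]
  refine Summable.hasSum ?_
  have h1 := (ArithmeticFunction.LSeriesSummable_vonMangoldt
    (s := ((1 + ε : ℝ) : ℂ)) (by simpa)).norm.mul_right (1 / Real.log 2)
  refine Summable.of_nonneg_of_le (fun n => div_nonneg ArithmeticFunction.vonMangoldt_nonneg
    (mul_nonneg (by positivity) (Real.log_natCast_nonneg n))) (fun n => ?_) h1
  have hl2 : 0 < Real.log 2 := Real.log_pos (by norm_num)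
  rcases lt_or_ge n 2 with h | h
  · have : Real.log n = 0 := by interval_cases n <;> simp
    rw [this, mul_zero, div_zero]
    positivity
  · have hn0 : (0:ℝ) < n := by exact_mod_cast (show 0 < n by omega)
    rw [LSeries.norm_term_eq, if_neg (by omega), Complex.ofReal_re, Complex.norm_real,
      Real.norm_of_nonneg ArithmeticFunction.vonMangoldt_nonneg, div_mul_eq_div_div _ _ (Real.log n),
      div_eq_mul_one_div _ (Real.log n)]
    have := Real.rpow_pos_of_pos hn0 (1 + ε)
    have hm : 0 ≤ ArithmeticFunction.vonMangoldt n := ArithmeticFunction.vonMangoldt_nonneg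
    refine mul_le_mul_of_nonneg_left ?_ (by positivity)
    refine one_div_le_one_div_of_le hl2 (Real.log_le_log (by norm_num) (by exact_mod_cast h))

lemma hasSum_harmonic_step (u : ℝ) :
    HasSum (fun n : ℕ => 1 / ((n:ℝ) + 1) * if (n:ℝ) + 1 ≤ u then 1 else 0)
      ((harmonic ⌊u⌋₊ : ℚ) : ℝ) := by
  have hiff (n : ℕ) : n < ⌊u⌋₊ ↔ (n:ℝ) + 1 ≤ u := by
    rw [← Nat.succ_le_iff, Nat.le_floor_iff' (Nat.succ_ne_zero n)]; push_cast; rfl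
  have : ((harmonic ⌊u⌋₊ : ℚ) : ℝ) = ∑ n ∈ Finset.range ⌊u⌋₊,
      1 / ((n:ℝ) + 1) * if (n:ℝ) + 1 ≤ u then 1 else 0 := by
    rw [harmonic]
    push_cast
    refine Finset.sum_congr rfl fun n hn => ?_
    rw [if_pos ((hiff n).1 (Finset.mem_range.1 hn)), mul_one, one_div]
  rw [this]
  refine hasSum_sum_of_ne_finset_zero fun n hn => ?_
  rw [if_neg fun h => hn (Finset.mem_range.2 ((hiff n).2 h)), mul_zero]

lemma hasSum_harmonic_exp {ε : ℝ} (hε : 0 < ε) :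
    HasSum (fun n : ℕ => 1 / ((n:ℝ) + 1) * Real.exp (-ε * ((n:ℝ) + 1)))
      (-Real.log (1 - Real.exp (-ε))) := by
  have := Real.hasSum_pow_div_log_of_abs_lt_one (x := Real.exp (-ε))
    (by rw [abs_of_pos (Real.exp_pos _)]; exact Real.exp_lt_one_iff.2 (by linarith))
  refine this.congr_fun fun n => ?_
  rw [← Real.exp_nat_mul, one_div, div_eq_inv_mul]
  push_cast
  ring_nf

lemma tendsto_log_zeta_add_log_one_sub_exp :
    Tendsto (fun ε : ℝ => Real.log (riemannZeta ((1 + ε : ℝ) : ℂ)).re -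
      -Real.log (1 - Real.exp (-ε))) (𝓝[>] 0) (𝓝 0) := by
  have h1 := (Asymptotics.isLittleO_one_iff ℝ).1 log_riemannZeta_add_log_sub_isLittleO_ofReal
  have hshift : Tendsto (fun ε : ℝ => 1 + ε) (𝓝[>] 0) (𝓝[>] 1) := by
    refine tendsto_nhdsWithin_iff.2 ⟨?_, ?_⟩
    · have : Tendsto (fun ε : ℝ => 1 + ε) (𝓝 0) (𝓝 (1 + 0)) :=
        (continuous_const.add continuous_id).tendsto 0
      rw [add_zero] at this
      exact this.mono_left nhdsWithin_le_nhds
    · filter_upwards [self_mem_nhdsWithin] with ε hε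
      simpa using hε
  have h2 := h1.comp hshift
  have h3 : Tendsto (fun ε : ℝ => (1 - Real.exp (-ε)) / ε) (𝓝[>] 0) (𝓝 1) := by
    have hd : HasDerivAt (fun ε : ℝ => 1 - Real.exp (-ε)) 1 0 := by
      have : HasDerivAt (fun u : ℝ => Real.exp (-u)) (-Real.exp (-0)) 0 := by
        simpa using (hasDerivAt_id (0:ℝ)).neg.exp
      simpa using this.const_sub 1
    have := (hasDerivAt_iff_tendsto_slope.1 hd).mono_left
      (nhdsWithin_mono 0 (fun x (hx : 0 < x) => hx.ne'))
    refine this.congr fun ε => ?_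
    simp [slope_def_field]
  have h4 := (Real.continuousAt_log one_ne_zero).tendsto.comp h3
  rw [Real.log_one] at h4
  have h5 := h2.add h4
  rw [add_zero] at h5
  refine h5.congr' ?_
  filter_upwards [self_mem_nhdsWithin] with ε hε
  have hε : 0 < ε := hε
  have hlt : Real.exp (-ε) < 1 := Real.exp_lt_one_iff.2 (by linarith)
  simp only [Function.comp]
  rw [Real.log_div (by linarith) hε.ne', add_sub_cancel_left]
  push_cast
  ring

lemma tendsto_harmonic_floor_sub_log :
    Tendsto (fun u : ℝ => ((harmonic ⌊u⌋₊ : ℚ) : ℝ) - Real.log u) atTop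
      (𝓝 Real.eulerMascheroniConstant) := by
  have h1 := Real.tendsto_harmonic_sub_log.comp (tendsto_nat_floor_atTop (α := ℝ))
  have h2 := (Real.continuousAt_log one_ne_zero).tendsto.comp (tendsto_nat_floor_div_atTop (R := ℝ))
  rw [Real.log_one] at h2
  have := h1.add h2
  rw [add_zero] at this
  refine this.congr' ?_
  filter_upwards [eventually_ge_atTop 1] with u hu
  have hf : (0:ℝ) < ⌊u⌋₊ := by exact_mod_cast Nat.floor_pos.2 hu
  simp only [Function.comp]
  rw [Real.log_div hf.ne' (by linarith)]
  ring

lemma eq_eulerMascheroniConstant_of_tendsto {C : ℝ}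
    (h : Tendsto (fun u => mangoldtLogSum u - Real.log u) atTop (𝓝 C)) :
    C = Real.eulerMascheroniConstant := by
  have hlim : Tendsto (fun u => mangoldtLogSum u - ((harmonic ⌊u⌋₊ : ℚ) : ℝ)) atTop
      (𝓝 (C - Real.eulerMascheroniConstant)) := by
    refine (h.sub tendsto_harmonic_floor_sub_log).congr fun u => ?_
    ring
  have hL (ε : ℝ) (hε : 0 < ε) : HasLaplace
      (fun u => ((mangoldtLogSum u - ((harmonic ⌊u⌋₊ : ℚ) : ℝ) : ℝ) : ℂ)) ε
      (((Real.log (riemannZeta ((1 + ε : ℝ) : ℂ)).re - -Real.log (1 - Real.exp (-ε))) / ε : ℝ) : ℂ) := by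
    have h1 := hasLaplace_stepSum mangoldt_div_nonneg (fun n => Real.log_natCast_nonneg n) hε
      (hasSum_log_riemannZeta hε) (F := mangoldtLogSum) fun u _ => hasSum_mangoldtLogSum u
    have h2 := hasLaplace_stepSum (a := fun n => 1 / ((n:ℝ) + 1)) (t := fun n => (n:ℝ) + 1)
      (fun n => by positivity) (fun n => by positivity) hε
      (hasSum_harmonic_exp hε) (F := fun u => ((harmonic ⌊u⌋₊ : ℚ) : ℝ))
      fun u _ => hasSum_harmonic_step u
    have h3 := h1.sub h2
    rw [sub_div]
    simpa only [ofReal_sub] using h3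
  have hb (T : ℝ) : ∃ B, ∀ u, 0 < u → u ≤ T →
      |mangoldtLogSum u - ((harmonic ⌊u⌋₊ : ℚ) : ℝ)| ≤ B := by
    refine ⟨mangoldtLogSum T + ((harmonic ⌊T⌋₊ : ℚ) : ℝ), fun u _ hu => ?_⟩
    have hA : mangoldtLogSum u ≤ mangoldtLogSum T :=
      Finset.sum_le_sum_of_subset_of_nonneg
        (Finset.Ioc_subset_Ioc_right (Nat.floor_le_floor (Real.exp_le_exp.2 hu)))
        fun n _ _ => mangoldt_div_nonneg n
    have hA0 : 0 ≤ mangoldtLogSum u := Finset.sum_nonneg fun n _ => mangoldt_div_nonneg n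
    have hh : harmonic ⌊u⌋₊ ≤ harmonic ⌊T⌋₊ :=
      Finset.sum_le_sum_of_subset_of_nonneg (Finset.range_mono (Nat.floor_le_floor hu))
        fun n _ _ => by positivity
    have hh0 : 0 ≤ harmonic ⌊u⌋₊ := Finset.sum_nonneg fun n _ => by positivity
    have hh' : ((harmonic ⌊u⌋₊ : ℚ) : ℝ) ≤ ((harmonic ⌊T⌋₊ : ℚ) : ℝ) := by exact_mod_cast hh
    have hh0' : (0:ℝ) ≤ ((harmonic ⌊u⌋₊ : ℚ) : ℝ) := by exact_mod_cast hh0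
    rw [abs_le]
    constructor <;> linarith
  have h1 := tendsto_mul_laplace hL hlim hb
  have h2 := tendsto_log_zeta_add_log_one_sub_exp
  have h3 := tendsto_nhds_unique (h1.congr' (f₂ := fun ε : ℝ => Real.log (riemannZeta ((1 + ε : ℝ) : ℂ)).re -
      -Real.log (1 - Real.exp (-ε))) (by
    filter_upwards [self_mem_nhdsWithin] with ε hε
    have hε : 0 < ε := hε
    field_simp)) h2
  linarith

lemma mangoldtLogSum_eq {u : ℝ} :
    mangoldtLogSum u = mertensSum u + Chebyshev.psi (Real.exp u) * (Real.exp (-u) / u) := by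
  rw [mangoldtLogSum, mertensSum, Chebyshev.psi, Finset.sum_mul, ← Finset.sum_add_distrib]
  refine Finset.sum_congr rfl fun n _ => ?_
  ring

lemma tendsto_mangoldtLogSum_sub_mertensSum :
    Tendsto (fun u => mangoldtLogSum u - mertensSum u) atTop (𝓝 0) := by
  have h0 : Tendsto (fun u : ℝ => (Real.log 4 + 4) / u) atTop (𝓝 0) :=
    tendsto_const_nhds.div_atTop tendsto_id
  refine squeeze_zero' ?_ ?_ h0
  · filter_upwards [eventually_gt_atTop 0] with u hu
    rw [mangoldtLogSum_eq, add_sub_cancel_left]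
    exact mul_nonneg (Chebyshev.psi_nonneg _) (by positivity)
  · filter_upwards [eventually_gt_atTop 0] with u hu
    rw [mangoldtLogSum_eq, add_sub_cancel_left]
    calc _ ≤ (Real.log 4 + 4) * Real.exp u * (Real.exp (-u) / u) :=
          mul_le_mul_of_nonneg_right (Chebyshev.psi_le_const_mul_self (Real.exp_pos u).le)
            (by positivity)
      _ = (Real.log 4 + 4) / u := by
        rw [Real.exp_neg]; field_simp

lemma mertensSum_bound_eulerMascheroni {a : ℝ} (ha : 0 < a) {e δ : ℝ → ℝ}
    (hδ : ∀ u, a ≤ u → |psiOneErr u| ≤ δ u)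
    (he : ∀ u, a ≤ u → HasDerivAt e (-(δ u * (1 / u ^ 2 + 2 / u ^ 3))) u)
    (he0 : ∀ u, a ≤ u → 0 ≤ e u)
    (hlim : Tendsto (fun u => e u + δ u * (1 / u + 1 / u ^ 2)) atTop (𝓝 0)) {u : ℝ} (hu : a ≤ u) :
    |mertensSum u - (Real.log u - 1 / u + Real.eulerMascheroniConstant)| ≤
      e u + δ u * (1 / u + 1 / u ^ 2) := by
  obtain ⟨C, hC⟩ := exists_mertensSum_bound ha hδ he he0
  have h1 : Tendsto (fun u => mertensSum u - (Real.log u - 1 / u + C)) atTop (𝓝 0) :=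
    squeeze_zero_norm' (by filter_upwards [eventually_ge_atTop a] with u hu using hC u hu) hlim
  have h2 : Tendsto (fun u : ℝ => 1 / u) atTop (𝓝 0) := tendsto_const_nhds.div_atTop tendsto_id
  have h3 := ((h1.add tendsto_mangoldtLogSum_sub_mertensSum).sub h2).add_const C
  rw [← eq_eulerMascheroniConstant_of_tendsto (C := C)]
  · exact hC u hu
  · simp only [add_zero, sub_zero, zero_add] at h3
    refine h3.congr fun u => ?_
    ring

lemma tendsto_const_div_pow_atTop (c : ℝ) {n : ℕ} (hn : n ≠ 0) :
    Tendsto (fun u : ℝ => c / u ^ n) atTop (𝓝 0) :=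
  tendsto_const_nhds.div_atTop (tendsto_pow_atTop hn)

theorem abs_mertensSum_sub_le_const {u : ℝ} (hu : 9.2 ≤ u) :
    |mertensSum u - (Real.log u - 1 / u + Real.eulerMascheroniConstant)| ≤
      0.0478 * (1 / u + 1 / u ^ 2) := by
  have := mertensSum_bound_eulerMascheroni (a := 9.2) (by norm_num) (δ := fun _ => 0.0239)
    (e := fun u => 0.0239 * (1 / u + 1 / u ^ 2)) (fun u hu => abs_psiOneErr_le_const hu)
    (fun u hu => ?_) (fun u hu => ?_) ?_ hu
  · refine this.trans_eq (by ring)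
  · have hu0 : u ≠ 0 := by rintro rfl; norm_num at hu
    refine (((hasDerivAt_one_div hu0).add (hasDerivAt_one_div_sq hu0)).const_mul 0.0239).congr_deriv ?_
    ring
  · have : 0 < u := by linarith
    positivity
  · have := (tendsto_const_div_pow_atTop 0.0478 one_ne_zero).add
      (tendsto_const_div_pow_atTop 0.0478 two_ne_zero)
    rw [add_zero] at this
    refine this.congr fun u => ?_
    ring

theorem abs_mertensSum_sub_le_div {u : ℝ} (hu : 20 ≤ u) :
    |mertensSum u - (Real.log u - 1 / u + Real.eulerMascheroniConstant)| ≤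
      0.67 * (3 / 2 / u ^ 2 + 5 / 3 / u ^ 3) := by
  have := mertensSum_bound_eulerMascheroni (a := 20) (by norm_num) (δ := fun u => 0.67 / u)
    (e := fun u => 0.67 * (1 / 2 * (1 / u ^ 2) + 2 / 3 * (1 / u ^ 3)))
    (fun u hu => abs_psiOneErr_le_div hu) (fun u hu => ?_) (fun u hu => ?_) ?_ hu
  · refine this.trans_eq ?_
    have hu0 : u ≠ 0 := by rintro rfl; norm_num at hu
    field_simp
    ring
  · have hu0 : u ≠ 0 := by rintro rfl; norm_num at hu
    have h3 : HasDerivAt (fun u : ℝ => 1 / u ^ 3) (-3 / u ^ 4) u := by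
      have := (hasDerivAt_one_div_sq hu0).mul (hasDerivAt_one_div hu0)
      refine (this.congr_of_eventuallyEq (Eventually.of_forall fun v => ?_)).congr_deriv ?_
      · simp only [Pi.mul_apply]; ring
      · field_simp; ring
    refine ((((hasDerivAt_one_div_sq hu0).const_mul (1 / 2)).add (h3.const_mul (2 / 3))).const_mul
      0.67).congr_deriv ?_
    field_simp
    ring
  · have : 0 < u := by linarith
    positivity
  · have := (tendsto_const_div_pow_atTop (0.67 * (3 / 2)) two_ne_zero).add
      (tendsto_const_div_pow_atTop (0.67 * (5 / 3)) three_ne_zero)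
    rw [add_zero] at this
    refine this.congr' ?_
    filter_upwards [eventually_gt_atTop 0] with u hu
    field_simp
    ring

end

section

open Complex Filter Topology Metric

lemma neg_log_one_sub_le {x : ℝ} (hx0 : 0 ≤ x) (hx1 : x < 1) (K : ℕ) :
    -Real.log (1 - x) ≤ ∑ i ∈ Finset.range K, x ^ (i + 1) / ((i:ℝ) + 1) +
      x ^ (K + 1) / (((K:ℝ) + 1) * (1 - x)) := by
  have h := Real.hasSum_pow_div_log_of_abs_lt_one (x := x) (by rwa [abs_of_nonneg hx0])
  have h1 := (hasSum_nat_add_iff' K).2 h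
  have h2 := (hasSum_geometric_of_lt_one hx0 hx1).mul_left (x ^ (K + 1) / ((K:ℝ) + 1))
  have := hasSum_le (fun i => ?_) h1 h2
  · rw [div_mul_eq_div_div, div_eq_mul_inv _ (1 - x)]
    linarith
  · have e : x ^ (K + 1) / ((K:ℝ) + 1) * x ^ i = x ^ (i + K + 1) / ((K:ℝ) + 1) := by ring
    rw [e]
    push_cast
    gcongr
    linarith [(i.cast_nonneg : (0:ℝ) ≤ i)]

lemma sum_prime_pow_le_mangoldtLogSum {u : ℝ} {N : ℕ} (hN : N = ⌊Real.exp u⌋₊) :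
    ∑ p ∈ Finset.Ioc 0 N with p.Prime, ∑ i ∈ Finset.range (Nat.log p N),
      (1 / (p:ℝ)) ^ (i + 1) / ((i:ℝ) + 1) ≤ mangoldtLogSum u := by
  classical
  rw [Finset.sum_sigma', mangoldtLogSum, ← hN]
  set f : ℕ → ℝ := fun n => ArithmeticFunction.vonMangoldt n / (n * Real.log n) with hf
  set S := ((Finset.Ioc 0 N).filter Nat.Prime).sigma fun p => Finset.range (Nat.log p N) with hS
  set j : (Σ _ : ℕ, ℕ) → ℕ := fun q => q.1 ^ (q.2 + 1) with hj
  have hSp : ∀ q ∈ S, q.1.Prime := fun q hq => by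
    rw [hS, Finset.mem_sigma, Finset.mem_filter] at hq; exact hq.1.2
  have h1 : ∀ q ∈ S, (1 / (q.1:ℝ)) ^ (q.2 + 1) / ((q.2:ℝ) + 1) = f (j q) := by
    intro q hq
    have hp := hSp q hq
    have hp1 : (1:ℝ) < q.1 := by exact_mod_cast hp.one_lt
    have hl := Real.log_pos hp1
    have hp0 : (0:ℝ) < q.1 ^ (q.2 + 1) := by positivity
    simp only [hf, hj]
    rw [ArithmeticFunction.vonMangoldt_apply_pow (Nat.succ_ne_zero _),
      ArithmeticFunction.vonMangoldt_apply_prime hp]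
    push_cast
    rw [Real.log_pow, one_div, inv_pow]
    push_cast
    field_simp
  have hinj : Set.InjOn j S := by
    rintro ⟨p, k⟩ hq ⟨p', k'⟩ hq' h
    obtain ⟨h1, h2⟩ := Nat.Prime.pow_inj' (hSp _ hq) (hSp _ hq') (Nat.succ_ne_zero k)
      (Nat.succ_ne_zero k') h
    simp only at h1 h2
    obtain rfl : k = k' := by omega
    subst h1
    rfl
  rw [Finset.sum_congr rfl h1, ← Finset.sum_image hinj]
  refine Finset.sum_le_sum_of_subset_of_nonneg ?_ fun n _ _ => mangoldt_div_nonneg n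
  intro n hn
  obtain ⟨q, hq, rfl⟩ := Finset.mem_image.1 hn
  have hp := hSp q hq
  rw [hS, Finset.mem_sigma, Finset.mem_filter, Finset.mem_Ioc, Finset.mem_range] at hq
  rw [Finset.mem_Ioc]
  exact ⟨pow_pos hp.pos _, Nat.pow_le_of_le_log (by omega) (by omega)⟩

lemma sum_Ioc_one_div_mul_pred (R N : ℕ) (hR : 0 < R) (h : R ≤ N) :
    ∑ m ∈ Finset.Ioc R N, 1 / ((m:ℝ) * (m - 1)) = 1 / R - 1 / N := by
  induction N, h using Nat.le_induction with
  | base => simp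
  | succ N hN ih =>
    have : (0:ℝ) < N := by exact_mod_cast (by omega : 0 < N)
    rw [Finset.sum_Ioc_succ_top (by omega), ih]
    push_cast
    rw [add_sub_cancel_right]
    field_simp
    ring

/-- Partial sums of `-log (1 - 1/p)` in terms of `mangoldtLogSum`. -/
lemma sum_neg_log_one_sub_le {u : ℝ} (hu : 2 ≤ u) :
    ∑ p ∈ Finset.Ioc 0 ⌊Real.exp u⌋₊ with p.Prime, -Real.log (1 - 1 / (p:ℝ)) ≤
      mangoldtLogSum u + 1 / (2 * (Real.exp (u / 2) - 1)) +
        2 * Real.log 4 * Real.exp (-(u / 2)) / u := by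
  set y := Real.exp u with hy
  set N := ⌊y⌋₊ with hN
  set R := Nat.sqrt N with hR
  have hy4 : 4 ≤ y := by
    have := Real.quadratic_le_exp_of_nonneg (x := u) (by linarith)
    nlinarith
  have hy0 : 0 < y := Real.exp_pos u
  have hN4 : 4 ≤ N := Nat.le_floor (by exact_mod_cast hy4)
  have hR2 : 2 ≤ R := Nat.le_sqrt.2 (by omega)
  have hRN : R ≤ N := Nat.sqrt_le_self N
  have hsq : Real.exp (u / 2) ^ 2 = y := by rw [← Real.exp_nat_mul, hy]; congr 1; push_cast; ring
  have hs0 := Real.exp_pos (u / 2)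
  have hRlt : Real.exp (u / 2) < R + 1 := by
    have h1 : y < N + 1 := Nat.lt_floor_add_one y
    have h2 : N + 1 ≤ (R + 1) ^ 2 := by have := Nat.lt_succ_sqrt N; rw [pow_two]; exact this
    have h3 : ((N:ℝ) + 1) ≤ ((R:ℝ) + 1) ^ 2 := by exact_mod_cast h2
    refine lt_of_pow_lt_pow_left₀ 2 (by positivity) ?_
    rw [hsq]; linarith
  have hRle : (R:ℝ) ≤ Real.exp (u / 2) := by
    have h2 : R ^ 2 ≤ N := Nat.sqrt_le' N
    have h3 : (R:ℝ) ^ 2 ≤ N := by exact_mod_cast h2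
    refine le_of_pow_le_pow_left₀ two_ne_zero hs0.le ?_
    rw [hsq]
    exact h3.trans (Nat.floor_le hy0.le)
  have hR1 : (1:ℝ) < R := by exact_mod_cast (by omega : 1 < R)
  have hterm : ∀ p ∈ (Finset.Ioc 0 N).filter Nat.Prime, -Real.log (1 - 1 / (p:ℝ)) ≤
      ∑ i ∈ Finset.range (Nat.log p N), (1 / (p:ℝ)) ^ (i + 1) / ((i:ℝ) + 1) +
      ((if p ≤ R then 2 * Real.log p / (y * u) else 0) +
        if R < p then 1 / 2 * (1 / ((p:ℝ) * (p - 1))) else 0) := by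
    intro p hp
    rw [Finset.mem_filter, Finset.mem_Ioc] at hp
    obtain ⟨⟨-, hpN⟩, hp⟩ := hp
    have hp2 : (2:ℝ) ≤ p := by exact_mod_cast hp.two_le
    have hx1 : 1 / (p:ℝ) ≤ 1 / 2 := one_div_le_one_div_of_le (by norm_num) hp2
    have h := neg_log_one_sub_le (x := 1 / (p:ℝ)) (by positivity) (by linarith) (Nat.log p N)
    refine h.trans (add_le_add_right ?_ _)
    set K := Nat.log p N with hK
    by_cases hpR : p ≤ R
    · rw [if_pos hpR, if_neg (by omega), add_zero]
      have h1 : y < (p:ℝ) ^ (K + 1) := by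
        have := Nat.lt_pow_succ_log_self hp.one_lt N
        exact (Nat.lt_of_floor_lt (by exact_mod_cast this)).trans_le (by push_cast; rfl)
      have h2 : u ≤ ((K:ℝ) + 1) * Real.log p := by
        have := Real.log_le_log hy0 h1.le
        rw [hy, Real.log_exp, Real.log_pow] at this
        exact_mod_cast this
      have hl : 0 < Real.log p := Real.log_pos (by linarith)
      rw [one_div_pow]
      calc 1 / (p:ℝ) ^ (K + 1) / (((K:ℝ) + 1) * (1 - 1 / p))
          ≤ 1 / y / (u / Real.log p * (1 / 2)) := by
            have : u / Real.log p ≤ (K:ℝ) + 1 := by rwa [div_le_iff₀ hl]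
            refine div_le_div₀ (by positivity) (one_div_le_one_div_of_le hy0 h1.le) (by positivity) ?_
            refine mul_le_mul this (by linarith) (by norm_num) (by positivity)
        _ = 2 * Real.log p / (y * u) := by field_simp
    · rw [if_neg hpR, if_pos (by omega), zero_add]
      have hK1 : K = 1 := by
        rw [hK, Nat.log_eq_iff (Or.inl one_ne_zero)]
        refine ⟨by simpa using hpN, ?_⟩
        exact (Nat.sqrt_lt'.1 (not_le.1 hpR))
      rw [hK1]
      have : (p:ℝ) - 1 ≠ 0 := by linarith
      norm_num
      rw [show (1 - (p:ℝ)⁻¹) = ((p:ℝ) - 1) / p by field_simp]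
      refine le_of_eq ?_
      field_simp
  refine (Finset.sum_le_sum hterm).trans ?_
  rw [Finset.sum_add_distrib, Finset.sum_add_distrib]
  have h1 := sum_prime_pow_le_mangoldtLogSum (u := u) hN
  have h2 : ∑ p ∈ (Finset.Ioc 0 N).filter Nat.Prime, (if p ≤ R then 2 * Real.log p / (y * u) else 0)
      ≤ 2 * Real.log 4 * Real.exp (-(u / 2)) / u := by
    have e : ∑ p ∈ (Finset.Ioc 0 N).filter Nat.Prime, (if p ≤ R then 2 * Real.log p / (y * u) else 0)
        = 2 / (y * u) * Chebyshev.theta R := by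
      rw [← Finset.sum_filter, Chebyshev.theta, Nat.floor_natCast, Finset.mul_sum, Finset.filter_filter]
      refine Finset.sum_congr ?_ fun p _ => by ring
      ext p
      simp only [Finset.mem_filter, Finset.mem_Ioc]
      constructor
      · rintro ⟨h, h'⟩; exact ⟨⟨h.1, h'.2⟩, h'.1⟩
      · rintro ⟨h, h'⟩; exact ⟨⟨h.1, h.2.trans hRN⟩, h', h.2⟩
    rw [e]
    have h3 := (Chebyshev.theta_le_log4_mul_x (x := (R:ℝ)) (by positivity)).trans
      (mul_le_mul_of_nonneg_left hRle (Real.log_nonneg (by norm_num)))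
    calc 2 / (y * u) * Chebyshev.theta R ≤ 2 / (y * u) * (Real.log 4 * Real.exp (u / 2)) := by gcongr
      _ = _ := by
        rw [Real.exp_neg, ← hsq]; field_simp
  have h3 : ∑ p ∈ (Finset.Ioc 0 N).filter Nat.Prime,
      (if R < p then 1 / 2 * (1 / ((p:ℝ) * (p - 1))) else 0) ≤ 1 / (2 * (Real.exp (u / 2) - 1)) := by
    rw [← Finset.sum_filter]
    calc _ ≤ ∑ m ∈ Finset.Ioc R N, 1 / 2 * (1 / ((m:ℝ) * (m - 1))) := by
          refine Finset.sum_le_sum_of_subset_of_nonneg (fun p hp => ?_) fun m hm _ => ?_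
          · simp only [Finset.mem_filter, Finset.mem_Ioc] at hp ⊢
            exact ⟨hp.2, hp.1.1.2⟩
          · rw [Finset.mem_Ioc] at hm
            have : (1:ℝ) ≤ m := by exact_mod_cast (by omega : 1 ≤ m)
            have : (0:ℝ) ≤ m - 1 := by linarith
            positivity
      _ = 1 / 2 * (1 / R - 1 / N) := by
          rw [← Finset.mul_sum, sum_Ioc_one_div_mul_pred R N (by omega) hRN]
      _ ≤ 1 / 2 * (1 / R) := by
          have : (0:ℝ) ≤ 1 / N := by positivity
          linarith
      _ ≤ 1 / 2 * (1 / (Real.exp (u / 2) - 1)) := by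
          have : 0 < Real.exp (u / 2) - 1 := by linarith
          gcongr
          linarith
      _ = _ := by rw [one_div_mul_one_div]
  linarith

end

section

open Complex Filter Topology Metric

lemma div_totient_eq_prod {n : ℕ} (hn : n ≠ 0) :
    (n:ℝ) / n.totient = ∏ p ∈ n.primeFactors, (1 - 1 / (p:ℝ))⁻¹ := by
  have h : (n.totient : ℝ) = n * ∏ p ∈ n.primeFactors, (1 - 1 / (p:ℝ)) := by
    have := congrArg (fun q : ℚ => (q : ℝ)) (Nat.totient_eq_mul_prod_factors n)
    push_cast at this
    simpa only [one_div] using this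
  have hn0 : (n:ℝ) ≠ 0 := by exact_mod_cast hn
  rw [h, Finset.prod_inv_distrib, div_mul_eq_div_div, div_self hn0, one_div]

lemma one_sub_one_div_prime_pos {p : ℕ} (hp : p.Prime) : 0 < 1 - 1 / (p:ℝ) := by
  have : (1:ℝ) < p := by exact_mod_cast hp.one_lt
  rw [sub_pos, div_lt_one (by linarith)]
  exact this

lemma log_div_totient_eq_sum {n : ℕ} (hn : n ≠ 0) :
    Real.log ((n:ℝ) / n.totient) = ∑ p ∈ n.primeFactors, -Real.log (1 - 1 / (p:ℝ)) := by
  rw [div_totient_eq_prod hn, Real.log_prod fun p hp =>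
    (inv_pos.2 (one_sub_one_div_prime_pos (Nat.prime_of_mem_primeFactors hp))).ne']
  exact Finset.sum_congr rfl fun p _ => Real.log_inv _

lemma sum_log_primeFactors_le {n : ℕ} (hn : n ≠ 0) :
    ∑ p ∈ n.primeFactors, Real.log p ≤ Real.log n := by
  rw [← Real.log_prod fun p hp => by
    exact_mod_cast (Nat.prime_of_mem_primeFactors hp).ne_zero]
  have h := Nat.le_of_dvd (Nat.pos_of_ne_zero hn) (Nat.prod_primeFactors_dvd n)
  have h0 : 0 < ∏ p ∈ n.primeFactors, p :=
    Finset.prod_pos fun p hp => (Nat.prime_of_mem_primeFactors hp).pos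
  rw [← Nat.cast_prod]
  exact Real.log_le_log (Nat.cast_pos.2 h0) (Nat.cast_le.2 h)

/-- Bound for `log (n / φ n)` by the sum over all primes up to `log n`. -/
lemma log_div_totient_le {n : ℕ} {u : ℝ} (hu : 2 ≤ u) (hnu : Real.log n = Real.exp u) :
    Real.log ((n:ℝ) / n.totient) ≤
      mertensSum u + 1 / u + (Chebyshev.psi (Real.exp u) - Chebyshev.theta (Real.exp u)) *
        (Real.exp (-u) / u) + 1 / ((Real.exp u - 1) * u) +
      1 / (2 * (Real.exp (u / 2) - 1)) + 2 * Real.log 4 * Real.exp (-(u / 2)) / u := by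
  have hn : n ≠ 0 := by
    rintro rfl
    have := Real.exp_pos u
    rw [Nat.cast_zero, Real.log_zero] at hnu
    linarith
  set y := Real.exp u with hy
  have hy1 : 1 < y := Real.one_lt_exp_iff.2 (by linarith)
  have hy0 : 0 < y := by linarith
  have hly : Real.log y = u := Real.log_exp u
  set w := -Real.log (1 - 1 / y) / u with hw
  have hgy0 : 0 < 1 - 1 / y := by rw [sub_pos, div_lt_one hy0]; exact hy1
  have hw_le : w ≤ 1 / ((y - 1) * u) := by
    have h1 : -Real.log (1 - 1 / y) ≤ 1 / (y - 1) := by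
      rw [← Real.log_inv]
      refine (Real.log_le_sub_one_of_pos (inv_pos.2 hgy0)).trans_eq ?_
      have : y - 1 ≠ 0 := by linarith
      rw [show 1 - 1 / y = (y - 1) / y by field_simp]
      field_simp
      ring
    rw [hw, ← div_div]
    gcongr
  have hw_ge : 1 / (y * u) ≤ w := by
    have h1 : 1 / y ≤ -Real.log (1 - 1 / y) := by
      have := Real.log_le_sub_one_of_pos hgy0
      linarith
    rw [hw, ← div_div]
    gcongr
  have hw0 : 0 ≤ w := le_trans (by positivity) hw_ge
  have hlt (p : ℕ) (hp : p.Prime) : 0 < Real.log p := Real.log_pos (by exact_mod_cast hp.one_lt)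
  have hgu : 0 ≤ -Real.log (1 - 1 / y) := by
    have := mul_nonneg hw0 (show 0 ≤ u by linarith)
    rwa [hw, div_mul_cancel₀ _ (by linarith)] at this
  have hsmall (p : ℕ) (hp : p.Prime) (h : (p:ℝ) ≤ y) :
      0 ≤ -Real.log (1 - 1 / (p:ℝ)) - w * Real.log p := by
    have hp0 : (0:ℝ) < p := by exact_mod_cast hp.pos
    have h1 : Real.log (1 - 1 / (p:ℝ)) ≤ Real.log (1 - 1 / y) :=
      Real.log_le_log (one_sub_one_div_prime_pos hp) (by gcongr)
    have h2 : w * Real.log p ≤ w * u := by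
      rw [← hly]; gcongr
    have h3 : w * u = -Real.log (1 - 1 / y) := by rw [hw, div_mul_cancel₀ _ (by linarith)]
    linarith
  have hlarge (p : ℕ) (hp : p.Prime) (h : y < (p:ℝ)) :
      -Real.log (1 - 1 / (p:ℝ)) - w * Real.log p ≤ 0 := by
    have hp0 : (0:ℝ) < p := by exact_mod_cast hp.pos
    have h1 : Real.log (1 - 1 / y) ≤ Real.log (1 - 1 / (p:ℝ)) :=
      Real.log_le_log hgy0 (by gcongr)
    have h2 : w * u ≤ w * Real.log p := by
      rw [← hly]; gcongr
    have h3 : w * u = -Real.log (1 - 1 / y) := by rw [hw, div_mul_cancel₀ _ (by linarith)]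
    linarith
  have hsum : ∑ p ∈ n.primeFactors, (-Real.log (1 - 1 / (p:ℝ)) - w * Real.log p) ≤
      ∑ p ∈ Finset.Ioc 0 ⌊y⌋₊ with p.Prime, (-Real.log (1 - 1 / (p:ℝ)) - w * Real.log p) := by
    classical
    rw [← Finset.sum_filter_add_sum_filter_not n.primeFactors (fun p : ℕ => (p:ℝ) ≤ y)]
    have h1 : ∑ p ∈ n.primeFactors.filter (fun p : ℕ => ¬ (p:ℝ) ≤ y),
        (-Real.log (1 - 1 / (p:ℝ)) - w * Real.log p) ≤ 0 := by
      refine Finset.sum_nonpos fun p hp => ?_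
      rw [Finset.mem_filter] at hp
      exact hlarge p (Nat.prime_of_mem_primeFactors hp.1) (not_le.1 hp.2)
    have h2 : ∑ p ∈ n.primeFactors.filter (fun p : ℕ => (p:ℝ) ≤ y),
        (-Real.log (1 - 1 / (p:ℝ)) - w * Real.log p) ≤
        ∑ p ∈ Finset.Ioc 0 ⌊y⌋₊ with p.Prime, (-Real.log (1 - 1 / (p:ℝ)) - w * Real.log p) := by
      refine Finset.sum_le_sum_of_subset_of_nonneg (fun p hp => ?_) fun p hp _ => ?_
      · rw [Finset.mem_filter] at hp
        have hpp := Nat.prime_of_mem_primeFactors hp.1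
        rw [Finset.mem_filter, Finset.mem_Ioc]
        exact ⟨⟨hpp.pos, Nat.le_floor hp.2⟩, hpp⟩
      · rw [Finset.mem_filter, Finset.mem_Ioc, Nat.le_floor_iff hy0.le] at hp
        exact hsmall p hp.2 hp.1.2
    linarith
  rw [Finset.sum_sub_distrib, Finset.sum_sub_distrib, ← Finset.mul_sum, ← Finset.mul_sum,
    ← log_div_totient_eq_sum hn] at hsum
  have hth : ∑ p ∈ Finset.Ioc 0 ⌊y⌋₊ with p.Prime, Real.log (p:ℝ) = Chebyshev.theta y := rfl
  have h1 := mul_le_mul_of_nonneg_left (sum_log_primeFactors_le hn) hw0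
  have h2 := sum_neg_log_one_sub_le hu
  have h3 := mangoldtLogSum_eq (u := u)
  rw [← hy] at h2 h3
  rw [hth] at hsum
  rw [hnu] at h1
  have h4 := mul_le_mul_of_nonneg_right hw_ge (Chebyshev.theta_nonneg y)
  have h5 := mul_le_mul_of_nonneg_right hw_le hy0.le
  have h6 : 1 / ((y - 1) * u) * y = 1 / u + 1 / ((y - 1) * u) := by
    have : y - 1 ≠ 0 := by linarith
    field_simp
    ring
  have h7 : Real.exp (-u) / u = 1 / (y * u) := by rw [Real.exp_neg, ← hy]; field_simp
  rw [h7] at h3 ⊢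
  nlinarith

lemma exp_div_two_ge {u : ℝ} (hu : 10.5 ≤ u) :
    190.5 * (1 + (u - 10.5) / 2 + (u - 10.5) ^ 2 / 8) ≤ Real.exp (u / 2) := by
  have h1 : (190.5 : ℝ) ≤ Real.exp 5.25 := by
    have h := Real.exp_one_gt_d9
    have h2 : Real.exp 5.25 = Real.exp 1 ^ 5 * Real.exp 0.25 := by
      rw [← Real.exp_nat_mul, ← Real.exp_add]; norm_num
    have h3 : (1.284 : ℝ) ≤ Real.exp 0.25 := by
      have := Real.sum_le_exp_of_nonneg (show (0:ℝ) ≤ 0.25 by norm_num) 6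
      norm_num [Finset.sum_range_succ, Nat.factorial] at this ⊢
      linarith
    have h4 : (148.41 : ℝ) ≤ Real.exp 1 ^ 5 := by
      calc (148.41:ℝ) ≤ 2.7182818283 ^ 5 := by norm_num
        _ ≤ _ := by gcongr
    rw [h2]
    calc (190.5:ℝ) ≤ 148.41 * 1.284 := by norm_num
      _ ≤ _ := by gcongr
  have h2 := Real.quadratic_le_exp_of_nonneg (x := (u - 10.5) / 2) (by linarith)
  have h3 : Real.exp (u / 2) = Real.exp 5.25 * Real.exp ((u - 10.5) / 2) := by
    rw [← Real.exp_add]; congr 1; ring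
  rw [h3]
  have h4 : 1 + (u - 10.5) / 2 + (u - 10.5) ^ 2 / 8 = 1 + (u - 10.5) / 2 + ((u - 10.5) / 2) ^ 2 / 2 := by
    ring
  rw [h4]
  have : 0 ≤ u - 10.5 := by linarith
  gcongr

lemma psi_sub_theta_exp_le {u : ℝ} (hu : 10.5 ≤ u) :
    Chebyshev.psi (Real.exp u) - Chebyshev.theta (Real.exp u) ≤ 6.58 * Real.exp (u / 2) := by
  have h := Chebyshev.psi_sub_theta_le_psi_add_psi_add_psi (Real.exp u)
  have hb (x : ℝ) : Chebyshev.psi (Real.exp u ^ x) ≤ (Real.log 4 + 4) * Real.exp (u * x) := by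
    rw [← Real.exp_mul]; exact Chebyshev.psi_le_const_mul_self (Real.exp_pos _).le
  have h2 := hb 2⁻¹
  have h3 := hb 3⁻¹
  have h5 := hb 5⁻¹
  have hl : Real.log 4 ≤ 1.3864 := by
    rw [show (4:ℝ) = 2 ^ 2 by norm_num, Real.log_pow]
    have := Real.log_two_lt_d9
    push_cast; linarith
  have hl0 : 0 ≤ Real.log 4 := Real.log_nonneg (by norm_num)
  have hexp (c k : ℝ) (hc : 0 < c) (hk : c ≤ Real.exp k) (x : ℝ) (hx : u * x + k ≤ u / 2) :
      Real.exp (u * x) ≤ Real.exp (u / 2) / c := by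
    rw [le_div_iff₀ hc]
    calc Real.exp (u * x) * c ≤ Real.exp (u * x) * Real.exp k := by gcongr
      _ = Real.exp (u * x + k) := (Real.exp_add _ _).symm
      _ ≤ _ := Real.exp_le_exp.2 hx
  have k3 : (5.7:ℝ) ≤ Real.exp 1.75 := by
    have := Real.sum_le_exp_of_nonneg (show (0:ℝ) ≤ 1.75 by norm_num) 7
    norm_num [Finset.sum_range_succ, Nat.factorial] at this ⊢
    linarith
  have k5 : (22:ℝ) ≤ Real.exp 3.15 := by
    have := Real.sum_le_exp_of_nonneg (show (0:ℝ) ≤ 3.15 by norm_num) 9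
    norm_num [Finset.sum_range_succ, Nat.factorial] at this ⊢
    linarith
  have e3 := hexp 5.7 1.75 (by norm_num) k3 3⁻¹ (by linarith)
  have e5 := hexp 22 3.15 (by norm_num) k5 5⁻¹ (by linarith)
  rw [← div_eq_mul_inv] at h2
  have hE := Real.exp_pos (u / 2)
  have m3 := mul_le_mul_of_nonneg_left e3 (show 0 ≤ Real.log 4 + 4 by linarith)
  have m5 := mul_le_mul_of_nonneg_left e5 (show 0 ≤ Real.log 4 + 4 by linarith)
  have m := mul_le_mul_of_nonneg_right (show Real.log 4 + 4 ≤ 5.3864 by linarith) hE.le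
  calc _ ≤ _ := h
    _ ≤ (Real.log 4 + 4) * Real.exp (u / 2) + (Real.log 4 + 4) * (Real.exp (u / 2) / 5.7) +
        (Real.log 4 + 4) * (Real.exp (u / 2) / 22) :=
      add_le_add (add_le_add h2 (h3.trans m3)) (h5.trans m5)
    _ ≤ _ := by
      have e : (Real.log 4 + 4) * Real.exp (u / 2) +
          (Real.log 4 + 4) * (Real.exp (u / 2) / 5.7) +
          (Real.log 4 + 4) * (Real.exp (u / 2) / 22) =
          (Real.log 4 + 4) * Real.exp (u / 2) * (1 + 1 / 5.7 + 1 / 22) := by ring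
      rw [e]
      refine (mul_le_mul_of_nonneg_right m (by norm_num)).trans ?_
      rw [mul_assoc, mul_comm (Real.exp _), ← mul_assoc]
      exact mul_le_mul_of_nonneg_right (by norm_num) hE.le

lemma exp_eulerMascheroniConstant_le : Real.exp Real.eulerMascheroniConstant ≤ 1.7811 := by
  have h1 := eulerMascheroniConstant_lt_d7
  refine (Real.exp_le_exp.2 h1.le).trans ?_
  have := Real.exp_bound' (x := 0.5772158) (by norm_num) (by norm_num) (n := 9) (by norm_num)
  norm_num [Finset.sum_range_succ, Nat.factorial] at this ⊢
  linarith

lemma totient_bound_of_log_div_le {n : ℕ} {u q : ℝ} (hn : n ≠ 0) (hu : 10.5 ≤ u)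
    (h : Real.log ((n:ℝ) / n.totient) ≤ Real.log u + Real.eulerMascheroniConstant + q)
    (hq : q * u ^ 2 ≤ 1.398) :
    (n:ℝ) / n.totient < Real.exp Real.eulerMascheroniConstant * u + 2.50637 / u := by
  have hu0 : 0 < u := by linarith
  have hR : 0 < (n:ℝ) / n.totient := by
    have h1 : (0:ℝ) < n := by exact_mod_cast Nat.pos_of_ne_zero hn
    have h2 : (0:ℝ) < n.totient := by exact_mod_cast Nat.totient_pos.2 (Nat.pos_of_ne_zero hn)
    positivity
  have h1 : (n:ℝ) / n.totient ≤ u * Real.exp Real.eulerMascheroniConstant * Real.exp q := by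
    rw [← Real.exp_log hR]
    refine (Real.exp_le_exp.2 h).trans_eq ?_
    rw [Real.exp_add, Real.exp_add, Real.exp_log hu0]
  have hx : q ≤ 1.398 / u ^ 2 := by rwa [le_div_iff₀ (by positivity)]
  have hu2 : 110.25 ≤ u ^ 2 := by nlinarith
  have h2 : 1.398 / u ^ 2 < 0.0127 := by
    rw [div_lt_iff₀ (by positivity)]; linarith
  have h3 : Real.exp q ≤ 1 + 1.4071 / u ^ 2 := by
    set x := 1.398 / u ^ 2 with hxdef
    have hx0 : 0 < x := by positivity
    have h4 := Real.exp_bound' hx0.le (by linarith) (n := 3) (by norm_num)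
    norm_num [Finset.sum_range_succ, Nat.factorial] at h4
    have h5 : x * u ^ 2 = 1.398 := div_mul_cancel₀ _ (by positivity)
    have h6 : 1.4071 / u ^ 2 = x * (1.4071 / 1.398) := by rw [hxdef]; field_simp
    rw [h6]
    refine (Real.exp_le_exp.2 hx).trans (h4.trans ?_)
    have h7 : x ^ 2 ≤ 0.01268049 * x := by nlinarith
    nlinarith
  have h0 := Real.exp_pos Real.eulerMascheroniConstant
  have h7 : Real.exp Real.eulerMascheroniConstant * (1.4071 / u) < 2.50637 / u := by
    rw [← mul_div_assoc]
    gcongr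
    nlinarith [exp_eulerMascheroniConstant_le]
  calc _ ≤ u * Real.exp Real.eulerMascheroniConstant * Real.exp q := h1
    _ ≤ u * Real.exp Real.eulerMascheroniConstant * (1 + 1.4071 / u ^ 2) := by gcongr
    _ = Real.exp Real.eulerMascheroniConstant * u + Real.exp Real.eulerMascheroniConstant * (1.4071 / u) := by
      field_simp
    _ < _ := by linarith

/-- The prime power and truncation errors, after multiplication by `u ^ 2`. -/
lemma prime_power_error_le {u : ℝ} (hu : 10.5 ≤ u) :
    ((Chebyshev.psi (Real.exp u) - Chebyshev.theta (Real.exp u)) *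
        (Real.exp (-u) / u) + 1 / ((Real.exp u - 1) * u) +
      1 / (2 * (Real.exp (u / 2) - 1)) + 2 * Real.log 4 * Real.exp (-(u / 2)) / u) * u ^ 2 ≤
    (0.5027 * u ^ 2 + 9.36 * u) / Real.exp (u / 2) := by
  set E := Real.exp (u / 2) with hE
  have hu0 : 0 < u := by linarith
  have hE1 : 190.5 ≤ E := by
    have := exp_div_two_ge hu
    nlinarith [sq_nonneg (u - 10.5)]
  have hE0 : 0 < E := by linarith
  have hy : Real.exp u = E ^ 2 := by rw [hE, ← Real.exp_nat_mul]; congr 1; push_cast; ring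
  have h1 := psi_sub_theta_exp_le hu
  have hl : Real.log 4 ≤ 1.3864 := by
    rw [show (4:ℝ) = 2 ^ 2 by norm_num, Real.log_pow]
    have := Real.log_two_lt_d9
    push_cast; linarith
  rw [Real.exp_neg, Real.exp_neg, hy, ← hE] at *
  have a1 : (Chebyshev.psi (E ^ 2) - Chebyshev.theta (E ^ 2)) * ((E ^ 2)⁻¹ / u) ≤
      6.58 / (E * u) := by
    calc _ ≤ 6.58 * E * ((E ^ 2)⁻¹ / u) := by gcongr
      _ = _ := by field_simp
  have a2 : 1 / ((E ^ 2 - 1) * u) ≤ 0.006 / (E * u) := by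
    rw [div_le_div_iff₀ (mul_pos (by nlinarith) hu0) (by positivity)]
    have : E ≤ 0.006 * (E ^ 2 - 1) := by nlinarith
    nlinarith
  have a3 : 1 / (2 * (E - 1)) ≤ 0.5027 / E := by
    rw [div_le_div_iff₀ (by linarith) hE0]
    linarith
  have a4 : 2 * Real.log 4 * E⁻¹ / u ≤ 2.7728 / (E * u) := by
    rw [← div_eq_mul_inv, div_div]
    gcongr
    linarith
  have a5 : (6.58 / (E * u) + 0.006 / (E * u) + 0.5027 / E + 2.7728 / (E * u)) * u ^ 2 ≤
      (0.5027 * u ^ 2 + 9.36 * u) / E := by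
    rw [show (6.58 / (E * u) + 0.006 / (E * u) + 0.5027 / E + 2.7728 / (E * u)) * u ^ 2 =
      (0.5027 * u ^ 2 + (6.58 + 0.006 + 2.7728) * u) / E by field_simp; ring]
    gcongr
    norm_num
  refine le_trans ?_ a5
  gcongr

theorem totient_bound_of_log_log_ge {n : ℕ} (hn : 3 ≤ n) (hu : 10.5 ≤ Real.log (Real.log n)) :
    (n:ℝ) / n.totient < Real.exp Real.eulerMascheroniConstant * Real.log (Real.log n) +
      2.50637 / Real.log (Real.log n) := by
  have hl : 0 < Real.log n := Real.log_pos (by exact_mod_cast (by omega : 1 < n))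
  have hnu : Real.log n = Real.exp (Real.log (Real.log n)) := (Real.exp_log hl).symm
  set u := Real.log (Real.log n) with hudef
  have hu0 : 0 < u := by linarith
  have h := log_div_totient_le (by linarith) hnu
  have hE := prime_power_error_le hu
  have hexp := exp_div_two_ge hu
  set e := (Chebyshev.psi (Real.exp u) - Chebyshev.theta (Real.exp u)) *
        (Real.exp (-u) / u) + 1 / ((Real.exp u - 1) * u) +
      1 / (2 * (Real.exp (u / 2) - 1)) + 2 * Real.log 4 * Real.exp (-(u / 2)) / u with hedef
  have h' : Real.log ((n:ℝ) / n.totient) ≤ mertensSum u + 1 / u + e := by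
    rw [hedef]; linarith
  clear_value e u
  clear h hedef hudef hnu
  have key (q : ℝ) (hq1 : mertensSum u - (Real.log u - 1 / u + Real.eulerMascheroniConstant) ≤ q)
      (hq2 : (q + e) * u ^ 2 ≤ 1.398) :=
    totient_bound_of_log_div_le (n := n) (by omega) hu (q := q + e) (by linarith) hq2
  have hE0 : 0 < Real.exp (u / 2) := Real.exp_pos _
  obtain ⟨s, hs, rfl⟩ : ∃ s, 0 ≤ s ∧ s + 10.5 = u := ⟨u - 10.5, by linarith, by ring⟩
  rw [add_sub_cancel_right] at hexp
  have hD : 0 < 190.5 * (1 + s / 2 + s ^ 2 / 8) := by positivity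
  have hE2 : e * (s + 10.5) ^ 2 ≤ (0.5027 * (s + 10.5) ^ 2 + 9.36 * (s + 10.5)) /
      (190.5 * (1 + s / 2 + s ^ 2 / 8)) := hE.trans (by gcongr)
  rcases le_total (s + 10.5) 20 with h20 | h20
  · refine key _ ((le_abs_self _).trans (abs_mertensSum_sub_le_const (by linarith))) ?_
    rw [add_mul, show 0.0478 * (1 / (s + 10.5) + 1 / (s + 10.5) ^ 2) * (s + 10.5) ^ 2 =
      0.0478 * (s + 11.5) by field_simp; ring]
    have : (0.5027 * (s + 10.5) ^ 2 + 9.36 * (s + 10.5)) / (190.5 * (1 + s / 2 + s ^ 2 / 8)) ≤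
        1.398 - 0.0478 * (s + 11.5) := by
      rw [div_le_iff₀ hD]
      nlinarith [mul_nonneg hs (show 0 ≤ 9.5 - s by linarith),
        mul_nonneg (mul_nonneg hs hs) (show 0 ≤ 9.5 - s by linarith)]
    linarith
  · refine key _ ((le_abs_self _).trans (abs_mertensSum_sub_le_div h20)) ?_
    rw [add_mul, show 0.67 * (3 / 2 / (s + 10.5) ^ 2 + 5 / 3 / (s + 10.5) ^ 3) * (s + 10.5) ^ 2 =
      0.67 * (3 / 2 + 5 / 3 / (s + 10.5)) by field_simp]
    have h1 : 5 / 3 / (s + 10.5) ≤ 5 / 3 / 20 := by gcongr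
    have : (0.5027 * (s + 10.5) ^ 2 + 9.36 * (s + 10.5)) / (190.5 * (1 + s / 2 + s ^ 2 / 8)) ≤
        0.33 := by
      rw [div_le_iff₀ hD]
      nlinarith
    linarith

end

section

open Filter Topology

lemma prod_le_prod_of_card_le {f : ℕ → ℝ} {S T : Finset ℕ} {c : ℝ} (hf : ∀ p, 0 ≤ f p)
    (hc : 1 ≤ c) (hST : S.card ≤ T.card) (hS : ∀ p ∈ S, p ∉ T → f p ≤ c)
    (hT : ∀ p ∈ T, p ∉ S → c ≤ f p) : ∏ p ∈ S, f p ≤ ∏ p ∈ T, f p := by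
  rw [← Finset.prod_inter_mul_prod_sdiff S T, ← Finset.prod_inter_mul_prod_sdiff T S,
    Finset.inter_comm T S]
  refine mul_le_mul_of_nonneg_left ?_ (Finset.prod_nonneg fun p _ => hf p)
  have hcard : (S \ T).card ≤ (T \ S).card := by
    have h1 := Finset.card_sdiff_add_card_inter S T
    have h2 := Finset.card_sdiff_add_card_inter T S
    rw [Finset.inter_comm] at h2
    omega
  calc ∏ p ∈ S \ T, f p ≤ c ^ (S \ T).card :=
        (Finset.prod_le_prod (fun p _ => hf p) fun p hp =>
          hS p (Finset.mem_sdiff.1 hp).1 (Finset.mem_sdiff.1 hp).2).trans_eq (Finset.prod_const c)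
    _ ≤ c ^ (T \ S).card := pow_le_pow_right₀ hc hcard
    _ = ∏ _p ∈ T \ S, c := by rw [Finset.prod_const]
    _ ≤ _ := Finset.prod_le_prod (fun _ _ => by linarith) fun p hp =>
        hT p (Finset.mem_sdiff.1 hp).1 (Finset.mem_sdiff.1 hp).2

/-- Product of the primes less than `z`. -/
def primeProd (z : ℕ) : ℕ := ∏ p ∈ z.primesBelow, p

/-- Product of `p - 1` over the primes `p` less than `z`. -/
def primePredProd (z : ℕ) : ℕ := ∏ p ∈ z.primesBelow, (p - 1)

lemma primePredProd_pos (z : ℕ) : 0 < primePredProd z :=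
  Finset.prod_pos fun _ hp => Nat.sub_pos_of_lt (Nat.prime_of_mem_primesBelow hp).one_lt

lemma primeProd_div_primePredProd (z : ℕ) :
    (primeProd z : ℝ) / primePredProd z = ∏ p ∈ z.primesBelow, (1 - 1 / (p:ℝ))⁻¹ := by
  rw [primeProd, primePredProd, Nat.cast_prod, Nat.cast_prod, ← Finset.prod_div_distrib]
  refine Finset.prod_congr rfl fun p hp => ?_
  have hp := Nat.prime_of_mem_primesBelow hp
  have h1 : (1:ℝ) < p := by exact_mod_cast hp.one_lt
  rw [Nat.cast_pred hp.pos, one_sub_div (by linarith), inv_div]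

lemma card_primeFactors_le {n z : ℕ} (hz : z.Prime) (hn : n ≠ 0) (h : n < primeProd z * z) :
    n.primeFactors.card ≤ z.primesBelow.card := by
  by_contra! hlt
  have hcard : (z + 1).primesBelow.card ≤ n.primeFactors.card := by
    rw [Nat.primesBelow_succ, if_pos hz, Finset.card_insert_of_notMem (Nat.notMem_primesBelow z)]
    exact hlt
  have h1 := prod_le_prod_of_card_le (f := fun p : ℕ => (p:ℝ)) (c := z) (fun p => p.cast_nonneg)
    (by exact_mod_cast hz.one_lt.le) hcard
    (fun p hp _ => by exact_mod_cast Nat.lt_succ_iff.1 (Nat.lt_of_mem_primesBelow hp))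
    (fun p hp hp' => by
      have hpp := Nat.prime_of_mem_primeFactors hp
      by_contra! hlt
      exact hp' (Nat.mem_primesBelow.2 ⟨Nat.lt_succ_of_lt (by exact_mod_cast hlt), hpp⟩))
  rw [← Nat.cast_prod, ← Nat.cast_prod, Nat.cast_le, Nat.primesBelow_succ, if_pos hz,
    Finset.prod_insert (Nat.notMem_primesBelow z)] at h1
  have h2 := Nat.le_of_dvd (Nat.pos_of_ne_zero hn) (Nat.prod_primeFactors_dvd n)
  rw [primeProd, mul_comm] at h
  omega

lemma div_totient_le_of_lt {n z : ℕ} (hz : z.Prime) (hn : n ≠ 0) (h : n < primeProd z * z) :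
    (n:ℝ) / n.totient ≤ (primeProd z : ℝ) / primePredProd z := by
  have hz1 : (1:ℝ) < z := by exact_mod_cast hz.one_lt
  have hle {a b : ℕ} (ha : 1 < a) (hab : a ≤ b) : (1 - 1 / (b:ℝ))⁻¹ ≤ (1 - 1 / (a:ℝ))⁻¹ := by
    have ha1 : (1:ℝ) < a := by exact_mod_cast ha
    have hab' : (a:ℝ) ≤ b := by exact_mod_cast hab
    have : 0 < 1 - 1 / (a:ℝ) := by rw [sub_pos, div_lt_one (by linarith)]; exact ha1
    gcongr
  rw [div_totient_eq_prod hn, primeProd_div_primePredProd]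
  refine prod_le_prod_of_card_le (c := (1 - 1 / (z:ℝ))⁻¹) (fun p => ?_) ?_
    (card_primeFactors_le hz hn h) (fun p hp hp' => ?_) (fun p hp _ => ?_)
  · rw [inv_nonneg, sub_nonneg]
    rcases Nat.eq_zero_or_pos p with rfl | hp
    · simp
    · rw [div_le_one (by exact_mod_cast hp)]
      exact_mod_cast hp
  · refine (one_le_inv₀ (one_sub_one_div_prime_pos hz)).2 ?_
    have : 0 < 1 / (z:ℝ) := by positivity
    linarith
  · have hpp := Nat.prime_of_mem_primeFactors hp
    refine hle hz.one_lt ?_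
    by_contra! hlt
    exact hp' (Nat.mem_primesBelow.2 ⟨hlt, hpp⟩)
  · exact hle (Nat.prime_of_mem_primesBelow hp).one_lt (Nat.lt_of_mem_primesBelow hp).le

lemma exp_eulerMascheroniConstant_ge : 1.7810724 ≤ Real.exp Real.eulerMascheroniConstant := by
  refine le_trans ?_ (Real.exp_le_exp.2 eulerMascheroniConstant_gt_d8.le)
  have := Real.sum_le_exp_of_nonneg (show (0:ℝ) ≤ 0.57721566 by norm_num) 12
  norm_num [Finset.sum_range_succ, Nat.factorial] at this ⊢
  linarith

lemma totient_bound_of_mem_block {n z : ℕ} {L : ℝ} (hz : z.Prime) (hn : n < primeProd z * z)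
    (hn0 : 0 < n) (hL : 1.2 ≤ L) (hLn : Real.exp L ≤ Real.log n)
    (h : (primeProd z : ℝ) / primePredProd z < 1.7810724 * L + 2.50637 / L) :
    (n:ℝ) / n.totient < Real.exp Real.eulerMascheroniConstant * Real.log (Real.log n) +
      2.50637 / Real.log (Real.log n) := by
  have hl : L ≤ Real.log (Real.log n) := by
    rw [← Real.log_exp L]
    exact Real.log_le_log (Real.exp_pos _) hLn
  generalize Real.log (Real.log n) = u at hl ⊢
  have h1 := div_totient_le_of_lt hz hn0.ne' hn
  have h2 : 1.7810724 * u ≤ Real.exp Real.eulerMascheroniConstant * u := by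
    gcongr
    · linarith
    · exact exp_eulerMascheroniConstant_ge
  have h3 : 1.7810724 * L + 2.50637 / L ≤ 1.7810724 * u + 2.50637 / u := by
    have hL0 : 0 < L := by linarith
    have hu0 : 0 < u := by linarith
    have e : 1.7810724 * u + 2.50637 / u - (1.7810724 * L + 2.50637 / L) =
        (u - L) * (1.7810724 * (L * u) - 2.50637) / (L * u) := by field_simp; ring
    have : 0 ≤ (u - L) * (1.7810724 * (L * u) - 2.50637) / (L * u) := by
      have : 1.44 ≤ L * u := by nlinarith
      refine div_nonneg (mul_nonneg (by linarith) (by linarith)) (by positivity)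
    linarith
  linarith

lemma exp_div_le_pow (l : ℕ) : Real.exp ((l:ℝ) / 4096) ≤ (8193 / 8191 : ℝ) ^ l := by
  have h : Real.exp (1 / 4096) ≤ (8193 / 8191 : ℝ) := by
    have := Real.exp_bound' (x := 1 / 4096) (by norm_num) (by norm_num) (n := 4) (by norm_num)
    norm_num [Finset.sum_range_succ, Nat.factorial] at this ⊢
    linarith
  rw [show (l:ℝ) / 4096 = l * (1 / 4096) by ring, Real.exp_nat_mul]
  gcongr

lemma exp_div_le_log {Y l K : ℕ} (hY : 2 ^ K ≤ Y ^ 64)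
    (hK : 8193 ^ l * (64 * 10 ^ 8) ≤ 8191 ^ l * 69314718 * K) :
    Real.exp ((l:ℝ) / 4096) ≤ Real.log Y := by
  have h1 : (K:ℝ) * Real.log 2 ≤ 64 * Real.log Y := by
    have : Real.log ((2:ℝ) ^ K) ≤ Real.log ((Y:ℝ) ^ 64) :=
      Real.log_le_log (by positivity) (by exact_mod_cast hY)
    rw [Real.log_pow, Real.log_pow] at this
    exact_mod_cast this
  have h2 : (8193:ℝ) ^ l * (64 * 10 ^ 8) ≤ 8191 ^ l * 69314718 * K := by exact_mod_cast hK
  have h3 := Real.log_two_gt_d9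
  refine (exp_div_le_pow l).trans ?_
  have h4 : (8193 / 8191 : ℝ) ^ l * (64 * 10 ^ 8) ≤ 69314718 * K := by
    rw [div_pow, div_mul_eq_mul_div, div_le_iff₀ (by positivity)]
    linarith
  nlinarith [show (0:ℝ) ≤ K from K.cast_nonneg]

end

section

open Filter Topology

/-- The primes less than `200`. -/
def smallPrimes : List ℕ :=
  [2, 3, 5, 7, 11, 13, 17, 19, 23, 29, 31, 37, 41, 43, 47, 53, 59, 61, 67, 71, 73, 79, 83, 89,
   97, 101, 103, 107, 109, 113, 127, 131, 137, 139, 149, 151, 157, 163, 167, 173, 179, 181, 191,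
   193, 197, 199]

/-- The product of the primes less than `200`. -/
def smallPrimesProd : ℕ :=
  7799922041683461553249199106329813876687996789903550945093032474868511536164700810

/-- A primality test for `n < 40000`. -/
def primeTest (n : ℕ) : Bool :=
  bif Nat.ble 200 n then Nat.beq (Nat.gcd n smallPrimesProd) 1 else smallPrimes.any (Nat.beq n)

lemma mem_smallPrimes_iff {p : ℕ} (hp : p < 200) : p ∈ smallPrimes ↔ p.Prime := by
  interval_cases p <;> norm_num [smallPrimes]

lemma lt_of_mem_smallPrimes : ∀ p ∈ smallPrimes, p < 200 := by decide

lemma smallPrimesProd_eq : smallPrimesProd = smallPrimes.prod := by decide +kernel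

lemma primeTest_iff {n : ℕ} (hn : n < 40000) : primeTest n = true ↔ n.Prime := by
  rcases lt_or_ge n 200 with h | h
  · have : Nat.ble 200 n = false := by
      rw [← Bool.not_eq_true, Nat.ble_eq]; omega
    rw [primeTest, this, cond_false, List.any_eq_true, ← mem_smallPrimes_iff h]
    simp
  · rw [primeTest, Nat.ble_eq_true_of_le h, cond_true, Nat.beq_eq, ← Nat.coprime_iff_gcd_eq_one]
    constructor
    · intro hc
      by_contra hp
      have h1 := Nat.minFac_sq_le_self (by omega) hp
      have h2 : n.minFac < 200 := by nlinarith
      have h3 := Nat.minFac_prime (n := n) (by omega)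
      have h4 : n.minFac ∣ smallPrimesProd := by
        rw [smallPrimesProd_eq]
        exact List.dvd_prod ((mem_smallPrimes_iff h2).2 h3)
      exact h3.one_lt.ne' (Nat.eq_one_of_dvd_coprimes hc n.minFac_dvd h4)
    · intro hp
      rw [hp.coprime_iff_not_dvd, smallPrimesProd_eq, hp.prime.dvd_prod_iff]
      rintro ⟨q, hq, hpq⟩
      have h1 := lt_of_mem_smallPrimes q hq
      have h2 := Nat.le_of_dvd ((mem_smallPrimes_iff h1).1 hq).pos hpq
      omega

/-- `∏ i < m, g (a + 2 * i)` for `m ≤ 2 ^ k`, evaluated by bisection. -/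
def oddProd (g : ℕ → ℕ) : ℕ → ℕ → ℕ → ℕ
  | 0, a, m => bif Nat.beq m 0 then 1 else g a
  | k + 1, a, m => bif Nat.ble m (2 ^ k) then oddProd g k a m else
      oddProd g k a (2 ^ k) * oddProd g k (a + 2 * 2 ^ k) (m - 2 ^ k)

lemma oddProd_eq (g : ℕ → ℕ) (k a m : ℕ) (hm : m ≤ 2 ^ k) :
    oddProd g k a m = ∏ i ∈ Finset.range m, g (a + 2 * i) := by
  induction k generalizing a m with
  | zero =>
    rw [pow_zero] at hm
    interval_cases m <;> simp [oddProd, Nat.beq]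
  | succ k ih =>
    rw [oddProd]
    rcases le_or_gt m (2 ^ k) with h | h
    · rw [Nat.ble_eq_true_of_le h, cond_true, ih a m h]
    · have : Nat.ble m (2 ^ k) = false := by
        rw [← Bool.not_eq_true, Nat.ble_eq]; omega
      obtain ⟨d, rfl⟩ := Nat.exists_eq_add_of_le h.le
      rw [this, cond_false, ih _ _ le_rfl, ih _ _ (by rw [pow_succ] at hm; omega),
        Finset.prod_range_add, Nat.add_sub_cancel_left]
      simp only [mul_add, add_assoc]

lemma prod_primesBelow_succ (h : ℕ → ℕ) (z : ℕ) :
    ∏ p ∈ (z + 1).primesBelow, h p =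
      (∏ p ∈ z.primesBelow, h p) * if z.Prime then h z else 1 := by
  simp only [Nat.primesBelow, Finset.prod_filter, Finset.prod_range_succ]

lemma prod_primesBelow_add (h : ℕ → ℕ) {a : ℕ} (ha : Odd a) (ha1 : 1 < a) (m : ℕ)
    (hm : a + 2 * m ≤ 40000) :
    ∏ p ∈ (a + 2 * m).primesBelow, h p = (∏ p ∈ a.primesBelow, h p) *
      ∏ i ∈ Finset.range m, bif primeTest (a + 2 * i) then h (a + 2 * i) else 1 := by
  induction m with
  | zero => simp
  | succ m ih =>
    have hnp : ¬ (a + 2 * m + 1).Prime := fun hp => by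
      obtain ⟨b, rfl⟩ := ha
      have := hp.eq_two_or_odd
      omega
    rw [Finset.prod_range_succ, ← mul_assoc, ← ih (by omega),
      show a + 2 * (m + 1) = a + 2 * m + 1 + 1 by ring, prod_primesBelow_succ, if_neg hnp, mul_one,
      prod_primesBelow_succ]
    congr 1
    have := primeTest_iff (n := a + 2 * m) (by omega)
    by_cases hp : (a + 2 * m).Prime
    · rw [if_pos hp, this.2 hp, cond_true]
    · rw [if_neg hp, Bool.eq_false_iff.2 (mt this.1 hp), cond_false]

/-- `k n`, arranged so that `n` is evaluated first. -/
def evalFirst (n : ℕ) (k : ℕ → Bool) : Bool :=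
  match n with
  | 0 => k 0
  | n + 1 => k (n + 1)

lemma evalFirst_eq (n : ℕ) (k : ℕ → Bool) : evalFirst n k = k n := by
  cases n <;> rfl

/-- Checks the hypotheses of `totient_bound_of_mem_block` with `L = l / 4096` for `n ≥ Y`, where
`P / Q` is the bound for `n / φ n`. -/
def stepCheck (Y P Q l : ℕ) : Bool :=
  Nat.ble 4916 l &&
    (Nat.ble (2 ^ (8193 ^ l * (64 * 10 ^ 8) / (8191 ^ l * 69314718) + 1)) (Y ^ 64) &&
      Nat.ble (P * (l * 4096 * 10 ^ 6) + 1) (Q * (1781072 * l ^ 2 + 2506370 * 4096 ^ 2)))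

/-- Runs through consecutive blocks `[primeProd z * z, primeProd w * w)` with `w = z + 2 * m`,
for the pairs `(l, m)` in the list. -/
def blockCheck (N : ℕ) : List (ℕ × ℕ) → ℕ → ℕ → ℕ → Bool
  | [], z, P, _ => Nat.ble N (P * z)
  | (l, m) :: t, z, P, Q =>
    evalFirst (P * oddProd (fun n => bif primeTest n then n else 1) 12 z m) fun P' =>
      evalFirst (Q * oddProd (fun n => bif primeTest n then n - 1 else 1) 12 z m) fun Q' =>
        stepCheck (P * z) P' Q' l && (Nat.ble m 4096 && (Nat.ble (z + 2 * m) 39999 &&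
          (primeTest (z + 2 * m) && blockCheck N t (z + 2 * m) P' Q')))

lemma totient_bound_of_stepCheck {n z Y l : ℕ} (hz : z.Prime) (hn : n < primeProd z * z)
    (hY : Y ≤ n) (h : stepCheck Y (primeProd z) (primePredProd z) l = true) :
    (n:ℝ) / n.totient < Real.exp Real.eulerMascheroniConstant * Real.log (Real.log n) +
      2.50637 / Real.log (Real.log n) := by
  rw [stepCheck, Bool.and_eq_true, Bool.and_eq_true, Nat.ble_eq, Nat.ble_eq, Nat.ble_eq] at h
  obtain ⟨hl, hK, hR⟩ := h
  have hY0 : 0 < Y := by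
    rcases Nat.eq_zero_or_pos Y with rfl | h
    · have : 0 < 2 ^ (8193 ^ l * (64 * 10 ^ 8) / (8191 ^ l * 69314718) + 1) := by positivity
      rw [zero_pow (by norm_num)] at hK
      omega
    · exact h
  have hl' : (4916:ℝ) ≤ l := by exact_mod_cast hl
  have hexp := exp_div_le_log (l := l) hK (by
    have h0 : 0 < 8191 ^ l * 69314718 := by positivity
    exact (Nat.lt_mul_div_succ _ h0).le)
  refine totient_bound_of_mem_block (L := (l:ℝ) / 4096) hz hn (hY0.trans_le hY) (by linarith)
    (hexp.trans (Real.log_le_log (by exact_mod_cast hY0) (by exact_mod_cast hY))) ?_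
  have hQ : (0:ℝ) < primePredProd z := by exact_mod_cast primePredProd_pos z
  have hR' : (primeProd z : ℝ) * (l * 4096 * 10 ^ 6) <
      primePredProd z * (1781072 * l ^ 2 + 2506370 * 4096 ^ 2) := by
    exact_mod_cast Nat.lt_of_succ_le hR
  have h1 : (primeProd z : ℝ) / primePredProd z <
      (1781072 * l ^ 2 + 2506370 * 4096 ^ 2) / (l * 4096 * 10 ^ 6) := by
    rw [div_lt_div_iff₀ hQ (by positivity)]
    linarith
  have h2 : ((1781072:ℝ) * l ^ 2 + 2506370 * 4096 ^ 2) / (l * 4096 * 10 ^ 6) =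
      1.781072 * (l / 4096) + 2.50637 / (l / 4096) := by
    have : (l:ℝ) ≠ 0 := by linarith
    field_simp
    ring
  linarith

lemma totient_bound_of_blockCheck {N n : ℕ} (hnN : n < N) (t : List (ℕ × ℕ)) {z : ℕ}
    (hz : z.Prime) (hz2 : z ≠ 2)
    (hc : blockCheck N t z (primeProd z) (primePredProd z) = true) (hn : primeProd z * z ≤ n) :
    (n:ℝ) / n.totient < Real.exp Real.eulerMascheroniConstant * Real.log (Real.log n) +
      2.50637 / Real.log (Real.log n) := by
  induction t generalizing z with
  | nil =>
    rw [blockCheck, Nat.ble_eq] at hc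
    omega
  | cons lm t ih =>
    obtain ⟨l, m⟩ := lm
    simp only [blockCheck, evalFirst_eq, Bool.and_eq_true, Nat.ble_eq] at hc
    obtain ⟨hstep, hm, hw, hp, ht⟩ := hc
    have hzo := hz.odd_of_ne_two hz2
    rw [oddProd_eq _ _ _ _ (by omega), primeProd,
      ← prod_primesBelow_add (fun p => p) hzo hz.one_lt m (by omega), ← primeProd,
      oddProd_eq _ _ _ _ (by omega), primePredProd,
      ← prod_primesBelow_add (fun p => p - 1) hzo hz.one_lt m (by omega), ← primePredProd] at hstep ht
    rw [primeTest_iff (by omega)] at hp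
    rcases lt_or_ge n (primeProd (z + 2 * m) * (z + 2 * m)) with h | h
    · exact totient_bound_of_stepCheck hp h hn hstep
    · have := hz.two_le
      exact ih hp (by omega) ht h


lemma exp_le_log_primorial_twenty_three :
    Real.exp 2.9561126 ≤ Real.log 223092870 := by
  have h1 : 19.2230986 ≤ Real.log 223092870 := by
    have h := (log_succ_sub_log_bounds (t := 134217728 / 88875142) (by norm_num) 8).1
    have e : Real.log 223092870 = 27 * Real.log 2 +
        (Real.log (134217728 / 88875142 + 1) - Real.log (134217728 / 88875142)) := by
      rw [← Real.log_div (by norm_num) (by norm_num)]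
      have : Real.log ((2:ℝ) ^ 27) = 27 * Real.log 2 := by rw [Real.log_pow]; norm_num
      rw [← this, ← Real.log_mul (by norm_num) (by norm_num)]
      norm_num
    rw [e]
    have h2 := Real.log_two_gt_d9
    generalize Real.log (134217728 / 88875142 + 1) - Real.log (134217728 / 88875142) = d at *
    norm_num [Finset.sum_range_succ] at h ⊢
    linarith
  refine le_trans ?_ h1
  have h := (log_succ_sub_log_bounds (t := 16 / 3.2230986) (by norm_num) 6).1
  rw [← Real.le_log_iff_exp_le (by norm_num)]
  have e : Real.log 19.2230986 = 4 * Real.log 2 +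
      (Real.log (16 / 3.2230986 + 1) - Real.log (16 / 3.2230986)) := by
    rw [← Real.log_div (by norm_num) (by norm_num)]
    have : Real.log ((2:ℝ) ^ 4) = 4 * Real.log 2 := by rw [Real.log_pow]; norm_num
    rw [← this, ← Real.log_mul (by norm_num) (by norm_num)]
    norm_num
  rw [e]
  have h2 := Real.log_two_gt_d9
  generalize Real.log (16 / 3.2230986 + 1) - Real.log (16 / 3.2230986) = d at *
  norm_num [Finset.sum_range_succ] at h ⊢
  linarith

lemma primeProd_seven : primeProd 7 = 30 := by decide +kernel

lemma primePredProd_seven : primePredProd 7 = 8 := by decide +kernel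
lemma primeProd_twenty_nine : primeProd 29 = 223092870 := by decide +kernel

lemma primePredProd_twenty_nine : primePredProd 29 = 36495360 := by decide +kernel

lemma blockCheck_seven : blockCheck 223092870
    [(6861, 2), (8384, 1), (9552, 2), (10549, 1), (11377, 2)] 7 (primeProd 7) (primePredProd 7) = true := by
  rw [primeProd_seven, primePredProd_seven]
  decide +kernel

lemma blockCheck_twenty_nine : blockCheck (2 ^ 52395)
    [(12767, 1), (13347, 3), (13880, 2), (14364, 1), (14801, 2), (15205, 3), (15585, 3),
    (15941, 1), (16270, 3), (16582, 3), (17152, 5), (17666, 7), (18134, 3), (18564, 3),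
    (18957, 11), (19498, 9), (19988, 7), (20435, 9), (20974, 9), (21460, 17), (22009, 15),
    (22503, 15), (23036, 27), (23594, 21), (24163, 27), (24732, 30), (25294, 42), (25846, 36),
    (26426, 49), (26981, 53), (27546, 67), (28110, 66), (28694, 86), (29261, 99), (29850, 112),
    (30428, 138), (31008, 147), (31581, 182), (32155, 177), (32722, 228), (33288, 238),
    (33854, 302), (34420, 331), (34980, 365), (35541, 444), (36101, 495), (36657, 558),
    (37209, 618), (37758, 760), (38302, 780), (38842, 944), (39380, 1036), (39914, 1194),
    (40444, 1325), (40971, 1527), (41493, 1674), (42010, 1929), (42524, 2130)] 29 (primeProd 29)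
      (primePredProd 29) = true := by
  rw [primeProd_twenty_nine, primePredProd_twenty_nine]
  decide +kernel

lemma lt_two_pow_of_log_log_lt {n : ℕ} (hn : 1 < n) (hu : Real.log (Real.log n) < 10.5) :
    n < 2 ^ 52395 := by
  have hl : 0 < Real.log n := Real.log_pos (by exact_mod_cast hn)
  have h1 : Real.log n < Real.exp 10.5 := (Real.log_lt_iff_lt_exp hl).1 hu
  have h2 : Real.exp 10.5 ≤ 36317 := by
    refine le_of_pow_le_pow_left₀ two_ne_zero (by norm_num) ?_
    have := Real.exp_one_lt_d9
    calc Real.exp 10.5 ^ 2 = Real.exp 1 ^ 21 := by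
          rw [← Real.exp_nat_mul, ← Real.exp_nat_mul]; norm_num
      _ ≤ 2.7182818286 ^ 21 := by gcongr
      _ ≤ 36317 ^ 2 := by norm_num
  have h3 := Real.log_two_gt_d9
  have h4 : Real.log n < Real.log ((2 ^ 52395 : ℕ) : ℝ) := by
    rw [Nat.cast_pow, Real.log_pow]
    push_cast
    linarith
  have h5 := (Real.log_lt_log_iff (by exact_mod_cast (by omega : 0 < n)) (by positivity)).1 h4
  exact_mod_cast h5

lemma totient_bound_of_lt {n : ℕ} (hn : 3 ≤ n) (h : n < 210) :
    (n:ℝ) / n.totient < Real.exp Real.eulerMascheroniConstant * Real.log (Real.log n) +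
      2.50637 / Real.log (Real.log n) := by
  have h1 := div_totient_le_of_lt (n := n) (z := 7) (by norm_num) (by omega)
    (by rw [primeProd_seven]; exact h)
  rw [primeProd_seven, primePredProd_seven] at h1
  have hu : 0 < Real.log (Real.log n) := by
    refine Real.log_pos ?_
    rw [Real.lt_log_iff_exp_lt (by positivity)]
    have : (3:ℝ) ≤ n := by exact_mod_cast hn
    linarith [Real.exp_one_lt_d9]
  generalize Real.log (Real.log n) = u at hu ⊢
  have h2 : 1.7810724 * u ≤ Real.exp Real.eulerMascheroniConstant * u := by
    gcongr
    exact exp_eulerMascheroniConstant_ge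
  have h3 : 3.75 < 1.7810724 * u + 2.50637 / u := by
    rw [← sub_pos, show 1.7810724 * u + 2.50637 / u - 3.75 =
      (1.7810724 * u ^ 2 + 2.50637 - 3.75 * u) / u by field_simp]
    refine div_pos ?_ hu
    nlinarith [sq_nonneg (u - 1)]
  norm_num at h1
  linarith

end

/-- Rosser–Schoenfeld (1962): for every integer `n ≥ 3`,
`n / φ(n) < e^γ log log n + 2.50637 / log log n`. -/
theorem rosser_schoenfeld_totient_bound (n : ℕ) (hn : 3 ≤ n) :
    (n : ℝ) / (Nat.totient n : ℝ) <
      Real.exp Real.eulerMascheroniConstant * Real.log (Real.log n) +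
        2.50637 / Real.log (Real.log n) := by
  rcases le_or_gt 10.5 (Real.log (Real.log n)) with hu | hu
  · exact totient_bound_of_log_log_ge hn hu
  rcases lt_or_ge n 210 with h1 | h1
  · exact totient_bound_of_lt hn h1
  rcases lt_or_ge n 223092870 with h2 | h2
  · refine totient_bound_of_blockCheck h2 _ (z := 7) (by norm_num) (by norm_num)
      blockCheck_seven (by rwa [primeProd_seven])
  rcases lt_or_ge n (primeProd 29 * 29) with h3 | h3
  · refine totient_bound_of_mem_block (z := 29) (L := 2.9561126) (by norm_num) h3 (by omega)
      (by norm_num) (exp_le_log_primorial_twenty_three.trans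
        (Real.log_le_log (by norm_num) (by exact_mod_cast h2))) ?_
    rw [primeProd_twenty_nine, primePredProd_twenty_nine]
    norm_num
  · refine totient_bound_of_blockCheck (lt_two_pow_of_log_log_lt (by omega) hu) _ (z := 29)
      (by norm_num) (by norm_num) blockCheck_twenty_nine h3
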